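/- arXiv:1404.3911 — 3 statements merged into one kernel-verified Lean document; each statement's English description precedes it below -/
import Mathlib

section
/- Let k be an algebraically closed field and let r > 2 and d₁ ≥ d₂ ≥ ⋯ ≥ d_r ≥ 1 be integers with d₁ ≥ s−1 and 2p − 3s > 0 (where s = d₂+⋯+d_r, D = Σ_{1≤i<j≤r} d_i d_j, p = D − d₁s, d = d₁+⋯+d_r). Then there exist nonzero homogeneous polynomials F₁,…,F_r, G₁,…,G_r ∈ k[x₀,x₁,x₂] with deg F_i = deg G_i = d_i such that dim_k (I_F ∩ I_G)_d = C(d₁−s+2, 2); moreover for every such choice of nonzero forms, dim_k (I_F ∩ I_G)_d ≥ C(d₁−s+2, 2). (Lemma 4.10(i): for general [F],[G] ∈ X_{2,λ} with d₁ ≥ s−1 and 2p−3s > 0, dim (I_Z)_d = C(d₁−s+2, 2).) -/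
open MvPolynomial Finset

/-- The ideal `I_F = ⋂_{i<j} (F_i, F_j)` associated to a tuple of forms. -/
noncomputable def idealOfForms {k : Type*} [Field k] {r : ℕ}
    (F : Fin r → MvPolynomial (Fin 3) k) : Ideal (MvPolynomial (Fin 3) k) :=
  ⨅ (i : Fin r) (j : Fin r) (_ : i < j), Ideal.span {F i, F j}

/-- `dim_k (I)_n`, the dimension of the degree-`n` homogeneous part of the ideal `I`. -/
noncomputable def gradedDim {k : Type*} [Field k]
    (I : Ideal (MvPolynomial (Fin 3) k)) (n : ℕ) : ℕ :=
  Module.finrank k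
    ↥(Submodule.restrictScalars k I ⊓ homogeneousSubmodule (Fin 3) k n)

/-- `D = Σ_{1 ≤ i < j ≤ r} d_i d_j`. -/
def Dval {r : ℕ} (d : Fin r → ℕ) : ℕ :=
  ∑ q ∈ univ.filter (fun q : Fin r × Fin r => q.1 < q.2), d q.1 * d q.2

/-- `s = d_2 + ⋯ + d_r`. -/
def sval {r : ℕ} (d : Fin r → ℕ) : ℕ :=
  ∑ i ∈ univ.filter (fun i : Fin r => i.val ≠ 0), d i

/-- `p = Σ_{2 ≤ i < j ≤ r} d_i d_j = D - d_1 s`. -/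
def pval {r : ℕ} (d : Fin r → ℕ) : ℕ :=
  ∑ q ∈ univ.filter (fun q : Fin r × Fin r => q.1 < q.2 ∧ q.1.val ≠ 0), d q.1 * d q.2

section

variable {k : Type*} [Field k]

/-- The line `x + c y + c² z`. -/
noncomputable def conicLine (c : k) : MvPolynomial (Fin 3) k :=
  X 0 + C c * X 1 + C (c ^ 2) * X 2

/-- The intersection point of `conicLine a` and `conicLine b`. -/
def conicPoint (a b : k) : Fin 3 → k := ![a * b, -(a + b), 1]

/-- Restriction of a form to `conicLine c`, in the affine coordinate `b ↦ conicPoint c b`. -/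
noncomputable def restrictLine (c : k) : MvPolynomial (Fin 3) k →ₐ[k] Polynomial k :=
  aeval ![Polynomial.C c * Polynomial.X, -(Polynomial.C c + Polynomial.X), 1]

/-- Elimination of the variable `x` by means of the equation of `conicLine c`. -/
noncomputable def eliminateLine (c : k) :
    MvPolynomial (Fin 3) k →ₐ[k] MvPolynomial (Fin 3) k :=
  aeval ![-(C c * X 1 + C (c ^ 2) * X 2), X 1, X 2]

lemma conicPoint_comm (a b : k) : conicPoint a b = conicPoint b a := by
  simp [conicPoint, mul_comm, add_comm]

lemma eval_conicLine (a b c : k) :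
    eval (conicPoint a b) (conicLine c) = (c - a) * (c - b) := by
  simp [conicLine, conicPoint]
  ring

lemma isHomogeneous_conicLine (c : k) : (conicLine c).IsHomogeneous 1 :=
  ((isHomogeneous_X k 0).add (isHomogeneous_C_mul_X c 1)).add (isHomogeneous_C_mul_X (c ^ 2) 2)

lemma conicLine_ne_zero (c : k) : conicLine c ≠ 0 := by
  intro h
  have := congrArg (eval ![1, 0, 0]) h
  simp [conicLine] at this

lemma eval_restrictLine (c b : k) (H : MvPolynomial (Fin 3) k) :
    (restrictLine c H).eval b = eval (conicPoint c b) H := by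
  have : ((Polynomial.aeval b).comp (restrictLine c)) = MvPolynomial.aeval (conicPoint c b) := by
    ext i
    fin_cases i <;> simp [restrictLine, conicPoint]
  simpa [Polynomial.aeval_def, aeval_eq_eval] using DFunLike.congr_fun this H

lemma natDegree_restrictLine_le (c : k) {H : MvPolynomial (Fin 3) k} {n : ℕ}
    (hH : H.IsHomogeneous n) : (restrictLine c H).natDegree ≤ n := by
  refine (aeval_natDegree_le H hH.totalDegree_le _ (n := 1) fun i => ?_).trans (by simp)
  fin_cases i
  · change (Polynomial.C c * Polynomial.X).natDegree ≤ 1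
    compute_degree
  · change (-(Polynomial.C c + Polynomial.X)).natDegree ≤ 1
    compute_degree
  · simp

lemma MvPolynomial.IsHomogeneous.eval_smul_point {H : MvPolynomial (Fin 3) k} {n : ℕ}
    (hH : H.IsHomogeneous n) (c : k) (v : Fin 3 → k) :
    eval (c • v) H = c ^ n * eval v H := by
  rw [eval_eq', eval_eq', mul_sum]
  refine sum_congr rfl fun m hm => ?_
  have hn : ∑ i, m i = n := by
    simpa [Finsupp.weight_apply, Finsupp.sum_fintype] using hH (mem_support_iff.mp hm)
  simp only [Pi.smul_apply, smul_eq_mul, mul_pow, prod_mul_distrib, prod_pow_eq_pow_sum, hn]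
  ring

lemma eliminateLine_eq_zero [Infinite k] (c : k) {H : MvPolynomial (Fin 3) k} {n : ℕ}
    (hH : H.IsHomogeneous n) (h : restrictLine c H = 0) : eliminateLine c H = 0 := by
  have key : X 2 * eliminateLine c H = 0 := by
    refine MvPolynomial.funext fun v => ?_
    have hv : eval v (eliminateLine c H) = eval ![-(c * v 1 + c ^ 2 * v 2), v 1, v 2] H := by
      have : ((MvPolynomial.aeval v).comp (eliminateLine c)) =
          (MvPolynomial.aeval ![-(c * v 1 + c ^ 2 * v 2), v 1, v 2] :
            MvPolynomial (Fin 3) k →ₐ[k] k) := by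
        ext i
        fin_cases i <;> simp [eliminateLine]
      simpa [aeval_eq_eval] using DFunLike.congr_fun this H
    by_cases h2 : v 2 = 0
    · simp [h2]
    · have h0 := eval_restrictLine c (-(v 1 / v 2) - c) H
      rw [h, Polynomial.eval_zero] at h0
      have hs : (![-(c * v 1 + c ^ 2 * v 2), v 1, v 2] : Fin 3 → k) =
          v 2 • conicPoint c (-(v 1 / v 2) - c) := by
        ext i
        fin_cases i
        · simp [conicPoint]; field_simp; ring
        · simp [conicPoint]; field_simp
        · simp [conicPoint]
      rw [map_mul, hv, hs, hH.eval_smul_point, ← h0]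
      simp
  exact (mul_eq_zero.mp key).resolve_left (X_ne_zero 2)

lemma conicLine_dvd_of_eliminateLine (c : k) {H : MvPolynomial (Fin 3) k}
    (h : eliminateLine c H = 0) : conicLine c ∣ H := by
  have : (Ideal.Quotient.mkₐ k (Ideal.span {conicLine c})).comp (eliminateLine c) =
      Ideal.Quotient.mkₐ k (Ideal.span {conicLine c}) := by
    ext i
    fin_cases i
    · simp only [eliminateLine, AlgHom.comp_apply, aeval_X, Ideal.Quotient.mkₐ_eq_mk]
      rw [Ideal.Quotient.eq, Ideal.mem_span_singleton]
      exact ⟨-1, by simp [conicLine]; ring⟩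
    · simp [eliminateLine]
    · simp [eliminateLine]
  have h2 := DFunLike.congr_fun this H
  rw [AlgHom.comp_apply, h, map_zero, eq_comm, Ideal.Quotient.mkₐ_eq_mk,
    Ideal.Quotient.eq_zero_iff_mem, Ideal.mem_span_singleton] at h2
  exact h2

lemma eliminateLine_conicLine_ne_zero {a c : k} (h : a ≠ c) :
    eliminateLine c (conicLine a) ≠ 0 := by
  intro h0
  have := congrArg (eval ![0, 1, 0]) h0
  simp [eliminateLine, conicLine] at this
  exact h (by linear_combination this)

lemma prod_conicLine_dvd (s : Finset k) (H : MvPolynomial (Fin 3) k)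
    (h : ∀ c ∈ s, eliminateLine c H = 0) : ∏ c ∈ s, conicLine c ∣ H := by
  classical
  induction s using Finset.induction_on generalizing H with
  | empty => simp
  | insert a s ha ih =>
    obtain ⟨H', rfl⟩ := conicLine_dvd_of_eliminateLine a (h a (mem_insert_self a s))
    rw [prod_insert ha]
    refine mul_dvd_mul_left _ (ih H' fun c hc => ?_)
    have := h c (mem_insert_of_mem hc)
    rw [map_mul] at this
    exact (mul_eq_zero.mp this).resolve_left
      (eliminateLine_conicLine_ne_zero fun e => ha (e ▸ hc))

lemma homogeneousComponent_mul_left {F : MvPolynomial (Fin 3) k} {m : ℕ}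
    (hF : F.IsHomogeneous m) (P : MvPolynomial (Fin 3) k) (n : ℕ) :
    homogeneousComponent n (F * P) =
      if m ≤ n then F * homogeneousComponent (n - m) P else 0 := by
  have h (i : ℕ) : homogeneousComponent n (F * homogeneousComponent i P) =
      if n = m + i then F * homogeneousComponent i P else 0 :=
    homogeneousComponent_of_mem (hF.mul (homogeneousComponent_isHomogeneous i P))
  conv_lhs => rw [← sum_homogeneousComponent P, mul_sum, map_sum]
  simp_rw [h]
  split_ifs with hmn
  · have h' (i : ℕ) : (if n = m + i then F * homogeneousComponent i P else 0) =
        if n - m = i then F * homogeneousComponent i P else 0 := by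
      congr 1
      exact propext (by omega)
    simp_rw [h', sum_ite_eq]
    split_ifs with hi
    · rfl
    · rw [mem_range] at hi
      rw [homogeneousComponent_eq_zero _ P (by omega), mul_zero]
  · exact sum_eq_zero fun i _ => if_neg (by omega)

lemma exists_isHomogeneous_of_mem_span_pair {F G H : MvPolynomial (Fin 3) k} {l m n : ℕ}
    (hF : F.IsHomogeneous m) (hG : G.IsHomogeneous l) (hH : H.IsHomogeneous (m + n))
    (h : H ∈ Ideal.span {F, G}) :
    ∃ A B : MvPolynomial (Fin 3) k, A.IsHomogeneous n ∧ H = F * A + G * B := by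
  obtain ⟨A, B, hAB⟩ := Ideal.mem_span_pair.mp h
  refine ⟨homogeneousComponent n A,
    if l ≤ m + n then homogeneousComponent (m + n - l) B else 0,
    homogeneousComponent_isHomogeneous n A, ?_⟩
  have h' := congrArg (homogeneousComponent (m + n)) hAB
  rw [homogeneousComponent_eq_self hH, map_add, mul_comm A F, mul_comm B G,
    homogeneousComponent_mul_left hF, homogeneousComponent_mul_left hG] at h'
  simp [← h']

lemma mem_idealOfForms {r : ℕ} {F : Fin r → MvPolynomial (Fin 3) k}
    {H : MvPolynomial (Fin 3) k} :
    H ∈ idealOfForms F ↔ ∀ i j, i < j → H ∈ Ideal.span {F i, F j} := by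
  simp [idealOfForms]

lemma mem_span_pair_of_mem_idealOfForms {r : ℕ} {F : Fin r → MvPolynomial (Fin 3) k}
    {H : MvPolynomial (Fin 3) k} (h : H ∈ idealOfForms F) {i j : Fin r} (hij : i ≠ j) :
    H ∈ Ideal.span {F i, F j} := by
  rcases hij.lt_or_gt with hlt | hlt
  · exact mem_idealOfForms.mp h i j hlt
  · rw [Set.pair_comm]
    exact mem_idealOfForms.mp h j i hlt

lemma eval_eq_zero_of_mem_idealOfForms {r : ℕ} {F : Fin r → MvPolynomial (Fin 3) k}
    {H : MvPolynomial (Fin 3) k} (h : H ∈ idealOfForms F) {i j : Fin r} (hij : i ≠ j)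
    {v : Fin 3 → k} (hi : eval v (F i) = 0) (hj : eval v (F j) = 0) : eval v H = 0 := by
  obtain ⟨A, B, rfl⟩ := Ideal.mem_span_pair.mp (mem_span_pair_of_mem_idealOfForms h hij)
  simp [hi, hj]

/-- A product of lines tangent to the conic, one for each index below `s` in the fibre of `γ`
over `c`. -/
noncomputable def lineProduct {r : ℕ} (γ : ℕ → Fin r) (s : ℕ) (a : ℕ → k) (c : Fin r) :
    MvPolynomial (Fin 3) k :=
  ∏ i ∈ range s with γ i = c, conicLine (a i)

lemma isHomogeneous_lineProduct {r : ℕ} (γ : ℕ → Fin r) (s : ℕ) (a : ℕ → k) (c : Fin r) :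
    (lineProduct γ s a c).IsHomogeneous #{i ∈ range s | γ i = c} := by
  simpa [lineProduct] using IsHomogeneous.prod {i ∈ range s | γ i = c}
    (fun i => conicLine (a i)) (fun _ => 1)
    fun i _ => isHomogeneous_conicLine (a i)

lemma lineProduct_ne_zero {r : ℕ} (γ : ℕ → Fin r) (s : ℕ) (a : ℕ → k) (c : Fin r) :
    lineProduct γ s a c ≠ 0 :=
  prod_ne_zero_iff.mpr fun i _ => conicLine_ne_zero (a i)

lemma eval_lineProduct_left {r : ℕ} (γ : ℕ → Fin r) {s i : ℕ} (a : ℕ → k) (hi : i < s) (b : k) :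
    eval (conicPoint (a i) b) (lineProduct γ s a (γ i)) = 0 := by
  rw [lineProduct, map_prod]
  exact prod_eq_zero (i := i) (by simp [hi]) (by simp [eval_conicLine])

/-- If a form `H` of degree `e + s` in the ideal of a tuple consisting of a form of degree `e` and
products of `s` lines vanishes at sufficiently many further points of these lines, then it vanishes
on all of them. -/
lemma restrictLine_eq_zero_of_card_le {r : ℕ} [NeZero r] {F : Fin r → MvPolynomial (Fin 3) k}
    {H : MvPolynomial (Fin 3) k} {s e : ℕ} {γ : ℕ → Fin r} {a : ℕ → k}
    (ha : ∀ i < s, ∀ j < s, a i = a j → i = j) (hγ : ∀ i < s, γ i ≠ 0)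
    (hF : (F 0).IsHomogeneous e) (hFγ : ∀ c, c ≠ 0 → F c = lineProduct γ s a c)
    (hH : H.IsHomogeneous (e + s)) (hI : H ∈ idealOfForms F)
    (hnode : ∀ i < s, ∀ j < s, i ≠ j → eval (conicPoint (a i) (a j)) (F 0) ≠ 0)
    (Z : ℕ → Finset k)
    (hZa : ∀ i < s, ∀ z ∈ Z i, ∀ j < s, a j ≠ z)
    (hZH : ∀ i < s, ∀ z ∈ Z i, eval (conicPoint (a i) z) H = 0)
    (hZF : ∀ i < s, ∀ z ∈ Z i, eval (conicPoint (a i) z) (F 0) ≠ 0)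
    (hcard : ∀ i < s, 1 + #{j ∈ range (i + 1) | γ j = γ i} ≤ #(Z i)) :
    ∀ i < s, restrictLine (a i) H = 0 := by
  intro i
  induction hn : s - i using Nat.strong_induction_on generalizing i with
  | _ n ih =>
  intro hi
  have hF' : F (γ i) = lineProduct γ s a (γ i) := hFγ _ (hγ i hi)
  obtain ⟨A, B, hA, hAB⟩ := exists_isHomogeneous_of_mem_span_pair hF
    (hF' ▸ isHomogeneous_lineProduct γ s a (γ i)) hH
    (mem_span_pair_of_mem_idealOfForms hI (hγ i hi).symm)
  have hev (z : k) : eval (conicPoint (a i) z) H =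
      eval (conicPoint (a i) z) (F 0) * eval (conicPoint (a i) z) A := by
    rw [hAB, map_add, map_mul, map_mul, hF', eval_lineProduct_left γ a hi, zero_mul, add_zero]
  set T := {j ∈ range s | ¬ (j ≤ i ∧ γ j = γ i)} with hT
  have hTH (j : ℕ) (hj : j ∈ T) : eval (conicPoint (a i) (a j)) H = 0 := by
    simp only [hT, mem_filter, mem_range, not_and'] at hj
    by_cases hγj : γ j = γ i
    · have hij := hj.2 hγj
      rw [conicPoint_comm, ← eval_restrictLine, ih (s - j) (by omega) j rfl hj.1,
        Polynomial.eval_zero]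
    · refine eval_eq_zero_of_mem_idealOfForms hI hγj ?_ ?_
      · rw [hFγ _ (hγ j hj.1), conicPoint_comm, eval_lineProduct_left γ a hj.1]
      · rw [hF', eval_lineProduct_left γ a hi]
  have hTcard : #T + #{j ∈ range (i + 1) | γ j = γ i} = s := by
    have h1 := card_filter_add_card_filter_not (s := range s) (fun j => j ≤ i ∧ γ j = γ i)
    have h2 : ({j ∈ range s | j ≤ i ∧ γ j = γ i} : Finset ℕ) =
        {j ∈ range (i + 1) | γ j = γ i} := by
      ext j
      simp only [mem_filter, mem_range]
      constructor
      · rintro ⟨_, h, h'⟩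
        exact ⟨by omega, h'⟩
      · rintro ⟨h, h'⟩
        exact ⟨by omega, by omega, h'⟩
    rw [h2, card_range, add_comm] at h1
    convert h1
  classical
  have hdisj : Disjoint (Z i) (T.image a) := by
    rw [Finset.disjoint_left]
    intro z hz hz'
    obtain ⟨j, hj, rfl⟩ := mem_image.mp hz'
    exact hZa i hi _ hz j (by simpa using (mem_filter.mp hj).1) rfl
  have hinj : #(T.image a) = #T := card_image_of_injOn fun j hj l hl h =>
    ha j (by simpa using (mem_filter.mp hj).1) l (by simpa using (mem_filter.mp hl).1) h
  have hA0 : restrictLine (a i) A = 0 := by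
    refine Polynomial.eq_zero_of_natDegree_lt_card_of_eval_eq_zero' _ (Z i ∪ T.image a) ?_ ?_
    · intro z hz
      rw [eval_restrictLine]
      rcases mem_union.mp hz with hz | hz
      · exact (mul_eq_zero.mp ((hev z).symm.trans (hZH i hi z hz))).resolve_left (hZF i hi z hz)
      · obtain ⟨j, hj, rfl⟩ := mem_image.mp hz
        refine (mul_eq_zero.mp ((hev _).symm.trans (hTH j hj))).resolve_left
          (hnode i hi j (by simpa using (mem_filter.mp hj).1) ?_)
        rintro rfl
        simp [hT] at hj
    · rw [card_union_of_disjoint hdisj, hinj]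
      have := natDegree_restrictLine_le (a i) hA
      have := hcard i hi
      omega
  have hline : restrictLine (a i) (conicLine (a i)) = 0 := by
    simp [restrictLine, conicLine]
    ring
  have hprod : restrictLine (a i) (lineProduct γ s a (γ i)) = 0 := by
    rw [lineProduct, map_prod]
    exact prod_eq_zero (i := i) (by simp [hi]) hline
  rw [hAB, map_add, map_mul, map_mul, hA0, hF', hprod, mul_zero, zero_mul, add_zero]

lemma finrank_homogeneousSubmodule (n : ℕ) :
    Module.finrank k (homogeneousSubmodule (Fin 3) k n) = (n + 2).choose 2 := by
  have hset : {m : Fin 3 →₀ ℕ | m.degree = n} = 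
      ((univ : Finset (Fin 3)).finsuppAntidiag n : Set (Fin 3 →₀ ℕ)) := by
    ext m
    simp [mem_finsuppAntidiag, Finsupp.degree_eq_sum]
  have hsub : homogeneousSubmodule (Fin 3) k n = restrictSupport k {m | m.degree = n} :=
    homogeneousSubmodule_eq_finsupp_supported (Fin 3) k n
  rw [hsub, Module.finrank_eq_nat_card_basis
    (basisRestrictSupport k {m : Fin 3 →₀ ℕ | m.degree = n}),
    hset, Nat.card_eq_card_toFinset, Finset.toFinset_coe, card_finsuppAntidiag_nat_eq_choose,
    card_fin, show 3 + n - 1 = n + 2 by omega]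
  exact Nat.choose_symm_of_eq_add rfl

instance finite_homogeneousSubmodule (n : ℕ) : Module.Finite k (homogeneousSubmodule (Fin 3) k n) :=
  Module.Finite.iff_fg.mpr (homogeneousSubmodule_fg (Fin 3) k n)

lemma finrank_map_mulLeft {P : MvPolynomial (Fin 3) k} (hP : P ≠ 0) (n : ℕ) :
    Module.finrank k ((homogeneousSubmodule (Fin 3) k n).map (LinearMap.mulLeft k P)) =
      (n + 2).choose 2 := by
  rw [← finrank_homogeneousSubmodule (k := k)]
  exact (Submodule.equivMapOfInjective _ (mul_right_injective₀ hP) _).finrank_eq.symm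

lemma choose_le_gradedDim {I : Ideal (MvPolynomial (Fin 3) k)} {P : MvPolynomial (Fin 3) k}
    {m : ℕ} (hP : P ≠ 0) (hPm : P.IsHomogeneous m) (hPI : P ∈ I) (n : ℕ) :
    (n + 2 - m).choose 2 ≤ gradedDim I n := by
  rcases lt_or_ge n m with h | h
  · rw [Nat.choose_eq_zero_of_lt (by omega)]
    exact Nat.zero_le _
  · obtain ⟨l, rfl⟩ := Nat.exists_eq_add_of_le h
    rw [show m + l + 2 - m = l + 2 by omega, ← finrank_map_mulLeft hP]
    have : Module.Finite k
        ↥(Submodule.restrictScalars k I ⊓ homogeneousSubmodule (Fin 3) k (m + l)) :=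
      Submodule.finiteDimensional_inf_right _ _
    refine Submodule.finrank_mono (Submodule.map_le_iff_le_comap.mpr fun Q hQ => ?_)
    exact ⟨I.mul_mem_right Q hPI, hPm.mul hQ⟩

lemma gradedDim_le_choose {I : Ideal (MvPolynomial (Fin 3) k)} {P : MvPolynomial (Fin 3) k}
    {m n : ℕ} (hP : P ≠ 0) (hPm : P.IsHomogeneous m)
    (h : ∀ H ∈ I, H.IsHomogeneous n → P ∣ H) :
    gradedDim I n ≤ (n + 2 - m).choose 2 := by
  have hdvd (H : MvPolynomial (Fin 3) k) (hHI : H ∈ I) (hHn : H.IsHomogeneous n) :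
      ∃ Q : MvPolynomial (Fin 3) k,
        H = if m ≤ n then P * homogeneousComponent (n - m) Q else 0 := by
    obtain ⟨Q, rfl⟩ := h H hHI hHn
    exact ⟨Q, by rw [← homogeneousComponent_mul_left hPm, homogeneousComponent_eq_self hHn]⟩
  rcases lt_or_ge n m with hnm | hnm
  · have : Submodule.restrictScalars k I ⊓ homogeneousSubmodule (Fin 3) k n = ⊥ := by
      rw [eq_bot_iff]
      rintro H ⟨hHI, hHn⟩
      obtain ⟨Q, rfl⟩ := hdvd H hHI hHn
      simp [hnm.not_ge]
    rw [gradedDim, this, finrank_bot]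
    exact Nat.zero_le _
  · rw [show n + 2 - m = n - m + 2 by omega, ← finrank_map_mulLeft hP]
    refine Submodule.finrank_mono ?_
    rintro H ⟨hHI, hHn⟩
    obtain ⟨Q, hQ⟩ := hdvd H hHI hHn
    exact ⟨_, homogeneousComponent_isHomogeneous (n - m) Q, by rw [hQ, if_pos hnm]; rfl⟩

lemma prod_mem_idealOfForms {r : ℕ} (F : Fin r → MvPolynomial (Fin 3) k) :
    ∏ c with c.val ≠ 0, F c ∈ idealOfForms F := by
  refine mem_idealOfForms.mpr fun i j hij => ?_
  refine Ideal.mem_of_dvd _ (dvd_prod_of_mem F (a := j) ?_) (Ideal.subset_span (by simp))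
  have : i.val < j.val := hij
  simp
  omega

lemma choose_le_gradedDim_idealOfForms {r : ℕ} [NeZero r] {d : Fin r → ℕ}
    {F G : Fin r → MvPolynomial (Fin 3) k}
    (hF : ∀ i, F i ≠ 0 ∧ (F i).IsHomogeneous (d i))
    (hG : ∀ i, G i ≠ 0 ∧ (G i).IsHomogeneous (d i)) (n : ℕ) :
    (n + 2 - (sval d + sval d)).choose 2 ≤ gradedDim (idealOfForms F ⊓ idealOfForms G) n :=
  choose_le_gradedDim
    (mul_ne_zero (prod_ne_zero_iff.mpr fun i _ => (hF i).1)
      (prod_ne_zero_iff.mpr fun i _ => (hG i).1))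
    ((IsHomogeneous.prod _ _ _ fun i _ => (hF i).2).mul
      (IsHomogeneous.prod _ _ _ fun i _ => (hG i).2))
    (Ideal.mem_inf.mpr ⟨Ideal.mul_mem_right _ _ (prod_mem_idealOfForms F),
      Ideal.mul_mem_left _ _ (prod_mem_idealOfForms G)⟩) n

lemma sum_eq_add_sval {r : ℕ} [NeZero r] (d : Fin r → ℕ) : ∑ i, d i = d 0 + sval d := by
  have h : (univ.filter fun i : Fin r => i.val ≠ 0) = univ.erase 0 := by
    ext i
    simp [Fin.val_eq_zero_iff]
  rw [sval, h, add_sum_erase _ _ (mem_univ 0)]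

lemma prod_conicLine_dvd_of_restrictLine [Infinite k] (S : Finset k)
    {H : MvPolynomial (Fin 3) k} {n : ℕ} (hH : H.IsHomogeneous n)
    (h : ∀ c ∈ S, restrictLine c H = 0) : ∏ c ∈ S, conicLine c ∣ H :=
  prod_conicLine_dvd S H fun c hc => eliminateLine_eq_zero c hH (h c hc)

/-- The tuple with first entry `E` whose other entries are products of lines. -/
noncomputable def linesTuple {r : ℕ} [NeZero r] (γ : ℕ → Fin r) (s : ℕ) (a : ℕ → k)
    (E : MvPolynomial (Fin 3) k) (c : Fin r) : MvPolynomial (Fin 3) k :=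
  if c = 0 then E else lineProduct γ s a c

lemma linesTuple_zero {r : ℕ} [NeZero r] (γ : ℕ → Fin r) (s : ℕ) (a : ℕ → k)
    (E : MvPolynomial (Fin 3) k) : linesTuple γ s a E 0 = E :=
  if_pos rfl

lemma linesTuple_of_ne_zero {r : ℕ} [NeZero r] (γ : ℕ → Fin r) (s : ℕ) (a : ℕ → k)
    (E : MvPolynomial (Fin 3) k) {c : Fin r} (hc : c ≠ 0) :
    linesTuple γ s a E c = lineProduct γ s a c :=
  if_neg hc

lemma linesTuple_spec {r : ℕ} [NeZero r] {d : Fin r → ℕ} {γ : ℕ → Fin r} {s : ℕ}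
    (hγd : ∀ c, c ≠ 0 → #{i ∈ range s | γ i = c} = d c) (a : ℕ → k)
    {E : MvPolynomial (Fin 3) k} (hE : E ≠ 0) (hEd : E.IsHomogeneous (d 0)) (c : Fin r) :
    linesTuple γ s a E c ≠ 0 ∧ (linesTuple γ s a E c).IsHomogeneous (d c) := by
  by_cases hc : c = 0
  · subst hc
    rw [linesTuple_zero]
    exact ⟨hE, hEd⟩
  · rw [linesTuple_of_ne_zero γ s a E hc, ← hγd c hc]
    exact ⟨lineProduct_ne_zero γ s a c, isHomogeneous_lineProduct γ s a c⟩

/-- Sufficient conditions on the lines and on the form `E` for the tuples built from them to attain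
the minimal dimension. -/
lemma exists_gradedDim_eq_choose [Infinite k] [DecidableEq k] {r : ℕ} [NeZero r] {d : Fin r → ℕ}
    (hd : sval d ≤ d 0 + 1) {s : ℕ} (hds : sval d = s) (hs : 0 < s)
    {γ : ℕ → Fin r} (hγ : ∀ i < s, γ i ≠ 0)
    (hγd : ∀ c, c ≠ 0 → #{i ∈ range s | γ i = c} = d c)
    {a b : ℕ → k} (ha : ∀ i < s, ∀ j < s, a i = a j → i = j)
    (hb : ∀ i < s, ∀ j < s, b i = b j → i = j) (hab : ∀ i < s, ∀ j < s, a i ≠ b j)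
    {E : MvPolynomial (Fin 3) k} (hE : E.IsHomogeneous (s - 1))
    (hnode : ∀ i < s, ∀ j < s, i ≠ j → eval (conicPoint (a i) (a j)) E ≠ 0)
    {R : ℕ → ℕ} (hR : ∀ i < s, 1 + #{j ∈ range (i + 1) | γ j = γ i} ≤ R i)
    (hcol : ∀ j < s, R j ≤ #{i ∈ range s | eval (conicPoint (a i) (b j)) E = 0})
    (hrow : ∀ i < s, R i ≤ #{j ∈ range s | eval (conicPoint (a i) (b j)) E ≠ 0}) :
    ∃ F G : Fin r → MvPolynomial (Fin 3) k,
      (∀ i, F i ≠ 0 ∧ (F i).IsHomogeneous (d i)) ∧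
      (∀ i, G i ≠ 0 ∧ (G i).IsHomogeneous (d i)) ∧
      gradedDim (idealOfForms F ⊓ idealOfForms G) (∑ i, d i) =
        (d 0 + 2 - sval d).choose 2 := by
  have hE0 : E ≠ 0 := by
    rintro rfl
    have h1 := hR 0 hs
    have h2 := hrow 0 hs
    simp at h2
    omega
  set E' : MvPolynomial (Fin 3) k := E * X 2 ^ (d 0 + 1 - s) with hE'
  have hE'0 : E' ≠ 0 := mul_ne_zero hE0 (pow_ne_zero _ (X_ne_zero 2))
  have hE'd : E'.IsHomogeneous (d 0) := by
    have := hE.mul (isHomogeneous_X_pow (R := k) (2 : Fin 3) (d 0 + 1 - s))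
    rwa [show s - 1 + (d 0 + 1 - s) = d 0 by omega] at this
  have hevE (x y : k) : eval (conicPoint x y) E' = eval (conicPoint x y) E := by
    simp [hE', conicPoint]
  have hX0 : (X 2 : MvPolynomial (Fin 3) k) ^ d 0 ≠ 0 := pow_ne_zero _ (X_ne_zero 2)
  have hXd := isHomogeneous_X_pow (R := k) (2 : Fin 3) (d 0)
  have hevX (x y : k) : eval (conicPoint x y) ((X 2 : MvPolynomial (Fin 3) k) ^ d 0) ≠ 0 := by
    simp [conicPoint]
  have hF := linesTuple_spec hγd a hE'0 hE'd
  have hG := linesTuple_spec hγd b hX0 hXd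
  refine ⟨_, _, hF, hG, le_antisymm ?_ ?_⟩
  · set S := (range s).image a ∪ (range s).image b with hS
    have hScard : #S = s + s := by
      rw [hS, card_union_of_disjoint, card_image_of_injOn, card_image_of_injOn, card_range]
      · simpa [Set.InjOn] using hb
      · simpa [Set.InjOn] using ha
      · simpa [Finset.disjoint_left] using fun i hi j hj => (hab i hi j hj).symm
    have hle : gradedDim (idealOfForms (linesTuple γ s a E') ⊓
        idealOfForms (linesTuple γ s b (X 2 ^ d 0))) (∑ i, d i) ≤
          (∑ i, d i + 2 - #S).choose 2 := by
      refine gradedDim_le_choose (P := ∏ c ∈ S, conicLine c)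
        (prod_ne_zero_iff.mpr fun c _ => conicLine_ne_zero c)
        (by simpa using IsHomogeneous.prod S conicLine (fun _ => 1)
              fun c _ => isHomogeneous_conicLine c) fun H hHI hH => ?_
      obtain ⟨hHF, hHG⟩ := Ideal.mem_inf.mp hHI
      refine prod_conicLine_dvd_of_restrictLine S hH ?_
      rw [sum_eq_add_sval, hds] at hH
      have hHb : ∀ j < s, restrictLine (b j) H = 0 := by
        refine restrictLine_eq_zero_of_card_le hb hγ (linesTuple_zero γ s b _ ▸ hXd)
          (fun c hc => linesTuple_of_ne_zero γ s b _ hc) hH hHG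
          (fun i _ j _ _ => linesTuple_zero γ s b _ ▸ hevX _ _)
          (fun j => {i ∈ range s | eval (conicPoint (a i) (b j)) E = 0}.image a) ?_ ?_ ?_ ?_
        · simp only [mem_image, mem_filter, mem_range]
          rintro j hj _ ⟨i, ⟨hi, -⟩, rfl⟩ l hl
          exact (hab i hi l hl).symm
        · simp only [mem_image, mem_filter, mem_range]
          rintro j hj _ ⟨i, ⟨hi, hij⟩, rfl⟩
          rw [conicPoint_comm]
          refine eval_eq_zero_of_mem_idealOfForms hHF (hγ i hi) ?_ ?_
          · rw [linesTuple_of_ne_zero γ s a _ (hγ i hi), eval_lineProduct_left γ a hi]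
          · rw [linesTuple_zero, hevE, hij]
        · exact fun j _ z _ => linesTuple_zero γ s b _ ▸ hevX _ _
        · intro j hj
          rw [card_image_of_injOn]
          · exact (hR j hj).trans (hcol j hj)
          · intro i hi l hl
            simp only [coe_filter, mem_range, Set.mem_ofPred_eq] at hi hl
            exact ha i hi.1 l hl.1
      have hHa : ∀ i < s, restrictLine (a i) H = 0 := by
        refine restrictLine_eq_zero_of_card_le ha hγ (linesTuple_zero γ s a _ ▸ hE'd)
          (fun c hc => linesTuple_of_ne_zero γ s a _ hc) hH hHF ?_
          (fun i => {j ∈ range s | eval (conicPoint (a i) (b j)) E ≠ 0}.image b) ?_ ?_ ?_ ?_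
        · intro i hi j hj hij
          rw [linesTuple_zero, hevE]
          exact hnode i hi j hj hij
        · simp only [mem_image, mem_filter, mem_range]
          rintro i hi _ ⟨j, ⟨hj, -⟩, rfl⟩ l hl
          exact hab l hl j hj
        · simp only [mem_image, mem_filter, mem_range]
          rintro i hi _ ⟨j, ⟨hj, hij⟩, rfl⟩
          rw [conicPoint_comm, ← eval_restrictLine, hHb j hj, Polynomial.eval_zero]
        · simp only [mem_image, mem_filter, mem_range]
          rintro i hi _ ⟨j, ⟨hj, hij⟩, rfl⟩
          rwa [linesTuple_zero, hevE]
        · intro i hi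
          rw [card_image_of_injOn]
          · exact (hR i hi).trans (hrow i hi)
          · intro j hj l hl
            simp only [coe_filter, mem_range, Set.mem_ofPred_eq] at hj hl
            exact hb j hj.1 l hl.1
      intro c hc
      rcases mem_union.mp hc with hc | hc
      · obtain ⟨i, hi, rfl⟩ := mem_image.mp hc
        exact hHa i (mem_range.mp hi)
      · obtain ⟨j, hj, rfl⟩ := mem_image.mp hc
        exact hHb j (mem_range.mp hj)
    rwa [hScard, sum_eq_add_sval,
      show d 0 + sval d + 2 - (s + s) = d 0 + 2 - sval d by omega, ← sum_eq_add_sval] at hle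
  · have := choose_le_gradedDim_idealOfForms hF hG (∑ i, d i)
    rwa [sum_eq_add_sval,
      show d 0 + sval d + 2 - (sval d + sval d) = d 0 + 2 - sval d by omega,
      ← sum_eq_add_sval] at this

lemma exists_forall_eval_ne_zero [Infinite k] {ι : Type*} (T : Finset ι) (p : ι → Polynomial k)
    (hp : ∀ i ∈ T, p i ≠ 0) : ∃ u : k, ∀ i ∈ T, (p i).eval u ≠ 0 := by
  by_contra! h
  refine prod_ne_zero_iff.mpr hp (Polynomial.funext fun u => ?_)
  obtain ⟨i, hi, hu⟩ := h u
  rw [Polynomial.eval_prod, Polynomial.eval_zero]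
  exact prod_eq_zero hi hu

lemma exists_injOn_pow [Infinite k] (N : ℕ) :
    ∃ t : k, ∀ m ≤ N, ∀ n ≤ N, t ^ m = t ^ n → m = n := by
  obtain ⟨t, ht⟩ := exists_forall_eval_ne_zero (k := k)
    ((range (N + 1) ×ˢ range (N + 1)).filter fun q => q.1 ≠ q.2)
    (fun q => Polynomial.X ^ q.1 - Polynomial.X ^ q.2) fun q hq => by
      rw [sub_ne_zero]
      exact fun h => (mem_filter.mp hq).2 (by simpa using congrArg Polynomial.natDegree h)
  refine ⟨t, fun m hm n hn h => ?_⟩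
  by_contra hmn
  refine ht (m, n) ?_ (by simp [h])
  simp only [mem_filter, mem_product, mem_range]
  exact ⟨⟨by omega, by omega⟩, hmn⟩

lemma exists_isHomogeneous_forall_eval_ne_zero [Infinite k] {N l : ℕ}
    (Q : ℕ → MvPolynomial (Fin 3) k) (hQ : ∀ m < N, (Q m).IsHomogeneous l)
    {ι : Type*} (T : Finset ι) (v : ι → Fin 3 → k)
    (hT : ∀ x ∈ T, ∃ m < N, eval (v x) (Q m) ≠ 0) :
    ∃ E : MvPolynomial (Fin 3) k, E.IsHomogeneous l ∧ (∀ x ∈ T, eval (v x) E ≠ 0) ∧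
      ∀ w, (∀ m < N, eval w (Q m) = 0) → eval w E = 0 := by
  obtain ⟨u, hu⟩ := exists_forall_eval_ne_zero T
    (fun x => ∑ m ∈ range N, Polynomial.monomial m (eval (v x) (Q m))) fun x hx h0 => by
      obtain ⟨m, hm, h⟩ := hT x hx
      refine h ?_
      have := congrArg (Polynomial.coeff · m) h0
      simpa [Polynomial.finsetSum_coeff, Polynomial.coeff_monomial, hm] using this
  refine ⟨∑ m ∈ range N, C (u ^ m) * Q m,
    IsHomogeneous.sum _ _ _ fun m hm => (hQ m (mem_range.mp hm)).C_mul _,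
    fun x hx => ?_, fun w hw => ?_⟩
  · have := hu x hx
    simp only [Polynomial.eval_finsetSum, Polynomial.eval_monomial] at this
    simpa [mul_comm] using this
  · rw [map_sum]
    exact sum_eq_zero fun m hm => by simp [hw m (mem_range.mp hm)]

/-- The line `x = c z`. -/
noncomputable def polarLine (c : k) : MvPolynomial (Fin 3) k := X 0 - C c * X 2

lemma eval_polarLine (a b c : k) : eval (conicPoint a b) (polarLine c) = a * b - c := by
  simp [polarLine, conicPoint]

lemma isHomogeneous_polarLine (c : k) : (polarLine c).IsHomogeneous 1 :=
  (isHomogeneous_X k 0).sub (isHomogeneous_C_mul_X c 2)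

lemma isHomogeneous_prod_conicLine (T : Finset ℕ) (a : ℕ → k) :
    (∏ i ∈ T, conicLine (a i)).IsHomogeneous #T := by
  simpa using IsHomogeneous.prod T (fun i => conicLine (a i)) (fun _ => 1)
    fun i _ => isHomogeneous_conicLine (a i)

/-- Tangent lines to the conic at points `t ^ α i` and `t ^ β j`, together with a form `E` of
degree `s - 1` with prescribed vanishing at their intersection points. -/
lemma exists_lines_and_form [Infinite k] {α β : ℕ → ℕ} (hα : Function.Injective α)
    (hβ : Function.Injective β) (hαβ : ∀ i j, α i ≠ β j) {K : Finset ℕ} {n s : ℕ}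
    (hK : #K + 1 = n) (hns : n ≤ s) (hαα : ∀ i j, i ≠ j → α i + α j ∉ K) :
    ∃ (a b : ℕ → k) (E : MvPolynomial (Fin 3) k),
      (∀ i < s, ∀ j < s, a i = a j → i = j) ∧ (∀ i < s, ∀ j < s, b i = b j → i = j) ∧
      (∀ i < s, ∀ j < s, a i ≠ b j) ∧ E.IsHomogeneous (s - 1) ∧
      (∀ i < s, ∀ j < s, i ≠ j → eval (conicPoint (a i) (a j)) E ≠ 0) ∧
      (∀ i < s, ∀ j < s, n ≤ j ∧ i < j ∨ i < n ∧ j < n ∧ α i + β j ∈ K →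
        eval (conicPoint (a i) (b j)) E = 0) ∧
      (∀ i < s, ∀ j < s, j < n ∧ α i + β j ∉ K ∨ n ≤ j ∧ j < i →
        eval (conicPoint (a i) (b j)) E ≠ 0) := by
  set N := (range s).sup α + (range s).sup β + K.sup id with hN
  have hαN (i : ℕ) (hi : i < s) : α i ≤ N := by
    have := le_sup (f := α) (mem_range.mpr hi)
    omega
  have hβN (i : ℕ) (hi : i < s) : β i ≤ N := by
    have := le_sup (f := β) (mem_range.mpr hi)
    omega
  have hKN (c : ℕ) (hc : c ∈ K) : c ≤ N := by
    have := le_sup (f := id) hc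
    rw [id] at this
    omega
  obtain ⟨t, ht⟩ := exists_injOn_pow (k := k) (N + N)
  set a : ℕ → k := fun i => t ^ α i
  set b : ℕ → k := fun i => t ^ β i
  have ha : ∀ i < s, ∀ j < s, a i = a j → i = j := fun i hi j hj h => by
    have h1 := hαN i hi
    have h2 := hαN j hj
    exact hα (ht _ (by omega) _ (by omega) h)
  have hb : ∀ i < s, ∀ j < s, b i = b j → i = j := fun i hi j hj h => by
    have h1 := hβN i hi
    have h2 := hβN j hj
    exact hβ (ht _ (by omega) _ (by omega) h)
  have hab : ∀ i < s, ∀ j < s, a i ≠ b j := fun i hi j hj h => by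
    have h1 := hαN i hi
    have h2 := hβN j hj
    exact hαβ i j (ht _ (by omega) _ (by omega) h)
  have hsum (x y c : ℕ) (hx : x ≤ N) (hy : y ≤ N) (hc : c ≤ N) :
      t ^ x * t ^ y - t ^ c = 0 ↔ x + y = c := by
    rw [sub_eq_zero, ← pow_add]
    exact ⟨ht _ (by omega) _ (by omega), fun h => by rw [h]⟩
  set Q : ℕ → MvPolynomial (Fin 3) k := fun m =>
    if m < n then (∏ c ∈ K, polarLine (t ^ c)) * ∏ j ∈ Ico n s, conicLine (b j)
    else (∏ i ∈ range m, conicLine (a i)) * ∏ j ∈ Ioo m s, conicLine (b j) with hQ_def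
  have hQlt {m : ℕ} (hm : m < n) (x y : k) : eval (conicPoint x y) (Q m) =
      (∏ c ∈ K, (x * y - t ^ c)) * ∏ j ∈ Ico n s, (b j - x) * (b j - y) := by
    simp only [hQ_def, if_pos hm, map_mul, map_prod, eval_polarLine, eval_conicLine]
  have hQge {m : ℕ} (hm : n ≤ m) (x y : k) : eval (conicPoint x y) (Q m) =
      (∏ i ∈ range m, (a i - x) * (a i - y)) * ∏ j ∈ Ioo m s, (b j - x) * (b j - y) := by
    simp only [hQ_def, if_neg hm.not_gt, map_mul, map_prod, eval_conicLine]
  have hQ (m : ℕ) (hm : m < s) : (Q m).IsHomogeneous (s - 1) := by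
    by_cases hmn : m < n
    · have h1 := IsHomogeneous.prod K (fun c => polarLine (t ^ c)) (fun _ => 1)
        fun c _ => isHomogeneous_polarLine (t ^ c)
      have h2 := h1.mul (isHomogeneous_prod_conicLine (Ico n s) b)
      rw [sum_const, smul_eq_mul, mul_one, Nat.card_Ico,
        show #K + (s - n) = s - 1 by omega] at h2
      simpa only [hQ_def, if_pos hmn] using h2
    · have h2 := (isHomogeneous_prod_conicLine (range m) a).mul
        (isHomogeneous_prod_conicLine (Ioo m s) b)
      rw [card_range, Nat.card_Ioo, show m + (s - m - 1) = s - 1 by omega] at h2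
      simpa only [hQ_def, if_neg hmn] using h2
  let I := range s ×ˢ range s
  obtain ⟨E, hE, hEne, hE0⟩ := exists_isHomogeneous_forall_eval_ne_zero Q hQ
    ((I.filter fun q => q.1 ≠ q.2).disjSum
      (I.filter fun q => q.2 < n ∧ α q.1 + β q.2 ∉ K ∨ n ≤ q.2 ∧ q.2 < q.1))
    (Sum.elim (fun q => conicPoint (a q.1) (a q.2)) fun q => conicPoint (a q.1) (b q.2)) (by
      rintro (⟨i, j⟩ | ⟨i, j⟩) hx
      · simp only [I, inl_mem_disjSum, mem_filter, mem_product, mem_range] at hx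
        obtain ⟨⟨hi, hj⟩, hij⟩ := hx
        refine ⟨0, by omega, ?_⟩
        rw [Sum.elim_inl, hQlt (by omega)]
        refine mul_ne_zero (prod_ne_zero_iff.mpr fun c hc h => ?_)
          (prod_ne_zero_iff.mpr fun l hl => ?_)
        · exact hαα i j hij
            (((hsum _ _ c (hαN i hi) (hαN j hj) (hKN c hc)).mp h).symm ▸ hc)
        · have hl := (mem_Ico.mp hl).2
          exact mul_ne_zero (sub_ne_zero.mpr (hab i hi l hl).symm)
            (sub_ne_zero.mpr (hab j hj l hl).symm)
      · simp only [I, inr_mem_disjSum, mem_filter, mem_product, mem_range] at hx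
        obtain ⟨⟨hi, hj⟩, ⟨hjn, hij⟩ | ⟨hjn, hij⟩⟩ := hx
        · refine ⟨0, by omega, ?_⟩
          rw [Sum.elim_inr, hQlt (by omega)]
          refine mul_ne_zero (prod_ne_zero_iff.mpr fun c hc h => ?_)
            (prod_ne_zero_iff.mpr fun l hl => ?_)
          · exact hij (((hsum _ _ c (hαN i hi) (hβN j hj) (hKN c hc)).mp h).symm ▸ hc)
          · have hl := mem_Ico.mp hl
            exact mul_ne_zero (sub_ne_zero.mpr (hab i hi l hl.2).symm)
              (sub_ne_zero.mpr fun h => by have := hb l hl.2 j hj h; omega)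
        · refine ⟨j, hj, ?_⟩
          rw [Sum.elim_inr, hQge hjn]
          refine mul_ne_zero (prod_ne_zero_iff.mpr fun l hl => ?_)
            (prod_ne_zero_iff.mpr fun l hl => ?_)
          · have hl := mem_range.mp hl
            exact mul_ne_zero
              (sub_ne_zero.mpr fun h => by have := ha l (by omega) i hi h; omega)
              (sub_ne_zero.mpr (hab l (by omega) j hj))
          · have hl := mem_Ioo.mp hl
            exact mul_ne_zero (sub_ne_zero.mpr (hab i hi l hl.2).symm)
              (sub_ne_zero.mpr fun h => by have := hb l hl.2 j hj h; omega))
  refine ⟨a, b, E, ha, hb, hab, hE, fun i hi j hj hij => ?_, fun i hi j hj hij => ?_,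
    fun i hi j hj hij => ?_⟩
  · exact hEne (Sum.inl (i, j)) (by simp [I, hi, hj, hij])
  · refine hE0 _ fun m hm => ?_
    by_cases hmn : m < n
    · rw [hQlt hmn]
      rcases hij with ⟨hjn, -⟩ | ⟨-, -, hijK⟩
      · exact mul_eq_zero_of_right _ (prod_eq_zero (mem_Ico.mpr ⟨hjn, hj⟩) (by simp))
      · exact mul_eq_zero_of_left (prod_eq_zero hijK
          ((hsum _ _ _ (hαN i hi) (hβN j hj) (hKN _ hijK)).mpr rfl)) _
    · rw [hQge (by omega)]
      by_cases him : i < m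
      · exact mul_eq_zero_of_left (prod_eq_zero (mem_range.mpr him) (by simp)) _
      · exact mul_eq_zero_of_right _
          (prod_eq_zero (mem_Ioo.mpr ⟨(by omega : m < j), hj⟩) (by simp))
  · exact hEne (Sum.inr (i, j)) (by
      rw [inr_mem_disjSum, mem_filter, mem_product]
      exact ⟨⟨mem_range.mpr hi, mem_range.mpr hj⟩, hij⟩)

/-- Combinatorial data prescribing the vanishing of a form at the intersection points of two
families of `n` lines: `ρ i` bounds the number of zeros on the column `i` and of nonzeros on the
row `i`. -/
structure IsDesign (n M : ℕ) (α β ρ : ℕ → ℕ) (K : Finset ℕ) : Prop where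
  card_add_one : #K + 1 = n
  lt_left : ∀ i < n, α i < M
  lt_right : ∀ i < n, β i < M
  lt_of_mem : ∀ c ∈ K, c < M
  inj_left : ∀ i < n, ∀ j < n, α i = α j → i = j
  inj_right : ∀ i < n, ∀ j < n, β i = β j → i = j
  ne : ∀ i < n, ∀ j < n, α i ≠ β j
  add_notMem : ∀ i < n, ∀ j < n, i ≠ j → α i + α j ∉ K
  le_column : ∀ j < n, ρ j ≤ #{i ∈ range n | α i + β j ∈ K}
  le_row : ∀ i < n, ρ i ≤ #{j ∈ range n | α i + β j ∉ K}

lemma IsDesign.exists_gradedDim_eq [Infinite k] {n M : ℕ} {α β ρ : ℕ → ℕ} {K : Finset ℕ}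
    (h : IsDesign n M α β ρ K) {r : ℕ} [NeZero r] {d : Fin r → ℕ} (hd : sval d ≤ d 0 + 1)
    (hs : n ≤ sval d) {γ : ℕ → Fin r} (hγ : ∀ i < sval d, γ i ≠ 0)
    (hγd : ∀ c, c ≠ 0 → #{i ∈ range (sval d) | γ i = c} = d c)
    (hlt : ∀ i < n, 1 + #{j ∈ range (i + 1) | γ j = γ i} ≤ ρ i)
    (hge : ∀ i, n ≤ i → i < sval d → 1 + #{j ∈ range (i + 1) | γ j = γ i} ≤ i) :
    ∃ F G : Fin r → MvPolynomial (Fin 3) k,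
      (∀ i, F i ≠ 0 ∧ (F i).IsHomogeneous (d i)) ∧
      (∀ i, G i ≠ 0 ∧ (G i).IsHomogeneous (d i)) ∧
      gradedDim (idealOfForms F ⊓ idealOfForms G) (∑ i, d i) =
        (d 0 + 2 - sval d).choose 2 := by
  classical
  have hn := h.card_add_one
  obtain ⟨a, b, E, ha, hb, hab, hE, hnode, h0, h1⟩ := exists_lines_and_form (k := k)
    (α := fun i => if i < n then α i else M + 2 * i)
    (β := fun i => if i < n then β i else M + 2 * i + 1) (K := K) (n := n) (s := sval d)
    (fun i j hij => by
      have hi := h.lt_left i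
      have hj := h.lt_left j
      have := h.inj_left i
      grind)
    (fun i j hij => by
      have hi := h.lt_right i
      have hj := h.lt_right j
      have := h.inj_right i
      grind)
    (fun i j => by
      have hi := h.lt_left i
      have hj := h.lt_right j
      have := h.ne i
      grind)
    hn hs
    (fun i j hij hK => by
      have hM := h.lt_of_mem _ hK
      have := h.add_notMem i
      grind)
  refine exists_gradedDim_eq_choose hd rfl (by omega) hγ hγd ha hb hab hE hnode
    (R := fun i => if i < n then ρ i else i) (fun i hi => ?_) (fun j hj => ?_) fun i hi => ?_
  · by_cases hin : i < n
    · simpa [hin] using hlt i hin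
    · simpa [hin] using hge i (by omega) hi
  · by_cases hjn : j < n
    · simp only [if_pos hjn]
      refine (h.le_column j hjn).trans (card_le_card fun i hi => ?_)
      simp only [mem_filter, mem_range] at hi ⊢
      exact ⟨by omega, h0 i (by omega) j hj (Or.inr ⟨hi.1, hjn, by simp [hi.1, hjn, hi.2]⟩)⟩
    · simp only [if_neg hjn]
      refine (card_range j).symm.le.trans (card_le_card fun i hi => ?_)
      simp only [mem_filter, mem_range] at hi ⊢
      exact ⟨by omega, h0 i (by omega) j hj (Or.inl ⟨by omega, hi⟩)⟩
  · by_cases hin : i < n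
    · simp only [if_pos hin]
      refine (h.le_row i hin).trans (card_le_card fun j hj => ?_)
      simp only [mem_filter, mem_range] at hj ⊢
      exact ⟨by omega, h1 i hi j (by omega) (Or.inl ⟨hj.1, by simp [hin, hj.1, hj.2]⟩)⟩
    · simp only [if_neg hin]
      refine (card_range i).symm.le.trans (card_le_card fun j hj => ?_)
      simp only [mem_filter, mem_range] at hj ⊢
      refine ⟨by omega, h1 i hi j (by omega) ?_⟩
      by_cases hjn : j < n
      · refine Or.inl ⟨hjn, fun hK => ?_⟩
        have hM := h.lt_of_mem _ hK
        simp only [if_neg hin] at hM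
        omega
      · exact Or.inr ⟨by omega, hj⟩

lemma isDesign_five : IsDesign 5 30 ([6, 9, 4, 1, 11].getD · 0) ([10, 2, 3, 0, 5].getD · 0)
    ([2, 2, 2, 3, 3].getD · 0) {6, 9, 11, 14} := by
  constructor <;> decide

lemma isDesign_six : IsDesign 6 30 ([9, 5, 7, 13, 1, 17].getD · 0) ([8, 0, 4, 10, 2, 6].getD · 0)
    ([2, 2, 2, 3, 4, 5].getD · 0) {7, 11, 13, 15, 19} := by
  constructor <;> decide

lemma isDesign_six' :
    IsDesign 6 30 ([12, 9, 11, 7, 14, 13].getD · 0) ([5, 0, 6, 4, 3, 1].getD · 0)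
      ([2, 2, 3, 3, 4, 4].getD · 0) {10, 12, 13, 15, 17} := by
  constructor <;> decide

lemma isDesign_eight :
    IsDesign 8 30 ([5, 1, 3, 7, 9, 13, 17, 21].getD · 0) ([14, 16, 12, 10, 6, 8, 0, 4].getD · 0)
      ([2, 2, 3, 3, 4, 5, 6, 7].getD · 0) {5, 7, 9, 11, 13, 17, 21} := by
  constructor <;> decide

lemma card_filter_getD_eq_count {ι : Type*} [DecidableEq ι] (L : List ι) (x c : ι) :
    #{i ∈ range L.length | L.getD i x = c} = L.count c := by
  induction L using List.reverseRecOn with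
  | nil => simp
  | append_singleton L y ih =>
    rw [List.length_append, List.length_singleton, range_add_one, filter_insert,
      List.count_append, ← ih]
    have h1 : ({i ∈ range L.length | (L ++ [y]).getD i x = c} : Finset ℕ) =
        {i ∈ range L.length | L.getD i x = c} :=
      filter_congr fun i hi => by rw [List.getD_append _ _ _ _ (mem_range.mp hi)]
    rw [h1]
    by_cases hy : y = c
    · rw [if_pos (by simp [hy]), card_insert_of_notMem (by simp)]
      simp [hy]
    · rw [if_neg (by simpa using hy)]
      simp [hy]

/-- Every list of nonzero indices in which each `c` occurs at most `d c` times extends to an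
enumeration in which each nonzero `c` occurs exactly `d c` times. -/
lemma exists_enumeration {r : ℕ} [NeZero r] (d : Fin r → ℕ) (l : List (Fin r)) (hl0 : 0 ∉ l)
    (hl : ∀ c, c ≠ 0 → l.count c ≤ d c) :
    ∃ γ : ℕ → Fin r, (∀ i < sval d, γ i ≠ 0) ∧
      (∀ c, c ≠ 0 → #{i ∈ range (sval d) | γ i = c} = d c) ∧
      ∀ i < l.length, γ i = l.getD i 0 := by
  set m : Multiset (Fin r) := ∑ c with c.val ≠ 0, Multiset.replicate (d c) c with hm
  have hcount (c : Fin r) : m.count c = if c = 0 then 0 else d c := by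
    rw [hm, Multiset.count_sum']
    simp only [Multiset.count_replicate, sum_ite_eq', mem_filter, mem_univ, true_and]
    by_cases hc : c = 0 <;> simp [hc, Fin.val_eq_zero_iff]
  have hlm : (l : Multiset (Fin r)) ≤ m := Multiset.le_iff_count.mpr fun c => by
    rw [hcount, Multiset.coe_count]
    split_ifs with hc
    · rw [hc, List.count_eq_zero_of_not_mem hl0]
    · exact hl c hc
  set L := l ++ (m - l).toList with hL
  have hLm : (L : Multiset (Fin r)) = m := by
    rw [hL, ← Multiset.coe_add, Multiset.coe_toList, add_tsub_cancel_of_le hlm]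
  have hLlen : L.length = sval d := by
    rw [← Multiset.coe_card, hLm, hm, Multiset.card_sum]
    simp [sval]
  have hLcount (c : Fin r) : L.count c = if c = 0 then 0 else d c := by
    rw [← Multiset.coe_count, hLm, hcount]
  refine ⟨fun i => L.getD i 0, fun i hi h0 => ?_, fun c hc => ?_, fun i hi => ?_⟩
  · have h1 := hLcount 0
    rw [if_pos rfl, List.count_eq_zero] at h1
    simp only at h0
    rw [List.getD_eq_getElem _ _ (hLlen ▸ hi)] at h0
    exact h1 (h0 ▸ List.getElem_mem _)
  · rw [← hLlen, card_filter_getD_eq_count, hLcount, if_neg hc]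
  · exact List.getD_append _ _ _ _ hi

lemma card_filter_add_card_le {ι : Type*} [DecidableEq ι] (γ : ℕ → ι) {i : ℕ} (T : Finset ℕ)
    (hT : ∀ j ∈ T, j ≤ i ∧ γ j ≠ γ i) :
    #{j ∈ range (i + 1) | γ j = γ i} + #T ≤ i + 1 := by
  have h := card_filter_add_card_filter_not (s := range (i + 1)) (fun j => γ j = γ i)
  have hle : #T ≤ #{j ∈ range (i + 1) | ¬ γ j = γ i} := card_le_card fun j hj => by
    have := hT j hj
    simp only [mem_filter, mem_range]
    exact ⟨by omega, this.2⟩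
  rw [card_range] at h
  omega

lemma card_filter_le_of_ne {ι : Type*} [DecidableEq ι] (γ : ℕ → ι) {i x y : ℕ} (hxy : x ≠ y)
    (hx : x ≤ i) (hy : y ≤ i) (hγx : γ x ≠ γ i) (hγy : γ y ≠ γ i) :
    1 + #{j ∈ range (i + 1) | γ j = γ i} ≤ i := by
  have := card_filter_add_card_le γ (i := i) {x, y} (by simp [*])
  rw [card_pair hxy] at this
  omega

lemma two_mul_pval_add_sum_sq {r : ℕ} (d : Fin r → ℕ) :
    2 * pval d + ∑ i with i.val ≠ 0, d i ^ 2 = sval d ^ 2 := by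
  set S := (univ : Finset (Fin r)).filter fun i => i.val ≠ 0 with hS
  have h1 : pval d = ∑ q ∈ S ×ˢ S with q.1 < q.2, d q.1 * d q.2 := by
    refine sum_congr ?_ fun _ _ => rfl
    ext ⟨i, j⟩
    simp only [hS, mem_filter, mem_univ, true_and, mem_product]
    constructor
    · rintro ⟨hij, hi⟩
      have : i.val < j.val := hij
      exact ⟨⟨hi, by omega⟩, hij⟩
    · rintro ⟨⟨hi, -⟩, hij⟩
      exact ⟨hij, hi⟩
  have h2 : pval d = ∑ q ∈ S ×ˢ S with q.2 < q.1, d q.1 * d q.2 := by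
    rw [h1]
    refine sum_nbij' Prod.swap Prod.swap ?_ ?_ ?_ ?_ ?_ <;>
      simp +contextual [mul_comm]
  have h3 : ∑ i ∈ S, d i ^ 2 = ∑ q ∈ S ×ˢ S with q.1 = q.2, d q.1 * d q.2 := by
    refine sum_nbij' (fun i => (i, i)) Prod.fst ?_ ?_ ?_ ?_ ?_ <;>
      simp +contextual [sq]
  have h4 : sval d ^ 2 = ∑ q ∈ S ×ˢ S, d q.1 * d q.2 := by
    rw [sq, sval, sum_mul_sum, sum_product]
  rw [h4, ← sum_filter_add_sum_filter_not (S ×ˢ S) (fun q => q.1 < q.2),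
    ← sum_filter_add_sum_filter_not ({q ∈ S ×ˢ S | ¬ q.1 < q.2}) (fun q => q.1 = q.2),
    filter_filter, filter_filter, h3, two_mul]
  nth_rewrite 1 [h1]
  rw [h2, add_assoc, add_comm (∑ q ∈ S ×ˢ S with q.2 < q.1, _)]
  congr 2
  · refine sum_congr (filter_congr fun q _ => ?_) fun _ _ => rfl
    constructor
    · intro h
      exact ⟨h.not_lt, h⟩
    · exact And.right
  · refine sum_congr (filter_congr fun q _ => ?_) fun _ _ => rfl
    rw [not_lt, ← lt_iff_le_and_ne.trans (and_congr_right fun _ => ne_comm)]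

lemma sq_add_sval_le {r : ℕ} {d : Fin r → ℕ} {c : Fin r} (hc : c.val ≠ 0) :
    d c ^ 2 + sval d ≤ ∑ i with i.val ≠ 0, d i ^ 2 + d c := by
  have hc' : c ∈ (univ : Finset (Fin r)).filter fun i => i.val ≠ 0 := by simp [hc]
  rw [sval, ← add_sum_erase _ _ hc', ← add_sum_erase _ (fun i => d i ^ 2) hc']
  have := sum_le_sum fun i (_ : i ∈ ((univ : Finset (Fin r)).filter fun i => i.val ≠ 0).erase c) =>
    Nat.le_self_pow two_ne_zero (d i)
  omega

lemma exists_gradedDim_eq_of_three_lt [Infinite k] {r : ℕ} [NeZero r] (hr : 3 < r) {d : Fin r → ℕ}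
    (hpos : ∀ i, 1 ≤ d i) (hds : sval d ≤ d 0 + 1) (hps : 3 * sval d < 2 * pval d) :
    ∃ F G : Fin r → MvPolynomial (Fin 3) k,
      (∀ i, F i ≠ 0 ∧ (F i).IsHomogeneous (d i)) ∧
      (∀ i, G i ≠ 0 ∧ (G i).IsHomogeneous (d i)) ∧
      gradedDim (idealOfForms F ⊓ idealOfForms G) (∑ i, d i) =
        (d 0 + 2 - sval d).choose 2 := by
  have hsq := two_mul_pval_add_sum_sq d
  have hle (c : Fin r) (hc : c.val ≠ 0) := sq_add_sval_le (d := d) hc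
  set c₁ : Fin r := ⟨1, by omega⟩ with hc₁
  set c₂ : Fin r := ⟨2, by omega⟩ with hc₂
  set c₃ : Fin r := ⟨3, by omega⟩ with hc₃
  have hs : 5 ≤ sval d := by
    have h1 := hle c₁ (by simp [hc₁])
    have h2 : d c₁ ≤ d c₁ ^ 2 := Nat.le_self_pow two_ne_zero _
    nlinarith
  have h12 : c₁ ≠ c₂ := by simp [hc₁, hc₂]
  have h13 : c₁ ≠ c₃ := by simp [hc₁, hc₃]
  have h23 : c₂ ≠ c₃ := by simp [hc₂, hc₃]
  obtain ⟨γ, hγ, hγd, hγl⟩ := exists_enumeration d [c₁, c₂, c₃]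
    (by simp [hc₁, hc₂, hc₃, Fin.ext_iff]) fun c _ =>
      (List.nodup_iff_count_le_one.mp (by simp [h12, h13, h23]) c).trans (hpos c)
  have hγ0 : γ 0 = c₁ := hγl 0 (by simp)
  have hγ1 : γ 1 = c₂ := hγl 1 (by simp)
  have hγ2 : γ 2 = c₃ := hγl 2 (by simp)
  have hge (i : ℕ) (hi : 2 < i) : 1 + #{j ∈ range (i + 1) | γ j = γ i} ≤ i := by
    by_cases h0 : γ 0 = γ i
    · exact card_filter_le_of_ne γ (x := 1) (y := 2) (by omega) (by omega) (by omega)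
        (by rw [← h0, hγ0, hγ1]; exact h12.symm) (by rw [← h0, hγ0, hγ2]; exact h13.symm)
    · by_cases h1 : γ 1 = γ i
      · exact card_filter_le_of_ne γ (x := 0) (y := 2) (by omega) (by omega) (by omega)
          h0 (by rw [← h1, hγ1, hγ2]; exact h23.symm)
      · exact card_filter_le_of_ne γ (x := 0) (y := 1) (by omega) (by omega) (by omega) h0 h1
  have hlt (i : ℕ) (hi : i ≤ 2) : 1 + #{j ∈ range (i + 1) | γ j = γ i} ≤ 2 := by
    have := card_filter_add_card_le γ (i := i) (range i) fun j hj => by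
      have hj := mem_range.mp hj
      refine ⟨hj.le, ?_⟩
      interval_cases i <;> interval_cases j <;> simp [hγ0, hγ1, hγ2, h12, h13, h23]
    rw [card_range] at this
    omega
  rcases hs.eq_or_lt with hs5 | hs6
  · have hd2 (c : Fin r) (hc : c.val ≠ 0) : d c ≤ 2 := by
      have h1 := hle c hc
      by_contra! h3
      nlinarith
    refine isDesign_five.exists_gradedDim_eq hds hs hγ hγd (fun i hi => ?_)
      fun i hi _ => hge i (by omega)
    by_cases hi3 : i ≤ 3
    · by_cases hi2 : i ≤ 2
      · refine (hlt i hi2).trans ?_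
        interval_cases i <;> simp
      · obtain rfl : i = 3 := by omega
        exact hge 3 (by omega)
    · obtain rfl : i = 4 := by omega
      have h4 := hγ 4 (by omega)
      have := (hγd _ h4).le.trans (hd2 (γ 4) (by simpa [Fin.val_eq_zero_iff] using h4))
      rw [← hs5] at this
      change 1 + #{j ∈ range 5 | γ j = γ 4} ≤ 3
      omega
  · refine isDesign_six.exists_gradedDim_eq hds hs6 hγ hγd (fun i hi => ?_)
      fun i hi _ => hge i (by omega)
    by_cases hi2 : i ≤ 2
    · refine (hlt i hi2).trans ?_
      interval_cases i <;> simp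
    · refine (hge i (by omega)).trans ?_
      interval_cases i <;> simp

lemma exists_gradedDim_eq_of_three [Infinite k] {d : Fin 3 → ℕ}
    (hanti : ∀ i j, i ≤ j → d j ≤ d i) (hds : sval d ≤ d 0 + 1)
    (hps : 3 * sval d < 2 * pval d) :
    ∃ F G : Fin 3 → MvPolynomial (Fin 3) k,
      (∀ i, F i ≠ 0 ∧ (F i).IsHomogeneous (d i)) ∧
      (∀ i, G i ≠ 0 ∧ (G i).IsHomogeneous (d i)) ∧
      gradedDim (idealOfForms F ⊓ idealOfForms G) (∑ i, d i) =
        (d 0 + 2 - sval d).choose 2 := by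
  have hs : sval d = d 1 + d 2 := by
    have h := sum_eq_add_sval d
    rw [Fin.sum_univ_three] at h
    omega
  have hp : pval d = d 1 * d 2 := by
    have : (univ.filter fun q : Fin 3 × Fin 3 => q.1 < q.2 ∧ q.1.val ≠ 0) = {(1, 2)} := by decide
    rw [pval, this, sum_singleton]
  have h21 : d 2 ≤ d 1 := hanti 1 2 (by decide)
  rw [hs, hp] at hps
  have h2 : 2 ≤ d 2 := by
    by_contra! h
    interval_cases d 2 <;> omega
  have hge {γ : ℕ → Fin 3} (hγ0 : γ 0 = 1) (hγ1 : γ 1 = 2) (hγ2 : γ 2 = 1) (hγ3 : γ 3 = 2)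
      (i : ℕ) (hi : 3 < i) : 1 + #{j ∈ range (i + 1) | γ j = γ i} ≤ i := by
    by_cases h : γ i = 1
    · exact card_filter_le_of_ne γ (x := 1) (y := 3) (by omega) (by omega) (by omega)
        (by simp [h, hγ1]) (by simp [h, hγ3])
    · exact card_filter_le_of_ne γ (x := 0) (y := 2) (by omega) (by omega) (by omega)
        (hγ0 ▸ Ne.symm h) (hγ2 ▸ Ne.symm h)
  rcases h2.eq_or_lt with h2 | h3
  · have hs8 : 8 ≤ sval d := by
      rw [← h2] at hps
      rw [hs]
      omega
    obtain ⟨γ, hγ, hγd, hγl⟩ := exists_enumeration d [1, 2, 1, 2] (by decide) fun c hc => by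
      fin_cases c <;> simp at hc ⊢ <;> omega
    have hγ0 : γ 0 = 1 := hγl 0 (by simp)
    have hγ1 : γ 1 = 2 := hγl 1 (by simp)
    have hγ2 : γ 2 = 1 := hγl 2 (by simp)
    have hγ3 : γ 3 = 2 := hγl 3 (by simp)
    refine isDesign_eight.exists_gradedDim_eq hds hs8 hγ hγd (fun i hi => ?_)
      fun i hi _ => hge hγ0 hγ1 hγ2 hγ3 i (by omega)
    by_cases hi4 : i ≤ 3
    · interval_cases i <;> simp [range_add_one, filter_insert, filter_singleton, hγ0, hγ1, hγ2, hγ3]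
    · refine (hge hγ0 hγ1 hγ2 hγ3 i (by omega)).trans ?_
      interval_cases i <;> simp
  · obtain ⟨γ, hγ, hγd, hγl⟩ := exists_enumeration d [1, 2, 1, 2, 1, 2] (by decide) fun c hc => by
      fin_cases c <;> simp at hc ⊢ <;> omega
    have hγ0 : γ 0 = 1 := hγl 0 (by simp)
    have hγ1 : γ 1 = 2 := hγl 1 (by simp)
    have hγ2 : γ 2 = 1 := hγl 2 (by simp)
    have hγ3 : γ 3 = 2 := hγl 3 (by simp)
    have hγ4 : γ 4 = 1 := hγl 4 (by simp)
    have hγ5 : γ 5 = 2 := hγl 5 (by simp)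
    refine isDesign_six'.exists_gradedDim_eq hds (by omega) hγ hγd (fun i hi => ?_)
      fun i hi _ => hge hγ0 hγ1 hγ2 hγ3 i (by omega)
    interval_cases i <;> simp [range_add_one, filter_insert, filter_singleton, hγ0, hγ1, hγ2, hγ3,
      hγ4, hγ5]

end

/-- Lemma 4.10(i): if `r > 2`, `d₁ ≥ s - 1` and `2p - 3s > 0`, then for general
`[F], [G] ∈ X_{2,λ}` one has `dim (I_F ∩ I_G)_d = C(d₁ - s + 2, 2)`; moreover this
value is always a lower bound. -/
theorem dim_equals_binom_unbalanced
    {k : Type*} [Field k] [IsAlgClosed k]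
    (r : ℕ) [NeZero r] (hr : 2 < r)
    (d : Fin r → ℕ)
    (hanti : ∀ i j : Fin r, i ≤ j → d j ≤ d i)
    (hpos : ∀ i, 1 ≤ d i)
    (hds : sval d ≤ d 0 + 1)
    (hps : 3 * sval d < 2 * pval d) :
    (∃ F G : Fin r → MvPolynomial (Fin 3) k,
      (∀ i, F i ≠ 0 ∧ (F i).IsHomogeneous (d i)) ∧
      (∀ i, G i ≠ 0 ∧ (G i).IsHomogeneous (d i)) ∧
      gradedDim (idealOfForms F ⊓ idealOfForms G) (∑ i, d i) =
        (d 0 + 2 - sval d).choose 2) ∧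
    (∀ F G : Fin r → MvPolynomial (Fin 3) k,
      (∀ i, F i ≠ 0 ∧ (F i).IsHomogeneous (d i)) →
      (∀ i, G i ≠ 0 ∧ (G i).IsHomogeneous (d i)) →
      (d 0 + 2 - sval d).choose 2 ≤
        gradedDim (idealOfForms F ⊓ idealOfForms G) (∑ i, d i)) := by
  refine ⟨?_, fun F G hF hG => ?_⟩
  · have : Infinite k := IsAlgClosed.instInfinite
    rcases Nat.lt_or_ge 3 r with hr4 | hr3
    · exact exists_gradedDim_eq_of_three_lt hr4 hpos hds hps
    · obtain rfl : r = 3 := by omega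
      exact exists_gradedDim_eq_of_three hanti hds hps
  · have := choose_le_gradedDim_idealOfForms hF hG (∑ i, d i)
    rwa [sum_eq_add_sval, show d 0 + sval d + 2 - (sval d + sval d) = d 0 + 2 - sval d by omega,
      ← sum_eq_add_sval] at this
end

section
/- Let r ≥ 2 and d₁ ≥ d₂ ≥ ⋯ ≥ d_r ≥ 1 be integers with d₁ ≥ s and 2p − 3s > 0 (where s = d₂+⋯+d_r, D = Σ_{1≤i<j≤r} d_i d_j, p = D − d₁s, d = d₁+⋯+d_r). Then C(d₁−s+2, 2) − max{0, C(d+2,2) − 2D} = min{C(d₁−s+2, 2), 2p − 3s}, and moreover C(d₁−s+2, 2) > 2p − 3s if and only if C(d+2,2) − 2D > 0. (Proposition 3.2: in the defective cases the 2-defect δ₂ equals 2p−3s when C(d+2,2) − 2D > 0 and equals C(d₁−s+2, 2) when C(d+2,2) − 2D ≤ 0.) -/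
open Finset

theorem sval_eq_sum_succ {n : ℕ} (d : Fin (n + 1) → ℕ) : sval d = ∑ i : Fin n, d i.succ := by
  simp [sval, sum_filter, Fin.sum_univ_succ]

theorem sum_eq_head_add_sval {n : ℕ} (d : Fin (n + 1) → ℕ) : ∑ i, d i = d 0 + sval d := by
  rw [sval_eq_sum_succ, Fin.sum_univ_succ]

theorem Dval_eq_head_mul_sval_add_pval {n : ℕ} (d : Fin (n + 1) → ℕ) :
    Dval d = d 0 * sval d + pval d := by
  simp [Dval, pval, sval_eq_sum_succ, sum_filter, Fintype.sum_prod_type, Fin.sum_univ_succ,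
    mul_sum]

theorem two_mul_choose_add_two (n : ℕ) :
    2 * ((n + 2).choose 2 : ℤ) = ((n : ℤ) + 2) * (n + 1) := by
  have h := Nat.add_one_mul_choose_eq (n + 1) 1
  rw [Nat.choose_one_right] at h
  zify at h
  linarith

theorem choose_sub_two_mul_Dval {n : ℕ} (d : Fin (n + 1) → ℕ) (hds : sval d ≤ d 0) :
    (((∑ i, d i) + 2).choose 2 : ℤ) - 2 * Dval d =
      ((d 0 + 2 - sval d).choose 2 : ℤ) - (2 * pval d - 3 * sval d) := by
  obtain ⟨a, ha⟩ := Nat.exists_eq_add_of_le hds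
  have hsub : d 0 + 2 - sval d = a + 2 := by omega
  rw [hsub, sum_eq_head_add_sval, Dval_eq_head_mul_sval_add_pval, ha]
  have h₁ := two_mul_choose_add_two a
  have h₂ := two_mul_choose_add_two (sval d + a + sval d)
  push_cast at h₁ h₂ ⊢
  linarith

/-- Proposition 3.2 (arithmetic form): if `d₁ ≥ s` and `2p - 3s > 0` then the 2-defect
`C(d₁-s+2,2) - max {0, C(d+2,2) - 2D}` equals `min {C(d₁-s+2,2), 2p - 3s}`, and
`C(d₁-s+2,2) > 2p - 3s` if and only if `C(d+2,2) - 2D > 0`. -/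
theorem defect_formula
    (r : ℕ) [NeZero r] (hr : 2 ≤ r)
    (d : Fin r → ℕ)
    (hanti : ∀ i j : Fin r, i ≤ j → d j ≤ d i)
    (hpos : ∀ i, 1 ≤ d i)
    (hds : sval d ≤ d 0)
    (hps : 3 * sval d < 2 * pval d) :
    ((d 0 + 2 - sval d).choose 2 : ℤ) -
        max 0 ((((∑ i, d i) + 2).choose 2 : ℤ) - 2 * Dval d) =
      min ((d 0 + 2 - sval d).choose 2 : ℤ) (2 * pval d - 3 * sval d) ∧
    (2 * (pval d : ℤ) - 3 * sval d < ((d 0 + 2 - sval d).choose 2 : ℤ) ↔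
      0 < (((∑ i, d i) + 2).choose 2 : ℤ) - 2 * Dval d) := by
  obtain ⟨n, rfl⟩ : ∃ n, r = n + 1 := ⟨r - 1, by omega⟩
  have h := choose_sub_two_mul_Dval d hds
  constructor
  · rw [h]
    omega
  · rw [h, sub_pos]
end

section
/- Let k be an algebraically closed field and let r ≥ 2 and d₁ ≥ d₂ ≥ ⋯ ≥ d_r ≥ 1 be integers with d₁ < s (s = d₂+⋯+d_r), and set d = d₁+⋯+d_r, D = Σ_{1≤i<j≤r} d_i d_j. Then there exist nonzero homogeneous polynomials F₁,…,F_r, G₁,…,G_r ∈ k[x₀,x₁,x₂] with deg F_i = deg G_i = d_i such that dim_k (I_F ∩ I_G)_d = max{0, C(d+2,2) − 2D}. (Proposition 4.7(i): below the hyperplane d₁ = d₂+⋯+d_r, (I_Z)_d always has the expected dimension for general [F],[G] ∈ X_{2,λ}.) -/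
open MvPolynomial Finset

namespace LineArrangement
open scoped Matrix

variable {k : Type*} [Field k]

/-- `Separates p S t`: forms of degree `t` separate the points `p i`, `i ∈ S`. -/
def Separates {ι : Type*} (p : ι → Fin 3 → k) (S : Finset ι) (t : ℕ) : Prop :=
  ∀ i ∈ S, ∃ f : MvPolynomial (Fin 3) k, f.IsHomogeneous t ∧ eval (p i) f ≠ 0 ∧
    ∀ j ∈ S, j ≠ i → eval (p j) f = 0

/-- The linear form with coefficient vector `v`. -/
noncomputable def lin (v : Fin 3 → k) : MvPolynomial (Fin 3) k :=
  ∑ i, C (v i) * X i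

lemma lin_isHomogeneous (v : Fin 3 → k) : (lin v).IsHomogeneous 1 :=
  IsHomogeneous.sum _ _ _ fun _ _ => (isHomogeneous_C_mul_X _ _)

lemma eval_lin (v x : Fin 3 → k) : eval x (lin v) = v ⬝ᵥ x := by
  simp [lin, dotProduct]

lemma exists_dot_ne_zero {v : Fin 3 → k} (hv : v ≠ 0) : ∃ w : Fin 3 → k, w ⬝ᵥ v ≠ 0 := by
  obtain ⟨i, hi⟩ := Function.ne_iff.mp hv
  exact ⟨Pi.single i 1, by simpa using hi⟩

/-- At most `t + 1` pairwise distinct points of the plane impose independent conditions on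
forms of degree `t`. -/
lemma separates_of_card_le {ι : Type*} {p : ι → Fin 3 → k} {S : Finset ι} {t : ℕ}
    (h0 : ∀ i ∈ S, p i ≠ 0) (h : ∀ i ∈ S, ∀ j ∈ S, i ≠ j → p i ⨯₃ p j ≠ 0)
    (hS : #S ≤ t + 1) : Separates p S t := by
  classical
  intro i hi
  have key : ∀ j, ∃ v : Fin 3 → k, j ∈ S.erase i → v ⬝ᵥ p i ≠ 0 ∧ v ⬝ᵥ p j = 0 := by
    intro j
    by_cases hj : j ∈ S.erase i
    · obtain ⟨w, hw⟩ :=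
        exists_dot_ne_zero (h i hi j (mem_of_mem_erase hj) (ne_of_mem_erase hj).symm)
      refine ⟨p j ⨯₃ w, fun _ => ⟨?_, by rw [dotProduct_comm, dot_self_cross]⟩⟩
      rwa [dotProduct_comm, triple_product_permutation, triple_product_permutation]
    · exact ⟨0, fun h => absurd h hj⟩
  choose v hv using key
  obtain ⟨w, hw⟩ := exists_dot_ne_zero (h0 i hi)
  refine ⟨(∏ j ∈ S.erase i, lin (v j)) * lin w ^ (t - #(S.erase i)), ?_, ?_, ?_⟩
  · have h1 : (∏ j ∈ S.erase i, lin (v j)).IsHomogeneous (∑ j ∈ S.erase i, 1) :=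
      IsHomogeneous.prod _ _ _ fun j _ => lin_isHomogeneous _
    have h2 := h1.mul ((lin_isHomogeneous w).pow (t - #(S.erase i)))
    have : #(S.erase i) ≤ t := by rw [card_erase_of_mem hi]; omega
    simpa [this] using h2
  · simp only [map_mul, map_prod, map_pow, eval_lin]
    exact mul_ne_zero (prod_ne_zero_iff.mpr fun j hj => (hv j hj).1) (pow_ne_zero _ hw)
  · intro j hj hji
    have hj' : j ∈ S.erase i := mem_erase.mpr ⟨hji, hj⟩
    simp only [map_mul, map_prod, map_pow, eval_lin]
    rw [prod_eq_zero hj' (hv j hj').2, zero_mul]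

/-- The Horace method for a line with equation `m`. -/
lemma separates_union {ι : Type*} [DecidableEq ι] {p : ι → Fin 3 → k} {A B : Finset ι} {t : ℕ}
    (m : Fin 3 → k) (hA : ∀ i ∈ A, m ⬝ᵥ p i = 0) (hB : ∀ i ∈ B, m ⬝ᵥ p i ≠ 0)
    (hsA : Separates p A (t + 1)) (hsB : Separates p B t) : Separates p (A ∪ B) (t + 1) := by
  have key : ∀ i, ∃ f : MvPolynomial (Fin 3) k, i ∈ B → f.IsHomogeneous (t + 1) ∧
      eval (p i) f = 1 ∧ (∀ j ∈ B, j ≠ i → eval (p j) f = 0) ∧ ∀ j ∈ A, eval (p j) f = 0 := by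
    intro i
    by_cases hi : i ∈ B
    · obtain ⟨f, hf, hfi, hfj⟩ := hsB i hi
      refine ⟨C (m ⬝ᵥ p i * eval (p i) f)⁻¹ * (lin m * f), fun _ => ⟨?_, ?_, ?_, ?_⟩⟩
      · have := (lin_isHomogeneous m).mul hf
        rw [add_comm] at this
        exact this.C_mul _
      · simp only [map_mul, eval_C, eval_lin]
        exact inv_mul_cancel₀ (mul_ne_zero (hB i hi) hfi)
      · intro j hj hji
        simp [hfj j hj hji]
      · intro j hj
        simp [eval_lin, hA j hj]
    · exact ⟨0, fun h => absurd h hi⟩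
  choose g hg using key
  intro i hi
  by_cases hiB : i ∈ B
  · obtain ⟨h1, h2, h3, h4⟩ := hg i hiB
    refine ⟨g i, h1, by simp [h2], fun j hj hji => ?_⟩
    rcases mem_union.mp hj with hj | hj
    exacts [h4 j hj, h3 j hj hji]
  · have hiA : i ∈ A := (mem_union.mp hi).resolve_right hiB
    obtain ⟨f, hf, hfi, hfj⟩ := hsA i hiA
    refine ⟨f - ∑ b ∈ B, C (eval (p b) f) * g b, ?_, ?_, ?_⟩
    · exact hf.sub (IsHomogeneous.sum _ _ _ fun b hb => (hg b hb).1.C_mul _)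
    · have : ∑ b ∈ B, eval (p b) f * eval (p i) (g b) = 0 :=
        sum_eq_zero fun b hb => by rw [(hg b hb).2.2.2 i hiA, mul_zero]
      simpa [this] using hfi
    · intro j hj hji
      by_cases hjB : j ∈ B
      · have : ∑ b ∈ B, eval (p b) f * eval (p j) (g b) = eval (p j) f := by
          rw [sum_eq_single_of_mem j hjB fun b hb hbj => by
            rw [(hg b hb).2.2.1 j hjB hbj.symm, mul_zero], (hg j hjB).2.1, mul_one]
        simp [this]
      · have hjA : j ∈ A := (mem_union.mp hj).resolve_right hjB
        have : ∑ b ∈ B, eval (p b) f * eval (p j) (g b) = 0 :=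
          sum_eq_zero fun b hb => by rw [(hg b hb).2.2.2 j hjA, mul_zero]
        simp [this, hfj j hjA hji]

lemma exists_eval_ne_zero {σ : Type*} [Infinite k] {P : MvPolynomial σ k} (hP : P ≠ 0) :
    ∃ x, eval x P ≠ 0 := by
  by_contra! h
  exact hP (MvPolynomial.funext fun x => by rw [h x, map_zero])

lemma exists_forall_dot_ne_zero [Infinite k] {ι : Type*} (S : Finset ι) (u : ι → Fin 3 → k)
    (h : ∀ i ∈ S, u i ≠ 0) : ∃ m : Fin 3 → k, ∀ i ∈ S, m ⬝ᵥ u i ≠ 0 := by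
  have hP : ∏ i ∈ S, lin (u i) ≠ 0 := prod_ne_zero_iff.mpr fun i hi h0 => by
    obtain ⟨w, hw⟩ := exists_dot_ne_zero (h i hi)
    rw [dotProduct_comm, ← eval_lin, h0, map_zero] at hw
    exact hw rfl
  obtain ⟨m, hm⟩ := exists_eval_ne_zero hP
  rw [map_prod, prod_ne_zero_iff] at hm
  exact ⟨m, fun i hi => by rw [dotProduct_comm, ← eval_lin]; exact hm i hi⟩

lemma cross_cross_ne_zero {m x y : Fin 3 → k} (h : m ⬝ᵥ x ⨯₃ y ≠ 0) :
    (m ⨯₃ x) ⨯₃ (m ⨯₃ y) ≠ 0 := by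
  have key : (m ⨯₃ x) ⨯₃ (m ⨯₃ y) = (m ⬝ᵥ x ⨯₃ y) • m := by
    ext i; fin_cases i <;> simp [cross_apply, dotProduct, Fin.sum_univ_three] <;> ring
  rw [key]
  refine smul_ne_zero h ?_
  rintro rfl
  simp at h

lemma exists_smul_cross {m a b : Fin 3 → k} (h : m ⬝ᵥ a ⨯₃ b = 0) (hab : a ⨯₃ b ≠ 0)
    (hma : m ⨯₃ a ≠ 0) : ∃ c : k, c ≠ 0 ∧ a ⨯₃ b = c • (m ⨯₃ a) := by
  have h0 : (m ⨯₃ a) ⨯₃ (a ⨯₃ b) = 0 := by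
    have : (m ⨯₃ a) ⨯₃ (a ⨯₃ b) = (m ⬝ᵥ a ⨯₃ b) • a := by
      ext i; fin_cases i <;> simp [cross_apply, dotProduct, Fin.sum_univ_three] <;> ring
    rw [this, h, zero_smul]
  have h1 := mt crossProduct_ne_zero_iff_linearIndependent.mpr (not_not.mpr h0)
  rw [LinearIndependent.pair_iff' hma] at h1
  push Not at h1
  obtain ⟨c, hc⟩ := h1
  exact ⟨c, by rintro rfl; exact hab (by rw [← hc, zero_smul]), hc.symm⟩

/-- Vectors orthogonal to `p` are of the form `p ⨯₃ w`. -/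
lemma exists_cross_eq {p m : Fin 3 → k} (hp : p ≠ 0) (h : m ⬝ᵥ p = 0) : ∃ w, p ⨯₃ w = m := by
  obtain ⟨i, hi⟩ := Function.ne_iff.mp hp
  simp only [dotProduct, Fin.sum_univ_three] at h
  fin_cases i <;> simp only [Fin.zero_eta, Fin.mk_one, Fin.reduceFinMk, Pi.zero_apply] at hi
  · refine ⟨![0, m 2 / p 0, -m 1 / p 0], ?_⟩
    ext i; fin_cases i <;> simp [cross_apply] <;> field_simp; linear_combination -h
  · refine ⟨![-m 2 / p 1, 0, m 0 / p 1], ?_⟩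
    ext i; fin_cases i <;> simp [cross_apply] <;> field_simp; linear_combination -h
  · refine ⟨![m 1 / p 2, -m 0 / p 2, 0], ?_⟩
    ext i; fin_cases i <;> simp [cross_apply] <;> field_simp; linear_combination -h

/-! ### Zariski open conditions on arrangements -/

variable {V : Type*}

variable (k V) in
/-- Polynomial functions on the space of arrangements. -/
noncomputable def polyFun : Subalgebra k ((V → Fin 3 → k) → k) :=
  (aeval fun (v : V × Fin 3) (l : V → Fin 3 → k) => l v.1 v.2).range

lemma coord_mem_polyFun (v : V) (i : Fin 3) : (fun l : V → Fin 3 → k => l v i) ∈ polyFun k V :=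
  ⟨X (v, i), by simp⟩

lemma eval_mem_polyFun {σ : Type*} (f : MvPolynomial σ k) {p : (V → Fin 3 → k) → σ → k}
    (hp : ∀ i, (fun l => p l i) ∈ polyFun k V) : (fun l => eval (p l) f) ∈ polyFun k V := by
  induction f using MvPolynomial.induction_on with
  | C a => simp only [eval_C]; exact (polyFun k V).algebraMap_mem a
  | add f g hf hg => simp only [map_add]; exact add_mem hf hg
  | mul_X f i hf => simp only [map_mul, eval_X]; exact mul_mem hf (hp i)

lemma aeval_coord (P : MvPolynomial (V × Fin 3) k) (l : V → Fin 3 → k) :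
    (aeval fun (v : V × Fin 3) (l : V → Fin 3 → k) => l v.1 v.2) P l =
      eval (fun v => l v.1 v.2) P := by
  induction P using MvPolynomial.induction_on with
  | C a => simp
  | add f g hf hg => simp [hf, hg]
  | mul_X f i hf => simp [hf]

lemma exists_mul_ne_zero_of_mem_polyFun [Infinite k] {f g : (V → Fin 3 → k) → k}
    (hf : f ∈ polyFun k V) (hg : g ∈ polyFun k V) (hf0 : f ≠ 0) (hg0 : g ≠ 0) :
    ∃ l, f l * g l ≠ 0 := by
  obtain ⟨P, rfl⟩ := hf
  obtain ⟨Q, rfl⟩ := hg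
  have hPQ : P * Q ≠ 0 := by
    refine mul_ne_zero ?_ ?_
    · rintro rfl; simp at hf0
    · rintro rfl; simp at hg0
  obtain ⟨x, hx⟩ := exists_eval_ne_zero hPQ
  refine ⟨fun v i => x (v, i), ?_⟩
  simpa [aeval_coord] using hx

/-- Zariski open sets of arrangements. -/
def IsZariskiOpen (S : Set (V → Fin 3 → k)) : Prop :=
  ∀ l ∈ S, ∃ f ∈ polyFun k V, f l ≠ 0 ∧ ∀ l', f l' ≠ 0 → l' ∈ S

/-- Polynomial maps from the space of arrangements to itself. -/
def IsPolyMap (Φ : (V → Fin 3 → k) → V → Fin 3 → k) : Prop :=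
  ∀ v i, (fun l => Φ l v i) ∈ polyFun k V

lemma IsZariskiOpen.inter {S T : Set (V → Fin 3 → k)} (hS : IsZariskiOpen S)
    (hT : IsZariskiOpen T) : IsZariskiOpen (S ∩ T) := by
  rintro l ⟨hlS, hlT⟩
  obtain ⟨f, hf, hfl, hfS⟩ := hS l hlS
  obtain ⟨g, hg, hgl, hgT⟩ := hT l hlT
  exact ⟨f * g, mul_mem hf hg, mul_ne_zero hfl hgl, fun l' hl' =>
    ⟨hfS l' (left_ne_zero_of_mul hl'), hgT l' (right_ne_zero_of_mul hl')⟩⟩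

lemma isZariskiOpen_biInter {ι : Type*} (s : Finset ι) {S : ι → Set (V → Fin 3 → k)}
    (h : ∀ i ∈ s, IsZariskiOpen (S i)) : IsZariskiOpen {l | ∀ i ∈ s, l ∈ S i} := by
  classical
  induction s using Finset.induction_on with
  | empty => exact fun l _ => ⟨1, one_mem _, one_ne_zero, by simp⟩
  | insert a s ha ih =>
    have := (h a (mem_insert_self a s)).inter (ih fun i hi => h i (mem_insert_of_mem hi))
    convert this using 1
    ext l; simp

lemma isZariskiOpen_ne_zero {f : (V → Fin 3 → k) → k} (hf : f ∈ polyFun k V) :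
    IsZariskiOpen {l | f l ≠ 0} := fun _ hl => ⟨f, hf, hl, fun _ h => h⟩

lemma isZariskiOpen_vec_ne_zero {p : (V → Fin 3 → k) → Fin 3 → k}
    (hp : ∀ i, (fun l => p l i) ∈ polyFun k V) : IsZariskiOpen {l | p l ≠ 0} := by
  intro l hl
  obtain ⟨i, hi⟩ := Function.ne_iff.mp hl
  exact ⟨_, hp i, hi, fun l' h' h0 => h' (by simp [h0])⟩

lemma IsZariskiOpen.preimage {S : Set (V → Fin 3 → k)} (hS : IsZariskiOpen S)
    {Φ : (V → Fin 3 → k) → V → Fin 3 → k} (hΦ : IsPolyMap Φ) : IsZariskiOpen (Φ ⁻¹' S) := by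
  intro l hl
  obtain ⟨f, ⟨P, rfl⟩, hfl, hfS⟩ := hS _ hl
  refine ⟨_, eval_mem_polyFun P (p := fun l v => Φ l v.1 v.2) fun v => hΦ v.1 v.2,
    fun h => hfl ((aeval_coord P _).trans h), fun l' hl' => hfS _ fun h => hl' ?_⟩
  exact (aeval_coord P _).symm.trans h

lemma IsZariskiOpen.inter_nonempty [Infinite k] {S T : Set (V → Fin 3 → k)} (hS : IsZariskiOpen S)
    (hT : IsZariskiOpen T) (hS0 : S.Nonempty) (hT0 : T.Nonempty) : (S ∩ T).Nonempty := by
  obtain ⟨l, hl⟩ := hS0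
  obtain ⟨l', hl'⟩ := hT0
  obtain ⟨f, hf, hfl, hfS⟩ := hS l hl
  obtain ⟨g, hg, hgl, hgT⟩ := hT l' hl'
  obtain ⟨x, hx⟩ := exists_mul_ne_zero_of_mem_polyFun hf hg
    (fun h => hfl (by simp [h])) (fun h => hgl (by simp [h]))
  exact ⟨x, hfS x (left_ne_zero_of_mul hx), hgT x (right_ne_zero_of_mul hx)⟩

lemma cross_mem_polyFun {p q : (V → Fin 3 → k) → Fin 3 → k}
    (hp : ∀ i, (fun l => p l i) ∈ polyFun k V) (hq : ∀ i, (fun l => q l i) ∈ polyFun k V)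
    (i : Fin 3) : (fun l => (p l ⨯₃ q l) i) ∈ polyFun k V := by
  fin_cases i <;> simp only [cross_apply]
  exacts [sub_mem (mul_mem (hp 1) (hq 2)) (mul_mem (hp 2) (hq 1)),
    sub_mem (mul_mem (hp 2) (hq 0)) (mul_mem (hp 0) (hq 2)),
    sub_mem (mul_mem (hp 0) (hq 1)) (mul_mem (hp 1) (hq 0))]

lemma dot_mem_polyFun {p q : (V → Fin 3 → k) → Fin 3 → k}
    (hp : ∀ i, (fun l => p l i) ∈ polyFun k V) (hq : ∀ i, (fun l => q l i) ∈ polyFun k V) :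
    (fun l => p l ⬝ᵥ q l) ∈ polyFun k V := by
  simp only [dotProduct, Fin.sum_univ_three]
  exact add_mem (add_mem (mul_mem (hp 0) (hq 0)) (mul_mem (hp 1) (hq 1))) (mul_mem (hp 2) (hq 2))

/-- The intersection point of two lines of an arrangement. -/
def pt (l : V → Fin 3 → k) (e : V × V) : Fin 3 → k := l e.1 ⨯₃ l e.2

lemma isZariskiOpen_separates (E : Finset (V × V)) (t : ℕ) :
    IsZariskiOpen {l : V → Fin 3 → k | Separates (pt l) E t} := by
  classical
  intro l hl
  choose f hf hfe hfe' using fun e : E => hl e.1 e.2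
  let M : (V → Fin 3 → k) → Matrix E E k := fun l => Matrix.of fun i j => eval (pt l j.1) (f i)
  refine ⟨fun l => (M l).det, ?_, ?_, ?_⟩
  · simp only [Matrix.det_apply']
    have : (fun l => ∑ σ : Equiv.Perm E, ((Equiv.Perm.sign σ : ℤ) : k) * ∏ i, M l (σ i) i) =
        ∑ σ : Equiv.Perm E, (algebraMap k _ ((Equiv.Perm.sign σ : ℤ) : k)) *
          ∏ i, (fun l => eval (pt l i.1) (f (σ i))) := by
      ext l; simp [M]
    rw [this]
    refine sum_mem fun σ _ => mul_mem (Subalgebra.algebraMap_mem _ _) (prod_mem fun i _ => ?_)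
    exact eval_mem_polyFun _ fun j => cross_mem_polyFun (fun i => coord_mem_polyFun _ i)
      (fun i => coord_mem_polyFun _ i) j
  · have : M l = Matrix.diagonal fun i => eval (pt l i.1) (f i) := by
      ext i j
      by_cases hij : i = j
      · subst hij; simp [M]
      · rw [Matrix.diagonal_apply_ne _ hij]
        exact hfe' i j.1 j.2 fun h => hij (Subtype.ext h).symm
    change (M l).det ≠ 0
    rw [this, Matrix.det_diagonal]
    exact prod_ne_zero_iff.mpr fun i _ => hfe i
  · intro l' hl' e he
    have hu : (M l')⁻¹ * M l' = 1 := Matrix.nonsing_inv_mul _ (isUnit_iff_ne_zero.mpr hl')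
    have hc : ∀ j : E, eval (pt l' j.1) (∑ i, C ((M l')⁻¹ ⟨e, he⟩ i) * f i) =
        (1 : Matrix E E k) ⟨e, he⟩ j := by
      intro j
      rw [← hu, Matrix.mul_apply]
      simp [M]
    refine ⟨∑ i, C ((M l')⁻¹ ⟨e, he⟩ i) * f i,
      IsHomogeneous.sum _ _ _ fun i _ => (hf i).C_mul _, ?_, fun j hj hje => ?_⟩
    · rw [hc ⟨e, he⟩]; simp
    · rw [hc ⟨j, hj⟩, Matrix.one_apply_ne]
      exact fun h => hje (Subtype.ext_iff.mp h).symm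

/-! ### Arrangements with prescribed triple points -/

/-- The determinant of three vectors. -/
def tp (x y z : Fin 3 → k) : k := x ⬝ᵥ y ⨯₃ z

lemma tp_eq (x y z : Fin 3 → k) : tp x y z = x 0 * (y 1 * z 2 - y 2 * z 1) +
    x 1 * (y 2 * z 0 - y 0 * z 2) + x 2 * (y 0 * z 1 - y 1 * z 0) := by
  simp [tp, cross_apply, dotProduct, Fin.sum_univ_three]

lemma tp_rotate (x y z : Fin 3 → k) : tp x y z = tp y z x := by simp only [tp_eq]; ring

lemma tp_swap (x y z : Fin 3 → k) : tp x y z = -tp x z y := by simp only [tp_eq]; ring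

lemma tp_cross_cross (a b w : Fin 3 → k) : tp ((a ⨯₃ b) ⨯₃ w) a b = 0 := by
  simp only [tp_eq, cross_apply]; simp; ring

lemma cross_ne_zero_comm {x y : Fin 3 → k} : x ⨯₃ y ≠ 0 ↔ y ⨯₃ x ≠ 0 := by
  rw [← cross_anticomm, neg_ne_zero]

lemma cross_cross_eq_tp (x y a b : Fin 3 → k) :
    (x ⨯₃ y) ⨯₃ (a ⨯₃ b) = tp a b y • -x + tp a b x • y := by
  ext i; fin_cases i <;> simp [cross_apply, tp_eq] <;> ring

lemma smul_add_smul_eq_zero {x y : Fin 3 → k} {c e : k} (hxy : x ⨯₃ y ≠ 0)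
    (h : c • -y + e • x = 0) : c = 0 ∧ e = 0 := by
  have h1 := crossProduct_ne_zero_iff_linearIndependent.mp hxy
  rw [LinearIndependent.pair_iff] at h1
  obtain ⟨he, hc⟩ := h1 e (-c) (by rw [← h]; simp [add_comm])
  exact ⟨neg_eq_zero.mp hc, he⟩

section
variable [DecidableEq V]

/-- The line `x` takes part in the triple point `τ`. -/
def Has (τ : V × V × V) (x : V) : Prop := x = τ.1 ∨ x = τ.2.1 ∨ x = τ.2.2

instance (τ : V × V × V) (x : V) : Decidable (Has τ x) := inferInstanceAs (Decidable (_ ∨ _ ∨ _))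

/-- The lines `x`, `y`, `z` pass through one of the prescribed triple points. -/
def Coll (T : List (V × V × V)) (x y z : V) : Prop := ∃ τ ∈ T, Has τ x ∧ Has τ y ∧ Has τ z

instance (T : List (V × V × V)) (x y z : V) : Decidable (Coll T x y z) :=
  inferInstanceAs (Decidable (∃ τ ∈ T, _))

/-- `T` can be realised by adding successively, for each `(c, a, b)` of `T` starting from the end,
the line `c` through the intersection of `a` and `b`. -/
def Valid (W : Finset V) : List (V × V × V) → Prop
  | [] => True
  | τ :: T => (τ.1 ∈ W ∧ τ.2.1 ∈ W ∧ τ.2.2 ∈ W ∧ τ.2.1 ≠ τ.2.2 ∧ τ.1 ≠ τ.2.1 ∧ τ.1 ≠ τ.2.2) ∧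
    (∀ σ ∈ T, ¬ Has σ τ.1 ∧ ¬ (Has σ τ.2.1 ∧ Has σ τ.2.2)) ∧ Valid W T

instance (W : Finset V) : ∀ T : List (V × V × V), Decidable (Valid W T)
  | [] => inferInstanceAs (Decidable True)
  | _ :: T =>
    have := instDecidableValid W T
    inferInstanceAs (Decidable (_ ∧ _ ∧ _))

omit [DecidableEq V] in
lemma Valid.mem {W : Finset V} : ∀ {T : List (V × V × V)}, Valid W T → ∀ τ ∈ T,
    τ.1 ∈ W ∧ τ.2.1 ∈ W ∧ τ.2.2 ∈ W ∧ τ.2.1 ≠ τ.2.2 ∧ τ.1 ≠ τ.2.1 ∧ τ.1 ≠ τ.2.2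
  | _ :: _, hV, τ, hτ => by
    rcases List.mem_cons.mp hτ with rfl | hτ
    exacts [hV.1, hV.2.2.mem τ hτ]

/-- The lines in `W` are distinct and their triple points are exactly those of `T`. -/
def Exact (T : List (V × V × V)) (W : Finset V) (l : V → Fin 3 → k) : Prop :=
  (∀ x ∈ W, ∀ y ∈ W, x ≠ y → l x ⨯₃ l y ≠ 0) ∧
  ∀ x ∈ W, ∀ y ∈ W, ∀ z ∈ W, x ≠ y → x ≠ z → y ≠ z → (tp (l x) (l y) (l z) = 0 ↔ Coll T x y z)

/-- Equality of unordered pairs. -/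
def SamePair (x y a b : V) : Prop := (x = a ∧ y = b) ∨ (x = b ∧ y = a)

instance (x y a b : V) : Decidable (SamePair x y a b) := inferInstanceAs (Decidable (_ ∨ _))

omit [DecidableEq V] in
lemma Coll.rotate {T : List (V × V × V)} {x y z : V} : Coll T x y z ↔ Coll T y z x :=
  ⟨fun ⟨τ, h, hx, hy, hz⟩ => ⟨τ, h, hy, hz, hx⟩, fun ⟨τ, h, hy, hz, hx⟩ => ⟨τ, h, hx, hy, hz⟩⟩

lemma Exact.cross_cross_ne_zero {T : List (V × V × V)} {W : Finset V} {l : V → Fin 3 → k}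
    (hl : Exact T W l) {a b x y : V} (ha : a ∈ W) (hb : b ∈ W) (hx : x ∈ W) (hy : y ∈ W)
    (hab : a ≠ b) (hxy : x ≠ y) (hT : ∀ τ ∈ T, ¬ (Has τ a ∧ Has τ b)) (h : ¬ SamePair x y a b) :
    (l x ⨯₃ l y) ⨯₃ (l a ⨯₃ l b) ≠ 0 := by
  intro h0
  rw [cross_cross_eq_tp] at h0
  obtain ⟨h1, h2⟩ := smul_add_smul_eq_zero (hl.1 y hy x hx hxy.symm) h0
  have key : ∀ z ∈ W, tp (l a) (l b) (l z) = 0 → z = a ∨ z = b := by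
    intro z hz h
    by_contra! hne
    obtain ⟨τ, hτ, h1, h2, -⟩ := (hl.2 a ha b hb z hz hab hne.1.symm hne.2.symm).mp h
    exact hT τ hτ ⟨h1, h2⟩
  have := key y hy h1
  have := key x hx h2
  unfold SamePair at h
  grind

section
variable [Infinite k]

/-- A general line through the intersection of two lines of an arrangement. -/
lemma Exact.exists_through {T : List (V × V × V)} {W : Finset V} {l : V → Fin 3 → k}
    (hl : Exact T W l) {a b : V} (ha : a ∈ W) (hb : b ∈ W) (hab : a ≠ b)
    (hT : ∀ τ ∈ T, ¬ (Has τ a ∧ Has τ b)) :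
    ∃ m, tp m (l a) (l b) = 0 ∧ (∀ x ∈ W, m ⨯₃ l x ≠ 0) ∧
      ∀ x ∈ W, ∀ y ∈ W, x ≠ y → ¬ SamePair x y a b → tp m (l x) (l y) ≠ 0 := by
  classical
  set p := l a ⨯₃ l b with hp
  have hp0 : p ≠ 0 := hl.1 a ha b hb hab
  have hla : l a ≠ 0 := by intro h; simp [p, h] at hp0
  have hlb : l b ≠ 0 := by intro h; simp [p, h] at hp0
  obtain ⟨w, hw⟩ := exists_forall_dot_ne_zero
    (insert (l a) (insert (l b) (((W ×ˢ W).filter fun e => e.1 ≠ e.2 ∧ ¬ SamePair e.1 e.2 a b).image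
      fun e => (l e.1 ⨯₃ l e.2) ⨯₃ p))) id (by
    intro u hu
    simp only [mem_insert, mem_image, mem_filter, mem_product] at hu
    rcases hu with rfl | rfl | ⟨e, ⟨⟨h1, h2⟩, h3, h4⟩, rfl⟩
    exacts [hla, hlb, hl.cross_cross_ne_zero ha hb h1 h2 hab h3 hT h4])
  have hcond : ∀ x ∈ W, ∀ y ∈ W, x ≠ y → ¬ SamePair x y a b → tp (p ⨯₃ w) (l x) (l y) ≠ 0 := by
    intro x hx y hy hxy h
    have := hw ((l x ⨯₃ l y) ⨯₃ p) (by
      simp only [mem_insert, mem_image, mem_filter, mem_product]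
      exact Or.inr (Or.inr ⟨(x, y), ⟨⟨hx, hy⟩, hxy, h⟩, rfl⟩))
    convert this using 1
    simp only [id, tp_eq, cross_apply, dotProduct, Fin.sum_univ_three]
    simp
    ring
  have hmul : ∀ c : V, c = a ∨ c = b → (p ⨯₃ w) ⨯₃ l c ≠ 0 := by
    intro c hc
    have h1 : w ⬝ᵥ l c ≠ 0 := hw (l c) (by rcases hc with rfl | rfl <;> simp)
    have h2 : l c ⬝ᵥ p = 0 := by
      rcases hc with rfl | rfl
      exacts [dot_self_cross _ _, dot_cross_self _ _]
    have h3 : (p ⨯₃ w) ⨯₃ l c = (l c ⬝ᵥ p) • w - (w ⬝ᵥ l c) • p := by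
      ext i; fin_cases i <;> simp [cross_apply, dotProduct, Fin.sum_univ_three] <;> ring
    rw [h3, h2, zero_smul, zero_sub, neg_ne_zero]
    exact smul_ne_zero h1 hp0
  refine ⟨p ⨯₃ w, tp_cross_cross _ _ _, fun x hx => ?_, hcond⟩
  by_cases hxa : x = a
  · exact hmul x (Or.inl hxa)
  by_cases hxb : x = b
  · exact hmul x (Or.inr hxb)
  have := hcond x hx a ha hxa (by unfold SamePair; tauto)
  intro h
  rw [tp_rotate, tp_rotate] at this
  exact this (by rw [tp, h, dotProduct_zero])

lemma Exact.extend {T : List (V × V × V)} {W : Finset V} {l : V → Fin 3 → k} (hl : Exact T W l)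
    {c a b : V} (hV : Valid W ((c, a, b) :: T)) :
    ∃ m, Exact ((c, a, b) :: T) W (Function.update l c m) := by
  obtain ⟨⟨hc, ha, hb, hab, hca, hcb⟩, hT, -⟩ := hV
  simp only at hc ha hb hab hca hcb hT
  obtain ⟨m, hm0, hm1, hm2⟩ := hl.exists_through ha hb hab fun τ hτ => (hT τ hτ).2
  refine ⟨m, ?_, ?_⟩
  · intro x hx y hy hxy
    by_cases hxc : x = c
    · subst hxc; rw [Function.update_self, Function.update_of_ne hxy.symm]; exact hm1 y hy
    by_cases hyc : y = c
    · subst hyc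
      rw [Function.update_self, Function.update_of_ne hxc, cross_ne_zero_comm]; exact hm1 x hx
    rw [Function.update_of_ne hxc, Function.update_of_ne hyc]
    exact hl.1 x hx y hy hxy
  · have key : ∀ y ∈ W, ∀ z ∈ W, c ≠ y → c ≠ z → y ≠ z →
        (tp m (l y) (l z) = 0 ↔ Coll ((c, a, b) :: T) c y z) := by
      intro y hy z hz hcy hcz hyz
      constructor
      · intro h
        have := not_imp_comm.mp (hm2 y hy z hz hyz) (not_not.mpr h)
        refine ⟨(c, a, b), by simp, by simp [Has], ?_⟩
        simp only [Has, SamePair] at this ⊢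
        tauto
      · rintro ⟨τ, hτ, h1, h2, h3⟩
        rcases List.mem_cons.mp hτ with rfl | hτ
        · simp only [Has] at h2 h3
          have : (y = a ∧ z = b) ∨ (y = b ∧ z = a) := by grind
          rcases this with ⟨rfl, rfl⟩ | ⟨rfl, rfl⟩
          · exact hm0
          · rw [tp_swap, hm0, neg_zero]
        · exact absurd h1 (hT τ hτ).1
    intro x hx y hy z hz hxy hxz hyz
    by_cases hxc : x = c
    · subst hxc
      rw [Function.update_self, Function.update_of_ne hxy.symm, Function.update_of_ne hxz.symm]
      exact key y hy z hz hxy hxz hyz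
    by_cases hyc : y = c
    · subst hyc
      rw [Function.update_self, Function.update_of_ne hxc, Function.update_of_ne hyz.symm,
        tp_rotate, key z hz x hx hyz hxy.symm hxz.symm, Coll.rotate, Coll.rotate]
    by_cases hzc : z = c
    · subst hzc
      rw [Function.update_self, Function.update_of_ne hxc, Function.update_of_ne hyc,
        tp_rotate, tp_rotate, key x hx y hy hxz.symm hyz.symm hxy, Coll.rotate]
    rw [Function.update_of_ne hxc, Function.update_of_ne hyc, Function.update_of_ne hzc,
      hl.2 x hx y hy z hz hxy hxz hyz]
    constructor
    · rintro ⟨τ, hτ, h⟩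
      exact ⟨τ, List.mem_cons_of_mem _ hτ, h⟩
    · rintro ⟨τ, hτ, h1, h2, h3⟩
      rcases List.mem_cons.mp hτ with rfl | hτ
      · simp only [Has] at h1 h2 h3
        grind
      · exact ⟨τ, hτ, h1, h2, h3⟩

omit [DecidableEq V] in
lemma exists_exact_nil (W : Finset V) : ∃ l : V → Fin 3 → k, Exact [] W l := by
  classical
  let f : V → k := fun x =>
    if h : x ∈ W then Infinite.natEmbedding k (W.equivFin ⟨x, h⟩) else 0
  have hf : ∀ x ∈ W, ∀ y ∈ W, x ≠ y → f x - f y ≠ 0 := by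
    intro x hx y hy hxy h
    simp only [f, hx, hy, dite_true, sub_eq_zero, EmbeddingLike.apply_eq_iff_eq, Fin.val_inj,
      Subtype.mk.injEq] at h
    exact hxy h
  refine ⟨fun x => ![1, f x, f x ^ 2], fun x hx y hy hxy h => ?_, ?_⟩
  · have := congr_fun h 2
    simp only [cross_apply] at this
    exact hf y hy x hx hxy.symm (by simpa using this)
  · intro x hx y hy z hz hxy hxz hyz
    have : tp ![1, f x, f x ^ 2] ![1, f y, f y ^ 2] ![1, f z, f z ^ 2] =
        (f x - f y) * (f y - f z) * (f z - f x) * (-1 : k) ^ 2 := by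
      simp only [tp_eq]; simp; ring
    have h0 := mul_ne_zero (mul_ne_zero (hf x hx y hy hxy) (hf y hy z hz hyz))
      (hf z hz x hx hxz.symm)
    simp only [this, even_two, Even.neg_pow, one_pow, mul_one]
    simpa [Coll] using h0

lemma exists_exact {W : Finset V} : ∀ {T : List (V × V × V)}, Valid W T →
    ∃ l : V → Fin 3 → k, Exact T W l
  | [], _ => exists_exact_nil W
  | (_, _, _) :: _, h => by
    obtain ⟨l, hl⟩ := exists_exact h.2.2
    obtain ⟨m, hm⟩ := hl.extend h
    exact ⟨_, hm⟩

end

/-- Parametrisation of the arrangements with triple points `T`. -/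
def con : List (V × V × V) → (V → Fin 3 → k) → V → Fin 3 → k
  | [], w => w
  | τ :: T, w =>
    Function.update (con T w) τ.1 ((con T w τ.2.1 ⨯₃ con T w τ.2.2) ⨯₃ con T w τ.1)

lemma isPolyMap_con : ∀ T : List (V × V × V), IsPolyMap (k := k) (con T)
  | [] => fun v i => coord_mem_polyFun v i
  | τ :: T => by
    have ih := isPolyMap_con T
    intro v i
    by_cases hv : v = τ.1
    · subst hv
      simp only [con, Function.update_self]
      exact cross_mem_polyFun (cross_mem_polyFun (ih _) (ih _)) (ih _) i
    · simp only [con, Function.update_of_ne hv]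
      exact ih v i

lemma exists_con_eq {W : Finset V} : ∀ {T : List (V × V × V)} {l : V → Fin 3 → k}, Valid W T →
    (∀ τ ∈ T, tp (l τ.1) (l τ.2.1) (l τ.2.2) = 0 ∧ l τ.2.1 ⨯₃ l τ.2.2 ≠ 0) → ∃ w, con T w = l
  | [], l, _, _ => ⟨l, rfl⟩
  | τ :: T, l, hV, h => by
    obtain ⟨⟨-, -, -, -, h1, h2⟩, h3, hV'⟩ := hV
    obtain ⟨h4, h5⟩ := h τ (by simp)
    obtain ⟨w, hw⟩ := exists_cross_eq h5 h4
    obtain ⟨w', hw'⟩ := exists_con_eq (l := Function.update l τ.1 w) hV' (by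
      intro σ hσ
      have := (h3 σ hσ).1
      simp only [Has, not_or] at this
      rw [Function.update_of_ne (Ne.symm this.1), Function.update_of_ne (Ne.symm this.2.1),
        Function.update_of_ne (Ne.symm this.2.2)]
      exact h σ (List.mem_cons_of_mem _ hσ))
    refine ⟨w', ?_⟩
    rw [con, hw', Function.update_self, Function.update_of_ne h1.symm,
      Function.update_of_ne h2.symm,
      hw, Function.update_idem, Function.update_eq_self]

lemma tp_con {W : Finset V} : ∀ {T : List (V × V × V)}, Valid W T → ∀ w : V → Fin 3 → k,
    ∀ τ ∈ T, tp (con T w τ.1) (con T w τ.2.1) (con T w τ.2.2) = 0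
  | σ :: T, hV, w, τ, hτ => by
    obtain ⟨⟨-, -, -, -, h1, h2⟩, h3, hV'⟩ := hV
    rcases List.mem_cons.mp hτ with rfl | hτ
    · rw [con, Function.update_self, Function.update_of_ne h1.symm, Function.update_of_ne h2.symm]
      exact tp_cross_cross _ _ _
    · have := (h3 τ hτ).1
      simp only [Has, not_or] at this
      rw [con, Function.update_of_ne (Ne.symm this.1), Function.update_of_ne (Ne.symm this.2.1),
        Function.update_of_ne (Ne.symm this.2.2)]
      exact tp_con hV' w τ hτ

omit [DecidableEq V] in
lemma tp_eq_zero_of_has {l : V → Fin 3 → k} {τ : V × V × V} {x y z : V}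
    (h : tp (l τ.1) (l τ.2.1) (l τ.2.2) = 0) (hx : Has τ x) (hy : Has τ y) (hz : Has τ z) :
    tp (l x) (l y) (l z) = 0 := by
  simp only [tp_eq] at h ⊢
  rcases hx with rfl | rfl | rfl <;> rcases hy with rfl | rfl | rfl <;>
    rcases hz with rfl | rfl | rfl <;> first | ring1 | linear_combination h | linear_combination -h

variable (k) in
/-- The points `E` impose independent conditions on forms of degree `t` for some arrangement with
triple points `T`. -/
def Gen (T : List (V × V × V)) (W : Finset V) (E : Finset (V × V)) (t : ℕ) : Prop :=
  ∃ l : V → Fin 3 → k, Exact T W l ∧ Separates (pt l) E t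

omit [DecidableEq V] in
lemma isZariskiOpen_cross_ne_zero (x y : V) :
    IsZariskiOpen {l : V → Fin 3 → k | l x ⨯₃ l y ≠ 0} :=
  isZariskiOpen_vec_ne_zero (cross_mem_polyFun (coord_mem_polyFun x) (coord_mem_polyFun y))

omit [DecidableEq V] in
lemma isZariskiOpen_tp_ne_zero (x y z : V) :
    IsZariskiOpen {l : V → Fin 3 → k | tp (l x) (l y) (l z) ≠ 0} :=
  isZariskiOpen_ne_zero (dot_mem_polyFun (coord_mem_polyFun x)
    (cross_mem_polyFun (coord_mem_polyFun y) (coord_mem_polyFun z)))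

section
variable [Infinite k] {T : List (V × V × V)} {W : Finset V} {E : Finset (V × V)} {t : ℕ}

/-- Deformation of a degenerate arrangement to one with exactly the triple points `T`. -/
lemma gen_of_deform (hV : Valid W T) {l : V → Fin 3 → k}
    (hT : ∀ τ ∈ T, tp (l τ.1) (l τ.2.1) (l τ.2.2) = 0 ∧ l τ.2.1 ⨯₃ l τ.2.2 ≠ 0)
    (hl : Separates (pt l) E t) : Gen k T W E t := by
  obtain ⟨w, hw⟩ := exists_con_eq hV hT
  obtain ⟨l', hl'⟩ := exists_exact (k := k) hV
  obtain ⟨w', hw'⟩ := exists_con_eq hV (l := l') (by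
    intro τ hτ
    obtain ⟨h1, h2, h3, h4, h5, h6⟩ := hV.mem τ hτ
    exact ⟨(hl'.2 _ h1 _ h2 _ h3 h5 h6 h4).mpr ⟨τ, hτ, by simp [Has], by simp [Has], by simp [Has]⟩,
      hl'.1 _ h2 _ h3 h4⟩)
  let O : Set (V → Fin 3 → k) :=
    {l | ∀ e ∈ (W ×ˢ W).filter (fun e => e.1 ≠ e.2), l ∈ {l : V → Fin 3 → k | l e.1 ⨯₃ l e.2 ≠ 0}} ∩
    {l | ∀ e ∈ (W ×ˢ W ×ˢ W).filter (fun e => e.1 ≠ e.2.1 ∧ e.1 ≠ e.2.2 ∧ e.2.1 ≠ e.2.2 ∧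
      ¬ Coll T e.1 e.2.1 e.2.2), l ∈ {l : V → Fin 3 → k | tp (l e.1) (l e.2.1) (l e.2.2) ≠ 0}}
  have hO : IsZariskiOpen O :=
    (isZariskiOpen_biInter _ fun e _ => isZariskiOpen_cross_ne_zero e.1 e.2).inter
      (isZariskiOpen_biInter _ fun e _ => isZariskiOpen_tp_ne_zero e.1 e.2.1 e.2.2)
  obtain ⟨w'', h1, h2⟩ := ((isZariskiOpen_separates E t).preimage (isPolyMap_con T)).inter_nonempty
    (hO.preimage (isPolyMap_con T)) ⟨w, by simpa [hw] using hl⟩ ⟨w', by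
      simp only [Set.mem_preimage, hw']
      refine ⟨fun e he => ?_, fun e he => ?_⟩
      · simp only [mem_filter, mem_product] at he
        exact hl'.1 _ he.1.1 _ he.1.2 he.2
      · simp only [mem_filter, mem_product] at he
        exact fun h => he.2.2.2.2 ((hl'.2 _ he.1.1 _ he.1.2.1 _ he.1.2.2 he.2.1 he.2.2.1
          he.2.2.2.1).mp h)⟩
  refine ⟨con T w'', ⟨fun x hx y hy hxy => h2.1 (x, y) (by simp [hx, hy, hxy]), ?_⟩, h1⟩
  intro x hx y hy z hz hxy hxz hyz
  constructor
  · intro h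
    by_contra hc
    exact h2.2 (x, y, z) (by simp [*]) h
  · rintro ⟨τ, hτ, h1, h2, h3⟩
    exact tp_eq_zero_of_has (tp_con hV w'' τ hτ) h1 h2 h3

end

end

/-! ### Degeneration steps -/

section
variable [DecidableEq V] [Infinite k] {T : List (V × V × V)} {W : Finset V}
  {E A B : Finset (V × V)} {t : ℕ}

omit [DecidableEq V] [Infinite k] in
lemma Exact.pt_ne_zero {l : V → Fin 3 → k} (hl : Exact T W l) {e : V × V} (h1 : e.1 ∈ W)
    (h2 : e.2 ∈ W) (h : e.1 ≠ e.2) : pt l e ≠ 0 := hl.1 _ h1 _ h2 h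

lemma gen_of_card_le_one (hV : Valid W T) (hE : ∀ e ∈ E, e.1 ∈ W ∧ e.2 ∈ W ∧ e.1 ≠ e.2)
    (h : #E ≤ 1) : Gen k T W E 0 := by
  obtain ⟨l, hl⟩ := exists_exact (k := k) hV
  refine ⟨l, hl, separates_of_card_le (fun e he => hl.1 _ (hE e he).1 _ (hE e he).2.1 (hE e he).2.2)
    (fun i hi j hj hij => absurd (Finset.card_le_one.mp h i hi j hj) hij) (by omega)⟩

lemma Gen.relax {T' : List (V × V × V)} (h : Gen k T' W E t) (hV : Valid W T)
    (hT : ∀ τ ∈ T, Coll T' τ.1 τ.2.1 τ.2.2) : Gen k T W E t := by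
  obtain ⟨l, hl, hs⟩ := h
  refine gen_of_deform hV (fun τ hτ => ?_) hs
  obtain ⟨h1, h2, h3, h4, h5, h6⟩ := hV.mem τ hτ
  exact ⟨(hl.2 _ h1 _ h2 _ h3 h5 h6 h4).mpr (hT τ hτ), hl.1 _ h2 _ h3 h4⟩

/-- The point `e` lies on the line `x`. -/
def On (T : List (V × V × V)) (x : V) (e : V × V) : Prop :=
  e.1 = x ∨ e.2 = x ∨ Coll T x e.1 e.2

instance (x : V) : DecidablePred (On T x) := fun _ => inferInstanceAs (Decidable (_ ∨ _ ∨ _))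

/-- A line other than `x` through the point `e`. -/
def other (x : V) (e : V × V) : V := if e.1 = x then e.2 else e.1

omit [DecidableEq V] [Infinite k] in
lemma cross_cross_ne_zero_of_smul {a b m x y : Fin 3 → k} {c e : k} (ha : a = c • m ⨯₃ x)
    (hb : b = e • m ⨯₃ y) (hc : c ≠ 0) (he : e ≠ 0) (h : tp m x y ≠ 0) : a ⨯₃ b ≠ 0 := by
  rw [ha, hb]
  simp only [map_smul, LinearMap.smul_apply]
  exact smul_ne_zero he (smul_ne_zero hc (cross_cross_ne_zero h))

omit [Infinite k] in
/-- Specialising to a line of the arrangement. -/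
lemma Gen.line (L : V) (hL : L ∈ W) (hE : ∀ e ∈ A ∪ B, e.1 ∈ W ∧ e.2 ∈ W ∧ e.1 ≠ e.2)
    (hA : ∀ e ∈ A, On T L e) (hB : ∀ e ∈ B, ¬ On T L e)
    (hAA : ∀ e ∈ A, ∀ e' ∈ A, e ≠ e' →
      other L e ≠ other L e' ∧ ¬ Coll T L (other L e) (other L e'))
    (hc : #A ≤ t + 2) (h : Gen k T W B t) : Gen k T W (A ∪ B) (t + 1) := by
  obtain ⟨l, hl, hs⟩ := h
  have h0 : ∀ e ∈ A ∪ B, pt l e ≠ 0 := fun e he =>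
    hl.pt_ne_zero (hE e he).1 (hE e he).2.1 (hE e he).2.2
  have hother : ∀ e ∈ A, other L e ∈ W ∧ other L e ≠ L ∧
      ∃ c : k, c ≠ 0 ∧ pt l e = c • l L ⨯₃ l (other L e) := by
    intro e he
    obtain ⟨h1, h2, h3⟩ := hE e (mem_union_left _ he)
    by_cases hx : e.1 = L
    · refine ⟨by simpa [other, hx] using h2, by simpa [other, hx] using (hx ▸ h3).symm, 1,
        one_ne_zero, ?_⟩
      simp [other, pt, hx]
    by_cases hx' : e.2 = L
    · refine ⟨by simpa [other, hx] using h1, by simp [other, hx], -1, by simp, ?_⟩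
      simp [other, pt, hx, hx']
    refine ⟨by simpa [other, hx] using h1, by simp [other, hx], ?_⟩
    obtain h | h | h := hA e he
    · exact absurd h hx
    · exact absurd h hx'
    have := (hl.2 L hL _ h1 _ h2 (Ne.symm hx) (Ne.symm hx') h3).mpr h
    simpa [other, hx, pt] using
      exists_smul_cross this (hl.1 _ h1 _ h2 h3) (hl.1 _ hL _ h1 (Ne.symm hx))
  refine ⟨l, hl, separates_union (l L) ?_ ?_ (separates_of_card_le
    (fun e he => h0 e (mem_union_left _ he)) ?_ (by omega)) hs⟩
  · intro e he
    obtain ⟨-, -, c, -, hc⟩ := hother e he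
    rw [hc, dotProduct_smul, dot_self_cross, smul_zero]
  · intro e he h
    obtain ⟨h1, h2, h3⟩ := hE e (mem_union_right _ he)
    have hne := hB e he
    simp only [On, not_or] at hne
    exact hne.2.2 ((hl.2 L hL _ h1 _ h2 (Ne.symm hne.1) (Ne.symm hne.2.1) h3).mp h)
  · intro e he e' he' hee
    obtain ⟨h1, h2, c, hc, hec⟩ := hother e he
    obtain ⟨h1', h2', c', hc', hec'⟩ := hother e' he'
    obtain ⟨h3, h4⟩ := hAA e he e' he' hee
    exact cross_cross_ne_zero_of_smul hec hec' hc hc' fun h =>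
      h4 ((hl.2 L hL _ h1 _ h1' h2.symm h2'.symm h3).mp h)

/-- Replacing a line whose only triple point is the one on `a` and `b`. -/
lemma Gen.drop (L a b : V) {T' : List (V × V × V)} (hV : Valid W T)
    (hT' : ∀ τ ∈ T, ¬ Has τ L → τ ∈ T')
    (ha : a ∈ W) (hb : b ∈ W) (hab : a ≠ b) (hne : ∀ τ ∈ T', ¬ (Has τ a ∧ Has τ b))
    (hT : ∀ τ ∈ T, Has τ L → ∀ x, Has τ x → x = L ∨ x = a ∨ x = b)
    (hLa : L ≠ a) (hLb : L ≠ b)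
    (hE : ∀ e ∈ E, e.1 ≠ L ∧ e.2 ≠ L) (h : Gen k T' W E t) : Gen k T W E t := by
  obtain ⟨l, hl, hs⟩ := h
  obtain ⟨m, hm, hm1, -⟩ := hl.exists_through ha hb hab hne
  have key : tp (Function.update l L m L) (Function.update l L m a)
      (Function.update l L m b) = 0 := by
    rwa [Function.update_self, Function.update_of_ne hLa.symm, Function.update_of_ne hLb.symm]
  refine gen_of_deform hV (l := Function.update l L m) (fun τ hτ => ?_) ?_
  · obtain ⟨h1, h2, h3, h4, h5, h6⟩ := hV.mem τ hτ
    by_cases hL : Has τ L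
    · have hx := hT τ hτ hL
      constructor
      · refine tp_eq_zero_of_has (τ := (L, a, b)) key (hx _ ?_) (hx _ ?_) (hx _ ?_) <;> simp [Has]
      · by_cases hx1 : τ.2.1 = L
        · have : τ.2.2 ≠ L := by rw [← hx1]; exact h4.symm
          rw [hx1, Function.update_self, Function.update_of_ne this]
          exact hm1 _ h3
        by_cases hx2 : τ.2.2 = L
        · rw [hx2, Function.update_self, Function.update_of_ne hx1, cross_ne_zero_comm]
          exact hm1 _ h2
        rw [Function.update_of_ne hx1, Function.update_of_ne hx2]
        exact hl.1 _ h2 _ h3 h4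
    · have hmem := hT' τ hτ hL
      simp only [Has, not_or] at hL
      rw [Function.update_of_ne (Ne.symm hL.1), Function.update_of_ne (Ne.symm hL.2.1),
        Function.update_of_ne (Ne.symm hL.2.2)]
      exact ⟨(hl.2 _ h1 _ h2 _ h3 h5 h6 h4).mpr ⟨τ, hmem, by simp [Has], by simp [Has],
        by simp [Has]⟩, hl.1 _ h2 _ h3 h4⟩
  · intro e he
    have hpt : ∀ e ∈ E, pt (Function.update l L m) e = pt l e := fun e he => by
      rw [pt, pt, Function.update_of_ne (hE e he).1, Function.update_of_ne (hE e he).2]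
    obtain ⟨f, hf, hf1, hf2⟩ := hs e he
    exact ⟨f, hf, by rwa [hpt e he], fun j hj hje => by rw [hpt j hj]; exact hf2 j hj hje⟩

/-- The line through the point `e` other than `u` and `v`. -/
def nbr (u v : V) (e : V × V) : V := if e.1 = u ∨ e.1 = v then e.2 else e.1

/-- Specialising two lines `u`, `v` to a common line through the intersection of `a` and `b`. -/
lemma Gen.pair (u v a b : V) (hV : Valid W ((v, a, b) :: T)) (huT : ∀ τ ∈ T, ¬ Has τ u)
    (hua : u ≠ a) (hub : u ≠ b) (hE : ∀ e ∈ A ∪ B, e.1 ∈ W ∧ e.2 ∈ W ∧ e.1 ≠ e.2)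
    (hA : ∀ e ∈ A, (e.1 = u ∨ e.1 = v ∨ e.2 = u ∨ e.2 = v) ∧ nbr u v e ≠ u ∧ nbr u v e ≠ v)
    (hB : ∀ e ∈ B, e.1 ≠ u ∧ e.1 ≠ v ∧ e.2 ≠ u ∧ e.2 ≠ v ∧ ¬ SamePair e.1 e.2 a b)
    (hAA : ∀ e ∈ A, ∀ e' ∈ A, e ≠ e' →
      nbr u v e ≠ nbr u v e' ∧ ¬ SamePair (nbr u v e) (nbr u v e') a b)
    (hc : #A ≤ t + 2) (h : Gen k T W B t) : Gen k ((v, a, b) :: T) W (A ∪ B) (t + 1) := by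
  obtain ⟨⟨hv, ha, hb, hab, hva, hvb⟩, hT, -⟩ := id hV
  simp only at hv ha hb hab hva hvb hT
  obtain ⟨l, hl, hs⟩ := h
  obtain ⟨m, hm, hm1, hm2⟩ := hl.exists_through ha hb hab fun τ hτ => (hT τ hτ).2
  let l' : V → Fin 3 → k := fun x => if x = u ∨ x = v then m else l x
  have hl1 : l' u = m := by simp [l']
  have hl2 : l' v = m := by simp [l']
  have hl3 : ∀ x, x ≠ u → x ≠ v → l' x = l x := fun x h1 h2 => by simp [l', h1, h2]
  have hpB : ∀ e ∈ B, pt l' e = pt l e := fun e he => by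
    obtain ⟨h1, h2, h3, h4, -⟩ := hB e he
    rw [pt, pt, hl3 _ h1 h2, hl3 _ h3 h4]
  have hpA : ∀ e ∈ A, nbr u v e ∈ W ∧ ∃ c : k, c ≠ 0 ∧ pt l' e = c • m ⨯₃ l (nbr u v e) := by
    intro e he
    obtain ⟨h1, h2, h3⟩ := hE e (mem_union_left _ he)
    obtain ⟨h4, h5, h6⟩ := hA e he
    by_cases hx : e.1 = u ∨ e.1 = v
    · have hn : nbr u v e = e.2 := by simp [nbr, hx]
      rw [hn] at h5 h6
      refine ⟨by rwa [hn], 1, one_ne_zero, ?_⟩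
      rw [hn, pt, hl3 _ h5 h6, one_smul]
      rcases hx with hx | hx <;> simp [hx, hl1, hl2]
    · have hn : nbr u v e = e.1 := by simp [nbr, hx]
      rw [hn] at h5 h6
      refine ⟨by rwa [hn], -1, by simp, ?_⟩
      rw [hn, pt, hl3 _ h5 h6, neg_one_smul]
      rcases (show e.2 = u ∨ e.2 = v by tauto) with hx | hx <;> simp [hx, hl1, hl2]
  refine gen_of_deform hV (l := l') (fun τ hτ => ?_) (separates_union m ?_ ?_
    (separates_of_card_le ?_ ?_ (by omega)) ?_)
  · rcases List.mem_cons.mp hτ with rfl | hτ'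
    · simp only [hl2, hl3 a hua.symm hva.symm, hl3 b hub.symm hvb.symm]
      exact ⟨hm, hl.1 a ha b hb hab⟩
    · obtain ⟨h1, h2, h3, h4, h5, h6⟩ := hV.mem τ hτ
      have hx := huT τ hτ'
      have hy := (hT τ hτ').1
      simp only [Has, not_or] at hx hy
      rw [hl3 _ (Ne.symm hx.1) (Ne.symm hy.1), hl3 _ (Ne.symm hx.2.1) (Ne.symm hy.2.1),
        hl3 _ (Ne.symm hx.2.2) (Ne.symm hy.2.2)]
      exact ⟨(hl.2 _ h1 _ h2 _ h3 h5 h6 h4).mpr ⟨τ, hτ', by simp [Has], by simp [Has],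
        by simp [Has]⟩, hl.1 _ h2 _ h3 h4⟩
  · intro e he
    obtain ⟨-, c, -, hc⟩ := hpA e he
    rw [hc, dotProduct_smul, dot_self_cross, smul_zero]
  · intro e he
    obtain ⟨h1, h2, h3⟩ := hE e (mem_union_right _ he)
    rw [hpB e he]
    exact hm2 _ h1 _ h2 h3 (hB e he).2.2.2.2
  · intro e he
    obtain ⟨h1, c, hc, he⟩ := hpA e he
    rw [he]
    exact smul_ne_zero hc (hm1 _ h1)
  · intro e he e' he' hee
    obtain ⟨h1, c, hc, hec⟩ := hpA e he
    obtain ⟨h1', c', hc', hec'⟩ := hpA e' he'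
    obtain ⟨h3, h4⟩ := hAA e he e' he' hee
    exact cross_cross_ne_zero_of_smul hec hec' hc hc' (hm2 _ h1 _ h1' h3 h4)
  · intro e he
    obtain ⟨f, hf, hf1, hf2⟩ := hs e he
    exact ⟨f, hf, by rwa [hpB e he], fun j hj hje => by rw [hpB j hj]; exact hf2 j hj hje⟩

end

/-! ### Certificates -/

/-- A step of a degeneration argument. -/
inductive Step
  /-- Impose the triple points `T`. -/
  | set (T : List (ℕ × ℕ × ℕ))
  /-- Specialise to the line `L`. -/
  | line (L : ℕ)
  /-- Specialise `u` and `v` to a common line through the intersection of `a` and `b`. -/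
  | pair (u v a b : ℕ)
  /-- Release the line `L` from the intersection of `a` and `b`. -/
  | drop (L a b : ℕ)

/-- The validity of a degeneration argument. -/
def Check (n : ℕ) : List Step → List (ℕ × ℕ × ℕ) → List (ℕ × ℕ) → ℕ → Prop
  | [], _, E, t => t = 0 ∧ E.length ≤ 1
  | .set T' :: S, T, E, t => (Valid (range n) T' ∧ ∀ τ ∈ T, Coll T' τ.1 τ.2.1 τ.2.2) ∧
      Check n S T' E t
  | .line _ :: _, _, _, 0 => False
  | .line L :: S, T, E, t + 1 => (L ∈ range n ∧
      (∀ e ∈ E.filter (On T L), ∀ e' ∈ E.filter (On T L), e ≠ e' →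
        other L e ≠ other L e' ∧ ¬ Coll T L (other L e) (other L e')) ∧
      (E.filter (On T L)).length ≤ t + 2) ∧ Check n S T (E.filter fun e => ¬ On T L e) t
  | .pair _ _ _ _ :: _, _, _, 0 => False
  | .pair u v a b :: S, T, E, t + 1 =>
      let T' := T.filter fun τ => ¬ Has τ u ∧ ¬ Has τ v
      let A := E.filter fun e => e.1 = u ∨ e.1 = v ∨ e.2 = u ∨ e.2 = v
      let B := E.filter fun e => ¬ (e.1 = u ∨ e.1 = v ∨ e.2 = u ∨ e.2 = v)
      (Valid (range n) ((v, a, b) :: T') ∧ u ≠ a ∧ u ≠ b ∧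
      (∀ τ ∈ T, Coll ((v, a, b) :: T') τ.1 τ.2.1 τ.2.2) ∧
      (∀ e ∈ A, nbr u v e ≠ u ∧ nbr u v e ≠ v) ∧
      (∀ e ∈ B, ¬ SamePair e.1 e.2 a b) ∧
      (∀ e ∈ A, ∀ e' ∈ A, e ≠ e' →
        nbr u v e ≠ nbr u v e' ∧ ¬ SamePair (nbr u v e) (nbr u v e') a b) ∧
      A.length ≤ t + 2) ∧ Check n S T' B t
  | .drop L a b :: S, T, E, t =>
      let T' := T.filter fun τ => ¬ Has τ L
      ((a ∈ range n ∧ b ∈ range n ∧ a ≠ b ∧ L ≠ a ∧ L ≠ b) ∧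
      (∀ τ ∈ T', ¬ (Has τ a ∧ Has τ b)) ∧
      (∀ τ ∈ T, Has τ L → (τ.1 = L ∨ τ.1 = a ∨ τ.1 = b) ∧ (τ.2.1 = L ∨ τ.2.1 = a ∨ τ.2.1 = b) ∧
        (τ.2.2 = L ∨ τ.2.2 = a ∨ τ.2.2 = b)) ∧
      ∀ e ∈ E, e.1 ≠ L ∧ e.2 ≠ L) ∧ Check n S T' E t

instance instDecidableCheck (n : ℕ) : ∀ (S : List Step) (T : List (ℕ × ℕ × ℕ)) (E : List (ℕ × ℕ))
    (t : ℕ), Decidable (Check n S T E t)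
  | [], _, _, _ => inferInstanceAs (Decidable (_ ∧ _))
  | .set T' :: S, _, E, t =>
    have := instDecidableCheck n S T' E t
    inferInstanceAs (Decidable (_ ∧ _))
  | .line _ :: _, _, _, 0 => inferInstanceAs (Decidable False)
  | .line L :: S, T, E, t + 1 =>
    have := instDecidableCheck n S T (E.filter fun e => ¬ On T L e) t
    inferInstanceAs (Decidable ((_ ∧ _ ∧ _) ∧ _))
  | .pair _ _ _ _ :: _, _, _, 0 => inferInstanceAs (Decidable False)
  | .pair u v _ _ :: S, T, E, t + 1 =>
    have := instDecidableCheck n S (T.filter fun τ => ¬ Has τ u ∧ ¬ Has τ v)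
      (E.filter fun e => ¬ (e.1 = u ∨ e.1 = v ∨ e.2 = u ∨ e.2 = v)) t
    inferInstanceAs (Decidable ((_ ∧ _ ∧ _ ∧ _ ∧ _ ∧ _ ∧ _ ∧ _) ∧ _))
  | .drop L _ _ :: S, T, E, t =>
    have := instDecidableCheck n S (T.filter fun τ => ¬ Has τ L) E t
    inferInstanceAs (Decidable ((_ ∧ _ ∧ _ ∧ _) ∧ _))

lemma Valid.filter {W : Finset V} (p : V × V × V → Bool) : ∀ {T : List (V × V × V)}, Valid W T →
    Valid W (T.filter p)
  | [], _ => trivial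
  | τ :: T, ⟨h1, h2, h3⟩ => by
    by_cases h : p τ
    · rw [List.filter_cons_of_pos h]
      exact ⟨h1, fun σ hσ => h2 σ (List.mem_of_mem_filter hσ), h3.filter p⟩
    · rw [List.filter_cons_of_neg h]
      exact h3.filter p

lemma gen_of_check [Infinite k] {n : ℕ} : ∀ {S : List Step} {T : List (ℕ × ℕ × ℕ)}
    {E : List (ℕ × ℕ)} {t : ℕ}, Valid (range n) T → (∀ e ∈ E, e.1 ∈ range n ∧ e.2 ∈ range n ∧
      e.1 ≠ e.2) → Check n S T E t → Gen k T (range n) E.toFinset t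
  | [], _, _, _, hV, hE, h => by
    obtain ⟨rfl, h⟩ := h
    exact gen_of_card_le_one hV (by simpa using hE) ((List.toFinset_card_le _).trans h)
  | .set _ :: _, _, _, _, hV, hE, h => (gen_of_check h.1.1 hE h.2).relax hV h.1.2
  | .line _ :: _, _, _, 0, _, _, h => h.elim
  | .line L :: S, T, E, t + 1, hV, hE, ⟨⟨h1, h2, h3⟩, h4⟩ => by
    have hEq : E.toFinset = (E.filter (On T L)).toFinset ∪
        (E.filter fun e => ¬ On T L e).toFinset := by
      ext e; simp only [List.mem_toFinset, mem_union, List.mem_filter, decide_eq_true_eq]; tauto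
    rw [hEq]
    refine Gen.line L h1 (fun e he => hE e (by rw [← hEq] at he; simpa using he)) ?_ ?_ ?_
      ((List.toFinset_card_le _).trans h3)
      (gen_of_check hV (fun e he => hE e (List.mem_of_mem_filter he)) h4)
    · intro e he; simpa using (List.mem_filter.mp (List.mem_toFinset.mp he)).2
    · intro e he; simpa using (List.mem_filter.mp (List.mem_toFinset.mp he)).2
    · intro e he e' he'; exact h2 e (List.mem_toFinset.mp he) e' (List.mem_toFinset.mp he')
  | .pair _ _ _ _ :: _, _, _, 0, _, _, h => h.elim
  | .pair u v a b :: S, T, E, t + 1, hV, hE, ⟨⟨h2, h4, h5, h6, h7, h8, h9, h10⟩, h11⟩ => by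
    have hEq : E.toFinset = (E.filter fun e => e.1 = u ∨ e.1 = v ∨ e.2 = u ∨ e.2 = v).toFinset ∪
        (E.filter fun e => ¬ (e.1 = u ∨ e.1 = v ∨ e.2 = u ∨ e.2 = v)).toFinset := by
      ext e; simp only [List.mem_toFinset, mem_union, List.mem_filter, decide_eq_true_eq]; tauto
    rw [hEq]
    refine Gen.relax (Gen.pair u v a b h2 ?_ h4 h5
      (fun e he => hE e (by rw [← hEq] at he; simpa using he)) ?_ ?_ ?_
      ((List.toFinset_card_le _).trans h10)
      (gen_of_check h2.2.2 (fun e he => hE e (List.mem_of_mem_filter he)) h11)) hV h6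
    · intro τ hτ; have := (List.mem_filter.mp hτ).2; simp only [decide_eq_true_eq] at this
      exact this.1
    · intro e he
      have h := List.mem_toFinset.mp he
      exact ⟨by simpa using (List.mem_filter.mp h).2, h7 e h⟩
    · intro e he
      have h := List.mem_toFinset.mp he
      have h' := (List.mem_filter.mp h).2
      simp only [decide_eq_true_eq, not_or] at h'
      exact ⟨h'.1, h'.2.1, h'.2.2.1, h'.2.2.2, h8 e h⟩
    · intro e he e' he'; exact h9 e (List.mem_toFinset.mp he) e' (List.mem_toFinset.mp he')
  | .drop L a b :: S, T, E, t, hV, hE, ⟨⟨⟨h1, h2, h3, h4, h5⟩, h6, h7, h8⟩, h9⟩ => by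
    refine (gen_of_check (hV.filter _) hE h9).drop L a b hV ?_ h1 h2 h3 h6 ?_ h4 h5
      (by simpa using h8)
    · intro τ hτ h; simpa [List.mem_filter] using ⟨hτ, h⟩
    · rintro τ hτ h x (rfl | rfl | rfl)
      exacts [(h7 τ hτ h).1, (h7 τ hτ h).2.1, (h7 τ hτ h).2.2]

/-- The pairs of lines of `F` or of `G` of different colours; `(s, i, a)` is the `a`-th line of
colour `i` on the side `s`. -/
def edges (l : List ℕ) : List ((Bool × ℕ × ℕ) × (Bool × ℕ × ℕ)) :=
  [false, true].flatMap fun s => (List.range l.length).flatMap fun j =>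
    (List.range j).flatMap fun i => (List.range (l.getD i 0)).flatMap fun a =>
      (List.range (l.getD j 0)).map fun b => ((s, i, a), (s, j, b))

lemma mem_edges {l : List ℕ} {e : (Bool × ℕ × ℕ) × (Bool × ℕ × ℕ)} :
    e ∈ edges l ↔ e.1.1 = e.2.1 ∧ e.1.2.1 < e.2.2.1 ∧ e.1.2.2 < l.getD e.1.2.1 0 ∧
      e.2.2.2 < l.getD e.2.2.1 0 := by
  obtain ⟨⟨s, i, a⟩, s', j, b⟩ := e
  have hl : ∀ j b, b < l.getD j 0 → j < l.length := fun j b h => by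
    by_contra! hj
    simp [List.getD_eq_getElem?_getD, List.getElem?_eq_none hj] at h
  simp only [edges, List.mem_flatMap, List.mem_range, List.mem_map, Prod.mk.injEq]
  constructor
  · rintro ⟨t, -, j', -, i', hi, a', ha, b', hb, ⟨rfl, rfl, rfl⟩, rfl, rfl, rfl⟩
    exact ⟨rfl, hi, ha, hb⟩
  · rintro ⟨rfl, hi, ha, hb⟩
    exact ⟨s, by cases s <;> simp, j, hl _ _ hb, i, hi, a, ha, b, hb, ⟨rfl, rfl, rfl⟩,
      rfl, rfl, rfl⟩

/-- An encoding of the lines with at most `7` lines of each colour. -/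
def code (v : Bool × ℕ × ℕ) : ℕ := 2 * (7 * v.2.1 + v.2.2) + v.1.toNat

section
variable {ι κ : Type*}

lemma Separates.mono {p : ι → Fin 3 → k} {S S' : Finset ι} {t : ℕ} (h : Separates p S' t)
    (hS : S ⊆ S') : Separates p S t := fun i hi =>
  let ⟨f, h1, h2, h3⟩ := h i (hS hi)
  ⟨f, h1, h2, fun j hj => h3 j (hS hj)⟩

lemma _root_.MvPolynomial.IsHomogeneous.eval_smul {σ : Type*} {f : MvPolynomial σ k} {t : ℕ}
    (hf : f.IsHomogeneous t) (c : k) (x : σ → k) : eval (c • x) f = c ^ t * eval x f := by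
  rw [eval_eq, eval_eq, mul_sum]
  refine sum_congr rfl fun m hm => ?_
  have h : ∑ i ∈ m.support, m i = t := by
    rw [← hf (mem_support_iff.mp hm), ← Finsupp.degree_apply, Finsupp.degree_eq_weight_one]
    rfl
  simp only [Pi.smul_apply, smul_eq_mul, mul_pow, prod_mul_distrib, prod_pow_eq_pow_sum, h]
  ring

lemma Separates.comap {p : ι → Fin 3 → k} {q : κ → Fin 3 → k} {S : Finset ι} {S' : Finset κ}
    {t : ℕ} (h : Separates q S' t) (g : ι → κ) (hg : ∀ i ∈ S, g i ∈ S') (hinj : Set.InjOn g S)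
    (hpq : ∀ i ∈ S, ∃ c : k, c ≠ 0 ∧ p i = c • q (g i)) : Separates p S t := by
  intro i hi
  obtain ⟨f, h1, h2, h3⟩ := h (g i) (hg i hi)
  refine ⟨f, h1, ?_, fun j hj hji => ?_⟩
  · obtain ⟨c, hc, e⟩ := hpq i hi
    rw [e, h1.eval_smul]
    exact mul_ne_zero (pow_ne_zero _ hc) h2
  · obtain ⟨c, -, e⟩ := hpq j hj
    rw [e, h1.eval_smul, h3 _ (hg j hj) (fun h => hji (hinj hj hi h)), mul_zero]

end

section
variable [DecidableEq V] {E E' N : Finset (V × V)} {t : ℕ}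

variable (k) in
/-- The intersection points `E` of pairs of lines of some arrangement impose independent
conditions on forms of degree `t`. -/
def Indep (E : Finset (V × V)) (t : ℕ) : Prop := ∃ l : V → Fin 3 → k, Separates (pt l) E t

omit [DecidableEq V] in
lemma Gen.indep {T : List (V × V × V)} {W : Finset V} (h : Gen k T W E t) : Indep k E t :=
  let ⟨l, _, hl⟩ := h
  ⟨l, hl⟩

lemma Indep.gen [Infinite k] (h : Indep k E t) (W : Finset V) : Gen k [] W E t :=
  let ⟨_, hl⟩ := h
  gen_of_deform (T := []) trivial (by simp) hl

omit [DecidableEq V] in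
lemma Indep.mono (h : Indep k E' t) (hE : E ⊆ E') : Indep k E t :=
  let ⟨l, hl⟩ := h
  ⟨l, hl.mono hE⟩

/-- Two further lines `u` and `v` whose points `N` are kept. -/
lemma Indep.add_pair [Infinite k] (u v : V) (h : Indep k E t)
    (hE : ∀ e ∈ E, e.1 ≠ u ∧ e.1 ≠ v ∧ e.2 ≠ u ∧ e.2 ≠ v ∧ e.1 ≠ e.2)
    (hN : ∀ e ∈ N, (e.1 = u ∨ e.1 = v) ∧ e.2 ≠ u ∧ e.2 ≠ v)
    (hNN : ∀ e ∈ N, ∀ e' ∈ N, e ≠ e' → e.2 ≠ e'.2) (hc : #N ≤ t + 2) :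
    Indep k (N ∪ E) (t + 1) := by
  obtain ⟨l, hl, hs⟩ := h.gen (insert u ((N ∪ E).image Prod.fst ∪ (N ∪ E).image Prod.snd))
  have hu : u ∈ insert u ((N ∪ E).image Prod.fst ∪ (N ∪ E).image Prod.snd) := by simp
  have h1 : ∀ e ∈ N ∪ E, e.1 ∈ insert u ((N ∪ E).image Prod.fst ∪ (N ∪ E).image Prod.snd) :=
    fun e he => mem_insert_of_mem (mem_union_left _ (mem_image_of_mem _ he))
  have h2 : ∀ e ∈ N ∪ E, e.2 ∈ insert u ((N ∪ E).image Prod.fst ∪ (N ∪ E).image Prod.snd) :=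
    fun e he => mem_insert_of_mem (mem_union_right _ (mem_image_of_mem _ he))
  generalize insert u ((N ∪ E).image Prod.fst ∪ (N ∪ E).image Prod.snd) = W at *
  have htp : ∀ x ∈ W, ∀ y ∈ W, u ≠ x → u ≠ y → x ≠ y → tp (l u) (l x) (l y) ≠ 0 :=
    fun x hx y hy hux huy hxy h => by
      simpa [Coll] using (hl.2 u hu x hx y hy hux huy hxy).mp h
  have hpN : ∀ e ∈ N, pt (fun x => if x = v then l u else l x) e = l u ⨯₃ l e.2 := fun e he => by
    obtain ⟨h3, h4, h5⟩ := hN e he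
    by_cases h : e.1 = v
    · simp [pt, h, h5]
    · simp [pt, h5, h3.resolve_right h, h3.resolve_right h ▸ h]
  have hpE : ∀ e ∈ E, pt (fun x => if x = v then l u else l x) e = pt l e := fun e he => by
    simp [pt, hE e he]
  refine ⟨fun x => if x = v then l u else l x, separates_union (l u) ?_ ?_
    (separates_of_card_le ?_ ?_ hc) (hs.comap id (by simp) (by simp) fun e he =>
      ⟨1, one_ne_zero, by simp [hpE e he]⟩)⟩
  · intro e he
    rw [hpN e he, dot_self_cross]
  · intro e he
    obtain ⟨h3, -, h4, -, h5⟩ := hE e he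
    rw [hpE e he]
    exact htp _ (h1 e (mem_union_right _ he)) _ (h2 e (mem_union_right _ he)) h3.symm h4.symm h5
  · intro e he
    rw [hpN e he]
    exact hl.1 _ hu _ (h2 e (mem_union_left _ he)) (hN e he).2.1.symm
  · intro e he e' he' hee
    rw [hpN e he, hpN e' he']
    exact cross_cross_ne_zero (htp _ (h2 e (mem_union_left _ he)) _ (h2 e' (mem_union_left _ he'))
      (hN e he).2.1.symm (hN e' he').2.1.symm (hNN e he e' he' hee))

end

/-! ### Colour patterns -/

/-- Lines of `F` and of `G`: `(s, i, a)` is the `a`-th line of colour `i` on the side `s`. -/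
abbrev Ln : Type := Bool × ℕ × ℕ

/-- The elements of `edges l`, as a finite set. -/
def Pts (l : List ℕ) : Finset (Ln × Ln) := (edges l).toFinset

lemma mem_pts {l : List ℕ} {e : Ln × Ln} : e ∈ Pts l ↔ e.1.1 = e.2.1 ∧ e.1.2.1 < e.2.2.1 ∧
    e.1.2.2 < l.getD e.1.2.1 0 ∧ e.2.2.2 < l.getD e.2.2.1 0 := by
  rw [Pts, List.mem_toFinset, mem_edges]

variable (k) in
/-- All intersection points impose independent conditions. -/
def Surj (l : List ℕ) : Prop := Indep k (Pts l) l.sum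

variable (k) in
/-- No form of degree `l.sum` passes through all intersection points. -/
def Inj (l : List ℕ) : Prop := ∃ E' ⊆ Pts l, (l.sum + 2).choose 2 = #E' ∧ Indep k E' l.sum

/-- A refinement of colour patterns. -/
def Emb (l l' : List ℕ) : Prop := ∃ φ : Ln → Ln, Function.Injective φ ∧
  ∀ e ∈ Pts l, (φ e.1, φ e.2) ∈ Pts l' ∨ (φ e.2, φ e.1) ∈ Pts l'

lemma Emb.exists_map {l l' : List ℕ} (h : Emb l l') : ∃ (φ : Ln → Ln) (g : Ln × Ln → Ln × Ln),
    Function.Injective φ ∧ Set.InjOn g (Pts l) ∧ ∀ e ∈ Pts l, g e ∈ Pts l' ∧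
      (g e = (φ e.1, φ e.2) ∨ g e = (φ e.2, φ e.1)) := by
  obtain ⟨φ, hφ, h⟩ := h
  refine ⟨φ, fun e => if (φ e.1, φ e.2) ∈ Pts l' then (φ e.1, φ e.2) else (φ e.2, φ e.1), hφ,
    ?_, ?_⟩
  · intro e he e' he' hee
    have h1 := (mem_pts.mp he).2.1
    have h2 := (mem_pts.mp he').2.1
    obtain ⟨a, b⟩ := e
    obtain ⟨a', b'⟩ := e'
    have key : (φ a = φ a' ∧ φ b = φ b') ∨ (φ a = φ b' ∧ φ b = φ a') := by
      simp only at hee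
      split_ifs at hee <;> simp only [Prod.mk.injEq] at hee <;> tauto
    rcases key with ⟨h3, h4⟩ | ⟨h3, h4⟩
    · rw [hφ h3, hφ h4]
    · rw [hφ h3, hφ h4] at h1
      simp only at h1 h2
      omega
  · intro e he
    dsimp only
    split_ifs with h1
    · exact ⟨h1, Or.inl rfl⟩
    · exact ⟨(h e he).resolve_left h1, Or.inr rfl⟩

lemma Emb.surj {l l' : List ℕ} (h : Emb l l') (hs : l'.sum = l.sum) (hl : Surj k l') :
    Surj k l := by
  obtain ⟨φ, g, -, hg, h⟩ := h.exists_map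
  obtain ⟨p, hp⟩ := hl
  refine ⟨p ∘ φ, hs ▸ hp.comap g (fun e he => (h e he).1) hg fun e he => ?_⟩
  rcases (h e he).2 with h | h
  · exact ⟨1, one_ne_zero, by simp [pt, h]⟩
  · exact ⟨-1, by simp, by simp [pt, h]⟩

lemma Emb.inj {l l' : List ℕ} (h : Emb l l') (hs : l'.sum = l.sum) (hl : Inj k l) :
    Inj k l' := by
  obtain ⟨φ, g, hφ, hg, h⟩ := h.exists_map
  obtain ⟨E', hE', hc, p, hp⟩ := hl
  have hg' : Set.InjOn g E' := hg.mono hE'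
  refine ⟨E'.image g, fun e he => ?_, by rw [hs, hc, card_image_of_injOn hg'],
    p ∘ Function.invFun φ, hs ▸ hp.comap (Function.invFunOn g E') ?_ ?_ ?_⟩
  · obtain ⟨e', he', rfl⟩ := mem_image.mp he
    exact (h e' (hE' he')).1
  · intro e he
    exact Function.invFunOn_mem (by simpa using he)
  · rw [coe_image]
    exact Function.invFunOn_injOn_image g E'
  · intro e he
    obtain ⟨e', he', rfl⟩ := mem_image.mp he
    rw [hg'.leftInvOn_invFunOn he']
    have := Function.leftInverse_invFun hφ
    rcases (h e' (hE' he')).2 with h | h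
    · exact ⟨1, one_ne_zero, by simp [pt, h, this _]⟩
    · exact ⟨-1, by simp, by simp [pt, h, this _]⟩

lemma sum_range_getD (l : List ℕ) : ∑ i ∈ range l.length, l.getD i 0 = l.sum := by
  induction l with
  | nil => simp
  | cons x l ih => rw [List.length_cons, sum_range_succ', List.sum_cons, ← ih]; simp [add_comm]

lemma _root_.List.Perm.exists_getD {l l' : List ℕ} (h : l.Perm l') :
    ∃ σ : ℕ → ℕ, Function.Injective σ ∧ ∀ i, l'.getD (σ i) 0 = l.getD i 0 := by
  induction h with
  | nil => exact ⟨id, Function.injective_id, fun _ => rfl⟩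
  | cons x _ ih =>
    obtain ⟨σ, hσ, h⟩ := ih
    refine ⟨fun i => i.casesOn 0 fun i => σ i + 1, ?_, ?_⟩
    · rintro (_ | i) (_ | j) hij
      · rfl
      · simp at hij
      · simp at hij
      · simpa using hσ (by simpa using hij)
    · rintro (_ | i)
      · rfl
      · simpa using h i
  | swap x y l =>
    refine ⟨Equiv.swap 0 1, (Equiv.swap 0 1).injective, ?_⟩
    rintro (_ | _ | i)
    · simp
    · simp
    · rw [Equiv.swap_apply_of_ne_of_ne (by simp) (by simp)]; simp
  | trans _ _ ih ih' =>
    obtain ⟨σ, hσ, h⟩ := ih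
    obtain ⟨τ, hτ, h'⟩ := ih'
    exact ⟨τ ∘ σ, hτ.comp hσ, fun i => (h' _).trans (h i)⟩

lemma _root_.List.Perm.emb {l l' : List ℕ} (h : l.Perm l') : Emb l l' := by
  obtain ⟨σ, hσ, h⟩ := h.exists_getD
  refine ⟨fun v => (v.1, σ v.2.1, v.2.2), ?_, ?_⟩
  · rintro ⟨s, i, a⟩ ⟨s', i', a'⟩ h
    simp only [Prod.mk.injEq] at h ⊢
    exact ⟨h.1, hσ h.2.1, h.2.2⟩
  · intro e he
    obtain ⟨h1, h2, h3, h4⟩ := mem_pts.mp he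
    rw [mem_pts, mem_pts]
    simp only [h]
    rcases lt_or_gt_of_ne (hσ.ne h2.ne) with h5 | h5
    · exact Or.inl ⟨h1, h5, h3, h4⟩
    · exact Or.inr ⟨h1.symm, h5, h4, h3⟩

lemma Surj.perm {l l' : List ℕ} (hl : Surj k l) (h : l.Perm l') : Surj k l' :=
  h.symm.emb.surj h.sum_eq hl

lemma Inj.perm {l l' : List ℕ} (hl : Inj k l) (h : l.Perm l') : Inj k l' :=
  h.emb.inj h.symm.sum_eq hl

lemma emb_merge (x y : ℕ) (r : List ℕ) : Emb ((x + y) :: r) (x :: y :: r) := by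
  refine ⟨fun v => match v with
    | (s, 0, a) => if a < x then (s, 0, a) else (s, 1, a - x)
    | (s, i + 1, a) => (s, i + 2, a), ?_, ?_⟩
  · rintro ⟨s, _ | i, a⟩ ⟨s', _ | i', a'⟩ h <;> dsimp only at h <;> (try split_ifs at h) <;>
      simp only [Prod.mk.injEq] at h ⊢ <;> obtain ⟨h1, h2, h3⟩ := h <;>
      exact ⟨h1, by omega, by omega⟩
  · rintro ⟨⟨s, i, a⟩, s', j, b⟩ he
    obtain ⟨h1, h2, h3, h4⟩ := mem_pts.mp he
    obtain ⟨j, rfl⟩ := Nat.exists_eq_succ_of_ne_zero (Nat.ne_zero_of_lt h2)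
    left
    rw [mem_pts]
    rcases i with _ | i
    · dsimp only at h1 h3 h4 ⊢
      split_ifs with h <;> simp_all; omega
    · simpa using ⟨h1, by simpa using h2, h3, h4⟩

lemma Surj.merge {x y : ℕ} {r : List ℕ} (h : Surj k (x :: y :: r)) : Surj k ((x + y) :: r) :=
  (emb_merge x y r).surj (by simp [add_assoc]) h

lemma Inj.split {x y : ℕ} {r : List ℕ} (h : Inj k ((x + y) :: r)) : Inj k (x :: y :: r) :=
  (emb_merge x y r).inj (by simp [add_assoc]) h

/-- The points on the `x`-th lines of colour `0`. -/
def newPts (x : ℕ) (r : List ℕ) : Finset (Ln × Ln) :=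
  ((univ : Finset Bool) ×ˢ (range r.length).sigma fun j => range (r.getD j 0)).image
    fun p => ((p.1, 0, x), (p.1, p.2.1 + 1, p.2.2))

lemma card_newPts (x : ℕ) (r : List ℕ) : #(newPts x r) = 2 * r.sum := by
  rw [newPts, card_image_of_injective, card_product, card_sigma]
  · simp only [card_univ, Fintype.card_bool, card_range, sum_range_getD]
  · rintro ⟨s, i, a⟩ ⟨s', i', a'⟩ h
    simp only [Prod.mk.injEq, Nat.add_right_cancel_iff, and_true] at h
    obtain ⟨⟨rfl, -⟩, -, rfl, rfl⟩ := h
    rfl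

lemma mem_newPts {x : ℕ} {r : List ℕ} {e : Ln × Ln} : e ∈ newPts x r ↔
    e.1.1 = e.2.1 ∧ e.1.2 = (0, x) ∧ ∃ j, e.2.2.1 = j + 1 ∧ e.2.2.2 < r.getD j 0 := by
  obtain ⟨⟨s, i, a⟩, s', j, b⟩ := e
  simp only [newPts, mem_image, mem_product, mem_univ, true_and, mem_sigma, mem_range,
    Prod.mk.injEq, Prod.exists, Sigma.exists]
  constructor
  · rintro ⟨s, j, a, ⟨-, h⟩, ⟨rfl, rfl, rfl⟩, rfl, rfl, rfl⟩
    exact ⟨rfl, ⟨rfl, rfl⟩, j, rfl, h⟩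
  · rintro ⟨rfl, ⟨rfl, rfl⟩, j, rfl, h⟩
    refine ⟨s, j, b, ⟨?_, h⟩, ⟨rfl, rfl, rfl⟩, rfl, rfl, rfl⟩
    by_contra! hj
    simp [List.getD_eq_getElem?_getD, List.getElem?_eq_none hj] at h

lemma pts_succ (x : ℕ) (r : List ℕ) : Pts ((x + 1) :: r) = newPts x r ∪ Pts (x :: r) := by
  ext ⟨⟨s, i, a⟩, s', j, b⟩
  rw [mem_union, mem_newPts, mem_pts, mem_pts]
  rcases j with _ | j
  · simp
  rcases i with _ | i
  · simp only [List.getD_cons_zero, List.getD_cons_succ, Prod.mk.injEq, true_and,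
      Nat.add_right_cancel_iff, exists_eq_left', Nat.lt_succ_iff_lt_or_eq]
    have := Nat.eq_zero_or_pos j
    tauto
  · simp

lemma Indep.add_newPts [Infinite k] {x : ℕ} {r : List ℕ} {A B : Finset (Ln × Ln)} {t : ℕ}
    (hA : A ⊆ Pts (x :: r)) (hB : B ⊆ newPts x r) (hc : #B ≤ t + 2) (h : Indep k A t) :
    Indep k (B ∪ A) (t + 1) := by
  refine h.add_pair (false, 0, x) (true, 0, x) ?_ ?_ ?_ hc
  · rintro ⟨⟨s, i, a⟩, s', j, b⟩ he
    obtain ⟨h1, h2, h3, h4⟩ := mem_pts.mp (hA he)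
    simp only at h1 h2 h3 h4
    have : i = 0 → a ≠ x := by rintro rfl; simpa using h3.ne
    simp only [ne_eq, Prod.mk.injEq]
    refine ⟨?_, ?_, ?_, ?_, ?_⟩ <;> omega
  · rintro ⟨⟨s, i, a⟩, s', j, b⟩ he
    obtain ⟨h1, h2, j, h3, h4⟩ := mem_newPts.mp (hB he)
    simp only [Prod.mk.injEq] at h1 h2 h3 h4
    obtain ⟨rfl, rfl⟩ := h2
    subst h3
    cases s <;> simp
  · rintro ⟨⟨s, i, a⟩, s', j, b⟩ he ⟨⟨t, i', a'⟩, t', j', b'⟩ he' hee h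
    obtain ⟨h1, h2, -⟩ := mem_newPts.mp (hB he)
    obtain ⟨h1', h2', -⟩ := mem_newPts.mp (hB he')
    simp only [Prod.mk.injEq] at h1 h2 h1' h2' h
    obtain ⟨rfl, rfl, rfl⟩ := h
    exact hee (by simp [h1, h1', h2, h2'])

lemma Surj.succ [Infinite k] {x : ℕ} {r : List ℕ} (h : Surj k (x :: r)) (hx : r.sum ≤ x + 2) :
    Surj k ((x + 1) :: r) := by
  have hc : #(newPts x r) ≤ (x :: r).sum + 2 := by rw [card_newPts, List.sum_cons]; omega
  have := Indep.add_newPts Subset.rfl Subset.rfl hc h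
  rw [← pts_succ] at this
  rwa [Surj, List.sum_cons, add_right_comm, ← List.sum_cons]

lemma Inj.succ [Infinite k] {x : ℕ} {r : List ℕ} (h : Inj k (x :: r)) (hx : x + 2 ≤ r.sum) :
    Inj k ((x + 1) :: r) := by
  obtain ⟨A, hA, hc, h⟩ := h
  obtain ⟨B, hB, hBc⟩ := exists_subset_card_eq (s := newPts x r) (n := x + r.sum + 2)
    (by rw [card_newPts]; omega)
  have hs : ((x + 1) :: r).sum = (x :: r).sum + 1 := by simp only [List.sum_cons]; omega
  refine ⟨B ∪ A, ?_, ?_, hs ▸ Indep.add_newPts hA hB (by simp [hBc]) h⟩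
  · rw [pts_succ]
    exact union_subset_union hB hA
  · rw [card_union_of_disjoint, ← hc, hBc, hs, List.sum_cons,
      show x + r.sum + 1 + 2 = (x + r.sum + 2) + 1 by ring, Nat.choose_succ_succ' _ 1]
    · simp
    · refine disjoint_left.mpr fun e he he' => ?_
      obtain ⟨-, h2, -⟩ := mem_newPts.mp (hB he)
      obtain ⟨-, -, h3, -⟩ := mem_pts.mp (hA he')
      rw [h2] at h3
      simp at h3

/-! ### Base cases -/

lemma surj_of_check [Infinite k] {l : List ℕ} {n : ℕ} (S : List Step)
    (hn : ((edges l).map (Prod.map code code)).Nodup)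
    (hE : ∀ e ∈ (edges l).map (Prod.map code code), e.1 ∈ range n ∧ e.2 ∈ range n ∧ e.1 ≠ e.2)
    (h : Check n S [] ((edges l).map (Prod.map code code)) l.sum) : Surj k l := by
  obtain ⟨p, hp⟩ := (gen_of_check (k := k) (T := []) trivial hE h).indep
  refine ⟨p ∘ code, hp.comap (Prod.map code code) (fun e he => ?_) (fun e he e' he' hee => ?_)
    fun e _ => ⟨1, one_ne_zero, by simp [pt]⟩⟩
  · rw [Pts, List.mem_toFinset] at he
    exact List.mem_toFinset.mpr (List.mem_map_of_mem he)
  · rw [mem_coe, Pts, List.mem_toFinset] at he he'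
    exact List.inj_on_of_nodup_map hn he he' hee

lemma Surj.inj {l : List ℕ} (h : Surj k l) (hc : (l.sum + 2).choose 2 = #(Pts l)) : Inj k l :=
  ⟨_, Subset.rfl, hc, h⟩

section
variable [Infinite k]

lemma surj_1111 : Surj k [1, 1, 1, 1] :=
  surj_of_check (n := 58)
    [.line 14, .line 1, .set [(15, 42, 43)], .line 42, .set [(15, 42, 43), (0, 28, 43)], .line
      43]
    (by decide +kernel) (by decide +kernel) (by decide +kernel)

lemma surj_11111 : Surj k [1, 1, 1, 1, 1] :=
  surj_of_check (n := 72)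
    [.set [(1, 42, 57), (15, 29, 42)], .line 42, .set [(15, 29, 42), (42, 1, 57), (1, 28, 29),
      (28, 43, 57)], .line 28, .set [(43, 28, 57), (57, 1, 42), (42, 15, 29), (28, 1, 29), (0,
      1, 15)], .line 0, .drop 0 1 15, .pair 56 15 29 42, .line 29]
    (by decide +kernel) (by decide +kernel) (by decide +kernel)

lemma surj_21111 : Surj k [2, 1, 1, 1, 1] :=
  surj_of_check (n := 72)
    [.set [(2, 42, 57), (28, 56, 57)], .line 57, .set [(2, 42, 57), (28, 56, 57), (3, 0, 15),
      (0, 1, 29)], .line 0, .set [(2, 42, 57), (28, 56, 57), (3, 0, 15), (0, 1, 29), (29, 42,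
      43), (1, 15, 42)], .line 42, .set [(2, 42, 57), (28, 56, 57), (3, 0, 15), (0, 1, 29), (29,
      42, 43), (1, 15, 42), (14, 43, 56)], .line 43, .line 2, .line 29]
    (by decide +kernel) (by decide +kernel) (by decide +kernel)

lemma inj_21111 : Inj k [2, 1, 1, 1, 1] := surj_21111.inj (by decide +kernel)

lemma surj_2221 : Surj k [2, 2, 2, 1] :=
  surj_of_check (n := 58)
    [.set [(2, 16, 43), (28, 42, 43)], .line 43, .set [(2, 16, 43), (28, 42, 43), (1, 0, 31),
      (0, 3, 29)], .line 0, .set [(2, 16, 43), (28, 42, 43), (1, 0, 31), (0, 3, 29), (3, 15,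
      30), (17, 29, 30)], .line 30, .set [(2, 16, 43), (43, 28, 42), (1, 0, 31), (0, 3, 29), (3,
      15, 30), (17, 29, 30), (14, 31, 42), (16, 28, 31)], .line 31, .set [(2, 16, 43), (43, 28,
      42), (15, 3, 30), (30, 17, 29), (14, 31, 42), (16, 28, 31), (31, 0, 1), (0, 3, 29), (1,
      28, 29), (3, 17, 28)], .line 28, .set [(2, 16, 43), (43, 28, 42), (14, 31, 42), (16, 28,
      31), (31, 0, 1), (0, 3, 29), (1, 28, 29), (28, 3, 17), (3, 15, 30), (17, 29, 30), (15, 29,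
      42)], .line 42, .line 1]
    (by decide +kernel) (by decide +kernel) (by decide +kernel)

lemma inj_2221 : Inj k [2, 2, 2, 1] := surj_2221.inj (by decide +kernel)

lemma surj_3311 : Surj k [3, 3, 1, 1] :=
  surj_of_check (n := 58)
    [.set [(18, 42, 43), (4, 14, 43)], .line 43, .line 28, .pair 3 14 4 43, .drop 43 18 42,
      .pair 18 15 56 57, .pair 4 1 56 57, .pair 0 19 56 57, .set [(5, 16, 29)], .line 16, .drop
      16 5 29, .pair 42 5 56 57]
    (by decide +kernel) (by decide +kernel) (by decide +kernel)

lemma surj_4411 : Surj k [4, 4, 1, 1] :=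
  surj_of_check (n := 58)
    [.set [(4, 18, 43), (6, 28, 43)], .line 43, .pair 7 18 4 43, .drop 43 6 28, .pair 0 17 56
      57, .pair 6 3 56 57, .pair 14 15 56 57, .set [(1, 4, 21), (4, 5, 29)], .line 4, .set [(1,
      4, 21), (4, 5, 29), (16, 19, 42), (19, 20, 28)], .line 19, .set [(1, 4, 21), (4, 5, 29),
      (20, 19, 28), (19, 16, 42), (2, 16, 21), (21, 28, 42)], .line 21, .set [(5, 4, 29), (4, 1,
      21), (2, 16, 21), (16, 19, 42), (19, 20, 28), (21, 28, 42), (1, 20, 29)], .line 20, .line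
      28]
    (by decide +kernel) (by decide +kernel) (by decide +kernel)

lemma inj_4411 : Inj k [4, 4, 1, 1] := surj_4411.inj (by decide +kernel)

lemma surj_333 : Surj k [3, 3, 3] :=
  surj_of_check (n := 44)
    [.set [(4, 29, 32), (2, 18, 29), (0, 16, 29), (14, 28, 29)], .line 29, .set [(32, 4, 29),
      (18, 2, 29), (0, 16, 29), (14, 28, 29), (4, 16, 31), (2, 28, 31)], .line 31, .set [(18, 2,
      29), (2, 28, 31), (28, 14, 29), (31, 4, 16), (16, 0, 29), (29, 4, 32), (0, 32, 33), (4,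
      14, 33)], .line 33, .set [(3, 15, 18), (5, 17, 18), (18, 2, 29), (2, 28, 31), (28, 14,
      29), (31, 4, 16), (16, 0, 29), (29, 4, 32), (0, 32, 33), (4, 14, 33)], .line 18, .set [(5,
      17, 18), (1, 14, 15), (15, 3, 18), (18, 2, 29), (2, 28, 31), (28, 14, 29), (31, 4, 16),
      (16, 0, 29), (29, 4, 32), (0, 32, 33), (4, 14, 33), (3, 14, 19)], .line 14, .set [(5, 17,
      18), (19, 3, 14), (3, 15, 18), (15, 1, 14), (18, 2, 29), (2, 28, 31), (28, 14, 29), (31,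
      4, 16), (14, 4, 33), (4, 29, 32), (29, 0, 16), (0, 32, 33), (1, 16, 17)], .line 16, .set
      [(5, 17, 18), (19, 3, 14), (30, 3, 17), (3, 15, 18), (15, 1, 14), (18, 2, 29), (2, 28,
      31), (28, 14, 29), (31, 4, 16), (14, 4, 33), (4, 29, 32), (29, 0, 16), (0, 32, 33), (1,
      16, 17)], .line 30, .set [(5, 17, 18), (30, 3, 17), (17, 1, 16), (1, 14, 15), (15, 3, 18),
      (3, 14, 19), (18, 2, 29), (19, 2, 32), (2, 28, 31), (28, 14, 29), (31, 4, 16), (14, 4,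
      33), (4, 29, 32), (16, 0, 29), (0, 32, 33)], .line 19, .line 28]
    (by decide +kernel) (by decide +kernel) (by decide +kernel)

lemma surj_433 : Surj k [4, 3, 3] :=
  surj_of_check (n := 44)
    [.set [(4, 18, 33), (6, 30, 33), (0, 14, 33), (16, 32, 33)], .line 33, .pair 3 6 30 33, .set
      [(18, 4, 33), (0, 14, 33), (16, 32, 33), (7, 4, 15), (1, 4, 29), (5, 4, 17), (4, 19, 31)],
      .line 4, .set [(14, 0, 33), (16, 32, 33), (33, 4, 18), (7, 4, 15), (1, 4, 29), (5, 4, 17),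
      (4, 19, 31), (2, 30, 31), (18, 31, 32), (0, 28, 31)], .line 31, .set [(7, 4, 15), (1, 4,
      29), (5, 4, 17), (19, 4, 31), (4, 18, 33), (2, 30, 31), (18, 31, 32), (28, 0, 31), (0, 14,
      33), (33, 16, 32), (14, 29, 32), (16, 29, 30)], .line 29, .set [(7, 4, 15), (1, 4, 29),
      (17, 4, 5), (19, 4, 31), (4, 18, 33), (18, 31, 32), (28, 0, 31), (31, 2, 30), (0, 14, 33),
      (33, 16, 32), (14, 29, 32), (16, 29, 30), (2, 5, 15)], .line 2, .set [(7, 4, 15), (1, 4,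
      29), (17, 4, 5), (28, 0, 31), (15, 2, 5), (2, 30, 31), (30, 16, 29), (16, 32, 33), (29,
      14, 32), (32, 18, 31), (31, 4, 19), (4, 18, 33), (14, 0, 33), (0, 5, 19)], .line 0, .set
      [(7, 4, 15), (17, 4, 5), (28, 0, 31), (15, 2, 5), (2, 30, 31), (5, 0, 19), (19, 4, 31),
      (31, 18, 32), (0, 14, 33), (14, 29, 32), (32, 16, 33), (16, 29, 30), (29, 1, 4), (4, 18,
      33), (1, 18, 30)], .line 1, .line 28, .line 7]
    (by decide +kernel) (by decide +kernel) (by decide +kernel)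

lemma inj_433 : Inj k [4, 3, 3] := surj_433.inj (by decide +kernel)

lemma surj_552 : Surj k [5, 5, 2] :=
  surj_of_check (n := 44)
    [.set [(9, 19, 30), (5, 23, 30)], .line 30, .pair 20 19 9 30, .drop 30 5 23, .pair 8 9 42
      43, .pair 18 5 42 43, .pair 0 17 42 43, .set [(7, 6, 23), (1, 6, 21), (3, 6, 31), (6, 15,
      29)], .line 6, .pair 14 7 6 23, .set [(21, 1, 6), (3, 6, 31), (6, 15, 29), (16, 1, 28),
      (1, 4, 22)], .line 1, .set [(21, 1, 6), (29, 6, 15), (6, 3, 31), (16, 1, 28), (1, 4, 22),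
      (3, 2, 15), (2, 23, 31)], .line 2, .set [(16, 1, 28), (4, 1, 22), (1, 6, 21), (21, 28,
      29), (29, 6, 15), (6, 3, 31), (15, 2, 3), (2, 23, 31), (3, 23, 28)], .line 28, .set [(22,
      1, 4), (4, 16, 31), (16, 1, 28), (1, 6, 21), (21, 28, 29), (29, 6, 15), (6, 3, 31), (15,
      2, 3), (2, 23, 31), (3, 23, 28)], .line 31, .line 29]
    (by decide +kernel) (by decide +kernel) (by decide +kernel)

lemma surj_662 : Surj k [6, 6, 2] :=
  surj_of_check (n := 44)
    [.set [(6, 30, 31), (18, 28, 31), (10, 16, 31)], .line 31, .pair 21 10 16 31, .pair 16 9 42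
      43, .pair 23 18 28 31, .drop 31 6 30, .pair 6 19 42 43, .pair 20 5 42 43, .pair 4 11 42
      43, .set [(3, 14, 15), (17, 14, 29), (1, 14, 25)], .line 14, .set [(15, 3, 14), (1, 14,
      25), (14, 17, 29), (25, 22, 29), (3, 17, 22)], .line 22, .set [(15, 3, 14), (1, 14, 25),
      (14, 17, 29), (25, 22, 29), (3, 17, 22), (0, 24, 29), (8, 29, 30)], .line 29, .set [(15,
      3, 14), (1, 14, 25), (14, 17, 29), (17, 3, 22), (22, 25, 29), (0, 24, 29), (8, 29, 30),
      (3, 25, 28)], .line 28, .drop 28 3 25, .pair 2 15 3 14, .set [(3, 17, 22), (22, 25, 29),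
      (24, 0, 29), (8, 29, 30), (29, 14, 17), (14, 1, 25), (1, 0, 17), (0, 7, 25)], .line 0,
      .set [(3, 17, 22), (22, 25, 29), (30, 8, 29), (7, 0, 25), (25, 1, 14), (14, 17, 29), (29,
      0, 24), (0, 1, 17), (8, 17, 24)], .line 17]
    (by decide +kernel) (by decide +kernel) (by decide +kernel)

lemma inj_662 : Inj k [6, 6, 2] := surj_662.inj (by decide +kernel)

end

/-! ### All colour patterns -/

section
variable [Infinite k]

lemma exists_sorted_perm (l : List ℕ) : ∃ l' : List ℕ, l'.Perm l ∧ l'.Pairwise (· ≤ ·) :=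
  ⟨l.insertionSort (· ≤ ·), List.perm_insertionSort _ l, List.pairwise_insertionSort _ l⟩

lemma inj_three {a b c : ℕ} (hab : b ≤ a) (hbc : c ≤ b) (h : a < b + c)
    (h' : 3 ≤ c ∧ 4 ≤ a ∨ c = 2 ∧ 6 ≤ b) : Inj k [a, b, c] := by
  induction hn : a + b + c using Nat.strong_induction_on generalizing a b c with
  | _ n ih =>
    have step₁ : b < a → (3 ≤ c ∧ 5 ≤ a ∨ c = 2 ∧ 6 ≤ b) → Inj k [a, b, c] := by
      rintro h1 h2
      obtain ⟨a, rfl⟩ := Nat.exists_eq_add_one_of_ne_zero (Nat.ne_zero_of_lt h1)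
      exact (ih _ (by omega) (a := a) (b := b) (c := c) (by omega) hbc (by omega) (by omega)
        rfl).succ (by simp; omega)
    have step₂ : c < b → b = a → (3 ≤ c ∧ 4 ≤ a ∨ c = 2 ∧ 7 ≤ b) → Inj k [a, b, c] := by
      rintro h1 rfl h2
      obtain ⟨a, rfl⟩ := Nat.exists_eq_add_one_of_ne_zero (Nat.ne_zero_of_lt h1)
      exact ((ih _ (by omega) (a := a + 1) (b := a) (c := c) (by omega) (by omega) (by omega)
        (by omega) rfl).perm (.swap _ _ _)).succ (by simp; omega)
    rcases h' with ⟨h1, h2⟩ | ⟨rfl, h2⟩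
    · rcases hab.lt_or_eq with h3 | h3
      · rcases h2.lt_or_eq with h4 | rfl
        · exact step₁ h3 (by omega)
        · obtain ⟨rfl, rfl⟩ : b = 3 ∧ c = 3 := by omega
          exact inj_433
      · rcases hbc.lt_or_eq with h4 | rfl
        · exact step₂ h4 h3 (by omega)
        · subst h3
          obtain ⟨c, rfl⟩ := Nat.exists_eq_add_one_of_ne_zero (Nat.ne_zero_of_lt h1)
          exact (((ih _ (by omega) (a := c + 1) (b := c + 1) (c := c) (by omega) (by omega)
            (by omega) (by omega) rfl).perm (List.perm_append_comm (l₁ := [c + 1, c + 1])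
            (l₂ := [c]))).succ (by simp; omega))
    · rcases hab.lt_or_eq with h3 | h3
      · exact step₁ h3 (by omega)
      · rcases h2.lt_or_eq with h4 | rfl
        · exact step₂ (by omega) h3 (by omega)
        · subst h3
          exact inj_662

lemma inj_of_length_eq_three {l : List ℕ} (hl : l.length = 3) (h3 : ∀ x ∈ l, 3 ≤ x)
    (h : ∀ x ∈ l, 2 * x < l.sum) (hs : 10 ≤ l.sum) : Inj k l := by
  obtain ⟨l', hp, hs'⟩ := exists_sorted_perm l
  rw [← hp.length_eq] at hl
  simp only [← hp.mem_iff, ← hp.sum_eq] at h3 h hs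
  refine Inj.perm ?_ hp
  obtain ⟨c, b, a, rfl⟩ := List.length_eq_three.mp hl
  simp only [List.pairwise_cons, List.mem_cons, List.not_mem_nil, or_false, List.sum_cons,
    List.sum_nil, forall_eq_or_imp, forall_eq] at hs' h3 h hs
  exact (inj_three (a := a) (b := b) (c := c) (by omega) (by omega) (by omega) (by omega)).perm
    ((List.perm_append_comm (l₁ := [a, b]) (l₂ := [c])).trans (.cons _ (.swap _ _ _)))

omit [Infinite k] in
lemma Inj.split_last {a b c e : ℕ} (h : Inj k [a, b, c + e]) : Inj k [a, b, c, e] :=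
  ((h.perm (List.perm_append_comm (l₁ := [a, b]) (l₂ := [c + e]))).split).perm
    (List.perm_append_comm (l₁ := [c, e]) (l₂ := [a, b]))

lemma inj_four {a b c e : ℕ} (hab : b ≤ a) (hbc : c ≤ b) (hce : e ≤ c) (he : 1 ≤ e)
    (h : a < b + c + e) (h' : 2 ≤ c ∨ 8 ≤ a + b) : Inj k [a, b, c, e] := by
  by_cases h1 : 3 ≤ b ∧ 3 ≤ c + e
  · have key : ∀ {e : ℕ}, e ≤ c → a < b + c + e → e < a → 3 ≤ c + e → 10 ≤ a + b + c + e →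
        Inj k [a, b, c, e] := fun h2 h3 h4 h5 h6 => Inj.split_last
      (inj_of_length_eq_three rfl (by simp; omega) (by simp; omega) (by simp; omega))
    rcases (hce.trans (hbc.trans hab)).lt_or_eq with h2 | rfl
    · by_cases h3 : 10 ≤ a + b + c + e
      · exact key hce h h2 h1.2 h3
      · obtain ⟨rfl, rfl, rfl, rfl⟩ : a = 3 ∧ b = 3 ∧ c = 2 ∧ e = 1 := by omega
        exact ((inj_2221.succ (by simp)).perm (l' := [2, 3, 2, 1]) (by decide)).succ (by simp)
    · obtain ⟨rfl, rfl⟩ : b = e ∧ c = e := by omega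
      obtain ⟨n, rfl⟩ := Nat.exists_eq_add_one_of_ne_zero (Nat.ne_zero_of_lt h1.1)
      exact ((key (e := n) (by omega) (by omega) (by omega) (by omega) (by omega)).perm
        (List.perm_append_comm (l₁ := [n + 1, n + 1, n + 1]) (l₂ := [n]))).succ (by simp; omega)
  by_cases h2 : c + e = 2
  · obtain ⟨rfl, rfl⟩ : c = 1 ∧ e = 1 := by omega
    by_cases h3 : 6 ≤ b
    · exact Inj.split_last (inj_three (c := 1 + 1) hab (by omega) (by omega) (by omega))
    have h₅ : Inj k [5, 4, 1, 1] := inj_4411.succ (by simp)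
    have h₆ : Inj k [5, 5, 1, 1] := (h₅.perm (.swap _ _ _)).succ (by simp)
    obtain ⟨rfl, rfl⟩ | ⟨rfl, rfl⟩ | ⟨rfl, rfl⟩ | ⟨rfl, rfl⟩ : (a = 4 ∧ b = 4) ∨ (a = 5 ∧ b = 4) ∨
      (a = 5 ∧ b = 5) ∨ (a = 6 ∧ b = 5) := by omega
    exacts [inj_4411, h₅, h₆, h₆.succ (by simp)]
  · obtain ⟨rfl, rfl⟩ : b = 2 ∧ c = 2 := by omega
    have h₃ : Inj k [3, 2, 2, 1] := inj_2221.succ (by simp)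
    have h₂ : Inj k [2, 2, 2, 2] :=
      (inj_2221.perm (List.perm_append_comm (l₁ := [2, 2, 2]) (l₂ := [1]))).succ (by simp)
    have h₃' : Inj k [3, 2, 2, 2] := h₂.succ (by simp)
    have h₄' : Inj k [4, 2, 2, 2] := h₃'.succ (by simp)
    obtain rfl | rfl : e = 1 ∨ e = 2 := by omega
    · obtain rfl | rfl | rfl : a = 2 ∨ a = 3 ∨ a = 4 := by omega
      exacts [inj_2221, h₃, h₃.succ (by simp)]
    · obtain rfl | rfl | rfl | rfl : a = 2 ∨ a = 3 ∨ a = 4 ∨ a = 5 := by omega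
      exacts [h₂, h₃', h₄', h₄'.succ (by simp)]

lemma inj_of_length_eq_four {l : List ℕ} (hl : l.length = 4) (hpos : ∀ x ∈ l, 1 ≤ x)
    (h : ∀ x ∈ l, 2 * x < l.sum) (h' : l.count 1 ≤ 1 ∨ 10 ≤ l.sum) : Inj k l := by
  obtain ⟨l', hp, hs'⟩ := exists_sorted_perm l
  rw [← hp.length_eq] at hl
  simp only [← hp.mem_iff, ← hp.sum_eq, ← hp.count_eq] at hpos h h'
  refine Inj.perm ?_ hp
  obtain ⟨e, c, b, a, rfl⟩ : ∃ e c b a, l' = [e, c, b, a] := by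
    match l', hl with
    | [e, c, b, a], _ => exact ⟨e, c, b, a, rfl⟩
  have hc : 2 ≤ c ∨ 10 ≤ [e, c, b, a].sum := by
    refine h'.imp_left fun h' => ?_
    by_contra! hc
    obtain ⟨rfl, rfl⟩ : e = 1 ∧ c = 1 := by
      simp only [List.pairwise_cons, List.mem_cons, forall_eq_or_imp] at hs' hpos
      omega
    simp [List.count_cons] at h'
  simp only [List.pairwise_cons, List.mem_cons, List.not_mem_nil, or_false, List.sum_cons,
    List.sum_nil, forall_eq_or_imp, forall_eq] at hs' hpos h hc
  refine (inj_four (a := a) (b := b) (c := c) (e := e) (by omega) (by omega) (by omega) (by omega)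
    (by omega) (by omega)).perm ?_
  simpa using (List.reverse_perm [a, b, c, e]).symm

lemma inj_of_five_le_length {l : List ℕ} (hl : 5 ≤ l.length) (hpos : ∀ x ∈ l, 1 ≤ x)
    (h : ∀ x ∈ l, 2 * x < l.sum) (h' : l.length = 5 → 6 ≤ l.sum) : Inj k l := by
  induction hn : l.length using Nat.strong_induction_on generalizing l with
  | _ n ih =>
    obtain ⟨l', hp, hs⟩ := exists_sorted_perm l
    rw [← hp.length_eq] at hl hn h'
    simp only [← hp.mem_iff, ← hp.sum_eq] at hpos h h'
    refine Inj.perm ?_ hp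
    clear hp
    obtain ⟨x, y, r, rfl⟩ : ∃ x y r, l' = x :: y :: r := by
      match l', hl with
      | x :: y :: r, _ => exact ⟨x, y, r, rfl⟩
    simp only [List.pairwise_cons, List.mem_cons, forall_eq_or_imp, List.sum_cons,
      List.length_cons] at hs hpos h hl hn h'
    have hr' : r.length * y ≤ r.sum := List.card_nsmul_le_sum r y hs.2.1
    have hr : 3 * y ≤ r.sum := (Nat.mul_le_mul_right y (by omega)).trans hr'
    have hr'' : r.length ≤ r.sum := (Nat.le_mul_of_pos_right _ hpos.2.1).trans hr'
    have hpos' : ∀ z ∈ (x + y) :: r, 1 ≤ z := by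
      simp only [List.mem_cons, forall_eq_or_imp]; exact ⟨by omega, hpos.2.2⟩
    have h2 : ∀ z ∈ (x + y) :: r, 2 * z < ((x + y) :: r).sum := by
      simp only [List.mem_cons, forall_eq_or_imp, List.sum_cons]
      exact ⟨by omega, fun z hz => by have := h.2.2 z hz; omega⟩
    rcases hl.lt_or_eq with h5 | h5
    · exact (ih _ (by rw [List.length_cons]; omega) (by rw [List.length_cons]; omega) hpos' h2
        (fun _ => by rw [List.sum_cons]; omega) rfl).split
    obtain ⟨p, q, w, rfl⟩ := List.length_eq_three.mp (show r.length = 3 by omega)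
    by_cases hq : 2 ≤ q
    · refine (inj_of_length_eq_four (by simp) hpos' h2 (Or.inl ?_)).split
      simp only [List.mem_cons, forall_eq_or_imp, List.pairwise_cons] at hs
      have : ¬ x + y = 1 := by omega
      have : ¬ w = 1 := by have := hs.2.2.2.1; simp at this; omega
      have : ¬ q = 1 := by omega
      simp only [List.count_cons, List.count_nil, beq_iff_eq, *, if_false]
      split_ifs <;> simp
    · simp only [List.mem_cons, forall_eq_or_imp, List.pairwise_cons, List.sum_cons,
        List.not_mem_nil, or_false, forall_eq, List.sum_nil] at hs hpos h h'
      obtain ⟨rfl, rfl, rfl, rfl⟩ : x = 1 ∧ y = 1 ∧ p = 1 ∧ q = 1 := by omega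
      have key : Inj k [w, 1, 1, 1, 1] := by
        obtain rfl | rfl : w = 2 ∨ w = 3 := by omega
        exacts [inj_21111, inj_21111.succ (by simp)]
      exact key.perm (List.perm_append_comm (l₁ := [w]) (l₂ := [1, 1, 1, 1]))

lemma surj_one (a : ℕ) : Surj k [a + 1, a + 1, 1] := by
  induction a with
  | zero =>
    have h : Surj k [0, 0, 1] :=
      ⟨0, fun e he => absurd (mem_pts.mp he).2.2.1 (by
        have h1 := (mem_pts.mp he).2.1
        have h2 := (mem_pts.mp he).2.2.2
        rcases he1 : e.1.2.1 with _ | _ | n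
        · simp
        · simp
        · rw [he1] at h1
          rw [List.getD_eq_default _ _ (by simp; omega)] at h2
          simp at h2)⟩
    exact ((h.succ (by simp)).perm (l' := [0, 1, 1]) (by decide)).succ (by simp)
  | succ a ih => exact ((ih.succ (by simp)).perm (.swap _ _ _)).succ (by simp)

/-- Below the hyperplane the intersection points impose independent conditions on forms of degree
`l.sum`, or no such form passes through them. -/
theorem surj_or_inj {l : List ℕ} (hl : 3 ≤ l.length) (hpos : ∀ x ∈ l, 1 ≤ x)
    (h : ∀ x ∈ l, 2 * x < l.sum) : Surj k l ∨ Inj k l := by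
  have s2211 : Surj k [2, 2, 1, 1] :=
    (surj_21111.perm (l' := [1, 1, 2, 1, 1]) (by decide)).merge
  have s3211 : Surj k [3, 2, 1, 1] :=
    (((surj_21111.succ (by simp)).perm (l' := [1, 1, 3, 1, 1]) (by decide)).merge).perm
      (.swap _ _ _)
  have s332 : Surj k [3, 3, 2] :=
    (surj_3311.perm (l' := [1, 1, 3, 3]) (by decide)).merge.perm (by decide)
  have s442 : Surj k [4, 4, 2] :=
    (surj_4411.perm (l' := [1, 1, 4, 4]) (by decide)).merge.perm (by decide)
  obtain ⟨l', hp, hs⟩ := exists_sorted_perm l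
  rw [← hp.length_eq] at hl
  simp only [← hp.mem_iff, ← hp.sum_eq] at hpos h
  suffices Surj k l' ∨ Inj k l' from this.imp (·.perm hp) (·.perm hp)
  clear hp
  match l', hl with
  | [c, b, a], _ =>
    simp only [List.pairwise_cons, List.mem_cons, List.not_mem_nil, or_false, List.sum_cons,
      List.sum_nil, forall_eq_or_imp, forall_eq] at hs hpos h
    have hperm : [a, b, c].Perm [c, b, a] := by simpa using (List.reverse_perm [a, b, c]).symm
    suffices Surj k [a, b, c] ∨ Inj k [a, b, c] from this.imp (·.perm hperm) (·.perm hperm)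
    by_cases h1 : 3 ≤ c ∧ 4 ≤ a ∨ c = 2 ∧ 6 ≤ b
    · exact Or.inr (inj_three (by omega) (by omega) (by omega) h1)
    left
    obtain rfl | rfl | ⟨rfl, rfl, rfl⟩ : c = 1 ∨ c = 2 ∨ (c = 3 ∧ b = 3 ∧ a = 3) := by omega
    · obtain ⟨n, rfl⟩ := Nat.exists_eq_add_one_of_ne_zero (show a ≠ 0 by omega)
      obtain rfl : b = n + 1 := by omega
      exact surj_one n
    · obtain ⟨rfl, rfl⟩ | ⟨rfl, rfl⟩ | ⟨rfl, rfl⟩ | ⟨rfl, rfl⟩ | ⟨rfl, rfl⟩ | ⟨rfl, rfl⟩ |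
        ⟨rfl, rfl⟩ | ⟨rfl, rfl⟩ :
        (b = 2 ∧ a = 2) ∨ (b = 2 ∧ a = 3) ∨ (b = 3 ∧ a = 3) ∨ (b = 3 ∧ a = 4) ∨
        (b = 4 ∧ a = 4) ∨ (b = 4 ∧ a = 5) ∨ (b = 5 ∧ a = 5) ∨ (b = 5 ∧ a = 6) := by omega
      exacts [(s2211.perm (l' := [1, 1, 2, 2]) (by decide)).merge,
        (s3211.perm (l' := [1, 1, 3, 2]) (by decide)).merge.perm (.swap _ _ _),
        s332, s332.succ (by simp), s442, s442.succ (by simp), surj_552, surj_552.succ (by simp)]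
    · exact surj_333
  | [e, c, b, a], _ =>
    simp only [List.pairwise_cons, List.mem_cons, List.not_mem_nil, or_false, List.sum_cons,
      List.sum_nil, forall_eq_or_imp, forall_eq] at hs hpos h
    have hperm : [a, b, c, e].Perm [e, c, b, a] := by
      simpa using (List.reverse_perm [a, b, c, e]).symm
    suffices Surj k [a, b, c, e] ∨ Inj k [a, b, c, e] from
      this.imp (·.perm hperm) (·.perm hperm)
    by_cases h1 : 2 ≤ c ∨ 8 ≤ a + b
    · exact Or.inr (inj_four (by omega) (by omega) (by omega) (by omega) (by omega) h1)
    left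
    obtain ⟨rfl, rfl⟩ : c = 1 ∧ e = 1 := by omega
    obtain ⟨rfl, rfl⟩ | ⟨rfl, rfl⟩ | ⟨rfl, rfl⟩ | ⟨rfl, rfl⟩ | ⟨rfl, rfl⟩ | ⟨rfl, rfl⟩ :
      (b = 1 ∧ a = 1) ∨ (b = 1 ∧ a = 2) ∨ (b = 2 ∧ a = 2) ∨ (b = 2 ∧ a = 3) ∨ (b = 3 ∧ a = 3) ∨
      (b = 3 ∧ a = 4) := by omega
    exacts [surj_1111, surj_11111.merge, s2211, s3211, surj_3311, surj_3311.succ (by simp)]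
  | x :: y :: z :: u :: v :: r, _ =>
    by_cases h1 : (x :: y :: z :: u :: v :: r).length = 5 ∧ (x :: y :: z :: u :: v :: r).sum < 6
    · obtain rfl : r = [] := List.length_eq_zero_iff.mp (by simpa using h1.1)
      simp only [List.mem_cons, List.not_mem_nil, or_false, List.sum_cons,
        List.sum_nil, forall_eq_or_imp, forall_eq] at hpos h1
      obtain ⟨rfl, rfl, rfl, rfl, rfl⟩ : x = 1 ∧ y = 1 ∧ z = 1 ∧ u = 1 ∧ v = 1 := by omega
      exact Or.inl surj_11111
    · exact Or.inr (inj_of_five_le_length (by simp) hpos h fun h2 =>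
        not_lt.mp fun h3 => h1 ⟨h2, h3⟩)

end

/-! ### Ideals of intersection points -/

lemma finrank_homogeneousSubmodule (n : ℕ) :
    Module.finrank k (homogeneousSubmodule (Fin 3) k n) = (n + 2).choose 2 := by
  have h : {m : Fin 3 →₀ ℕ | m.degree = n} =
      ((univ : Finset (Fin 3)).finsuppAntidiag n : Set _) := by
    ext m
    simp [mem_finsuppAntidiag, Finsupp.degree_eq_sum]
  rw [homogeneousSubmodule_eq_finsupp_supported, h,
    (AddMonoidAlgebra.supportedEquivFinsupp _).finrank_eq, Module.finrank_finsupp_self,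
    Fintype.card_of_finset' _ fun m => mem_coe.symm, card_finsuppAntidiag_nat_eq_choose,
    card_univ, Fintype.card_fin,
    show 3 + n - 1 = n + 2 by omega, Nat.choose_symm_add]

instance (n : ℕ) : Module.Finite k (homogeneousSubmodule (Fin 3) k n) :=
  Module.Finite.iff_fg.mpr (homogeneousSubmodule_fg (Fin 3) k n)

lemma Separates.finrank_add_card {ι : Type*} {p : ι → Fin 3 → k} {S : Finset ι} {t : ℕ}
    (h : Separates p S t) {M : Submodule k (MvPolynomial (Fin 3) k)}
    (hM : ∀ f, f ∈ M ↔ f.IsHomogeneous t ∧ ∀ i ∈ S, eval (p i) f = 0) :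
    Module.finrank k M + #S = (t + 2).choose 2 := by
  classical
  let φ : homogeneousSubmodule (Fin 3) k t →ₗ[k] S → k :=
    LinearMap.pi fun i => (aeval (p i)).toLinearMap ∘ₗ Submodule.subtype _
  have hφ : ∀ f i, φ f i = eval (p i) f.1 := fun f i => by simp [φ, aeval_eq_eval]
  have hr : LinearMap.range φ = ⊤ := by
    rw [eq_top_iff, ← (Pi.basisFun k S).span_eq, Submodule.span_le]
    rintro _ ⟨i, rfl⟩
    obtain ⟨f, h1, h2, h3⟩ := h i i.2
    refine ⟨(eval (p i) f)⁻¹ • ⟨f, h1⟩, ?_⟩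
    ext j
    rw [map_smul, Pi.smul_apply, hφ, Pi.basisFun_apply, smul_eq_mul]
    by_cases hj : j = i
    · subst hj
      simp [h2]
    · rw [h3 j j.2 fun h => hj (Subtype.ext h), mul_zero, Pi.single_eq_of_ne hj]
  have hk : (LinearMap.ker φ).map (Submodule.subtype _) = M := by
    ext f
    simp only [Submodule.mem_map, LinearMap.mem_ker, Submodule.subtype_apply, hM]
    constructor
    · rintro ⟨g, hg, rfl⟩
      exact ⟨g.2, fun i hi => by rw [← hφ g ⟨i, hi⟩, hg, Pi.zero_apply]⟩
    · rintro ⟨h1, h2⟩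
      exact ⟨⟨f, h1⟩, funext fun i => by rw [hφ, h2 i i.2, Pi.zero_apply], rfl⟩
  have h1 := φ.finrank_range_add_finrank_ker
  rw [hr, finrank_top, Module.finrank_fintype_fun_eq_card, Fintype.card_coe,
    finrank_homogeneousSubmodule] at h1
  rw [← hk, Submodule.finrank_map_subtype_eq, add_comm, h1]

lemma Separates.eq_zero {ι : Type*} {p : ι → Fin 3 → k} {S : Finset ι} {t : ℕ}
    (h : Separates p S t) (hS : #S = (t + 2).choose 2) {f : MvPolynomial (Fin 3) k}
    (hf : f.IsHomogeneous t) (hf' : ∀ i ∈ S, eval (p i) f = 0) : f = 0 := by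
  let M := homogeneousSubmodule (Fin 3) k t ⊓ ⨅ i ∈ S, LinearMap.ker (aeval (p i)).toLinearMap
  have hM : ∀ f, f ∈ M ↔ f.IsHomogeneous t ∧ ∀ i ∈ S, eval (p i) f = 0 := fun f => by
    simp [M, Submodule.mem_iInf, aeval_eq_eval]
  have h1 := h.finrank_add_card hM
  rw [hS, Nat.add_eq_right, Submodule.finrank_eq_zero] at h1
  simpa [h1] using (hM f).mpr ⟨hf, hf'⟩

lemma lin_add (u v : Fin 3 → k) : lin (u + v) = lin u + lin v := by
  simp [lin, add_mul, sum_add_distrib]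

lemma lin_smul (c : k) (v : Fin 3 → k) : lin (c • v) = C c * lin v := by
  simp [lin, mul_sum, mul_assoc]

lemma lin_single (i : Fin 3) : lin (Pi.single i 1 : Fin 3 → k) = X i := by
  simp [lin, Pi.single_apply, apply_ite C]

/-- Restriction of polynomials to the line through the origin and `p`. -/
noncomputable def cone (p : Fin 3 → k) : MvPolynomial (Fin 3) k →ₐ[k] Polynomial k :=
  aeval fun i => Polynomial.C (p i) * Polynomial.X

lemma cone_lin (p v : Fin 3 → k) : cone p (lin v) = Polynomial.C (v ⬝ᵥ p) * Polynomial.X := by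
  simp only [cone, lin, dotProduct, map_sum, map_mul, aeval_X, algHom_C, sum_mul, mul_assoc]
  rfl

lemma cone_eq_zero [Infinite k] {f : MvPolynomial (Fin 3) k} {t : ℕ} (hf : f.IsHomogeneous t)
    {p : Fin 3 → k} (h : eval p f = 0) : cone p f = 0 := by
  refine Polynomial.funext fun c => ?_
  have key : (Polynomial.evalRingHom c).comp (cone p : _ →+* _) = eval (c • p) := by
    ext i
    · simp [cone]
    · simp [cone, mul_comm c]
  have := RingHom.congr_fun key f
  rw [hf.eval_smul, h, mul_zero] at this
  simpa using this

lemma mem_span_of_cone_eq_zero {f : MvPolynomial (Fin 3) k} {u v : Fin 3 → k} (h : u ⨯₃ v ≠ 0)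
    (hf : cone (u ⨯₃ v) f = 0) : f ∈ Ideal.span {lin u, lin v} := by
  obtain ⟨w, hw⟩ := exists_dot_ne_zero h
  let ψ : Polynomial k →ₐ[k] MvPolynomial (Fin 3) k ⧸ Ideal.span {lin u, lin v} :=
    Polynomial.aeval (Ideal.Quotient.mk _ (C (w ⬝ᵥ u ⨯₃ v)⁻¹ * lin w))
  have key : ψ.comp (cone (u ⨯₃ v)) = Ideal.Quotient.mkₐ k _ := by
    ext i
    obtain ⟨x, hx⟩ := exists_cross_eq h
      (m := Pi.single i 1 + (-((w ⬝ᵥ u ⨯₃ v)⁻¹ * (u ⨯₃ v) i)) • w)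
      (by simp [add_dotProduct, smul_dotProduct, hw, mul_assoc, mul_left_comm])
    rw [cross_cross_eq_smul_sub_smul, sub_eq_add_neg, ← neg_smul] at hx
    have hx' := congr_arg lin hx
    simp only [lin_add, lin_smul, lin_single] at hx'
    have : ψ (cone (u ⨯₃ v) (X i)) = Ideal.Quotient.mk _
        (C ((w ⬝ᵥ u ⨯₃ v)⁻¹ * (u ⨯₃ v) i) * lin w) := by
      have hC : ∀ c : k, algebraMap k (MvPolynomial (Fin 3) k ⧸ Ideal.span {lin u, lin v}) c =
        Ideal.Quotient.mk _ (C c) := fun _ => rfl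
      simp only [ψ, cone, aeval_X, map_mul, Polynomial.aeval_C, Polynomial.aeval_X, hC]
      ring
    rw [AlgHom.comp_apply, this, eq_comm]
    refine Ideal.Quotient.eq.mpr (Ideal.mem_span_pair.mpr ⟨C (-(v ⬝ᵥ x)), C (u ⬝ᵥ x), ?_⟩)
    simp only [C_neg] at hx' ⊢
    linear_combination hx'
  have := AlgHom.congr_fun key f
  rw [AlgHom.comp_apply, hf, map_zero] at this
  exact Ideal.Quotient.eq_zero_iff_mem.mp this.symm

lemma mem_span_prod {V : Type*} {l : V → Fin 3 → k} {A : Finset V} {Q : MvPolynomial (Fin 3) k}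
    {S : V → Set (Fin 3 → k)} (hS : ∀ a ∈ A, ∀ p ∈ S a, cone p Q = 0)
    (hS' : ∀ a ∈ A, ∀ b ∈ A, a ≠ b → ∀ p ∈ S b, l a ⬝ᵥ p ≠ 0)
    (h : ∀ a ∈ A, ∀ f, (∀ p ∈ S a, cone p f = 0) → f ∈ Ideal.span {lin (l a), Q})
    {f : MvPolynomial (Fin 3) k} (hf : ∀ a ∈ A, ∀ p ∈ S a, cone p f = 0) :
    f ∈ Ideal.span {∏ a ∈ A, lin (l a), Q} := by
  classical
  induction A using Finset.induction_on generalizing f with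
  | empty => simp [Ideal.span_insert, Ideal.span_singleton_one]
  | insert a A ha ih =>
    simp only [mem_insert, forall_eq_or_imp] at hS hS' h hf
    obtain ⟨x, y, rfl⟩ := Ideal.mem_span_pair.mp (h.1 f hf.1)
    have hx : ∀ b ∈ A, ∀ p ∈ S b, cone p x = 0 := fun b hb p hp => by
      have h1 := hf.2 b hb p hp
      rw [map_add, map_mul, map_mul, hS.2 b hb p hp, mul_zero, add_zero, cone_lin] at h1
      refine (mul_eq_zero.mp h1).resolve_right (mul_ne_zero ?_ Polynomial.X_ne_zero)
      rw [Polynomial.C_ne_zero]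
      exact hS'.1.2 b hb (by rintro rfl; exact ha hb) p hp
    obtain ⟨x', y', rfl⟩ := Ideal.mem_span_pair.mp
      (ih hS.2 (fun b hb => (hS'.2 b hb).2) h.2 hx)
    rw [Ideal.mem_span_pair, prod_insert ha]
    exact ⟨x', y' * lin (l a) + y, by ring⟩


/-- The product of the first `n` lines of colour `i` on the side `s`. -/
noncomputable def lineProd (p : Ln → Fin 3 → k) (s : Bool) (n i : ℕ) : MvPolynomial (Fin 3) k :=
  ∏ a ∈ range n, lin (p (s, i, a))

lemma lineProd_isHomogeneous (p : Ln → Fin 3 → k) (s : Bool) (n i : ℕ) :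
    (lineProd p s n i).IsHomogeneous n := by
  simpa [lineProd] using IsHomogeneous.prod (range n) _ (fun _ => 1)
    fun a _ => lin_isHomogeneous (p (s, i, a))

lemma lineProd_ne_zero {p : Ln → Fin 3 → k} {s : Bool} {n i : ℕ}
    (h : ∀ a < n, p (s, i, a) ≠ 0) : lineProd p s n i ≠ 0 := by
  refine prod_ne_zero_iff.mpr fun a ha h0 => ?_
  obtain ⟨w, hw⟩ := exists_dot_ne_zero (h a (mem_range.mp ha))
  rw [dotProduct_comm, ← eval_lin, h0, map_zero] at hw
  exact hw rfl

/-- A form vanishing at the intersection points of two transversal completely reducible curves lies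
in the ideal of these curves. -/
lemma mem_span_lineProd [Infinite k] {p : Ln → Fin 3 → k} {s : Bool} {i j m n : ℕ} (hij : i ≠ j)
    {W : Finset Ln} (hp : Exact [] W p) (hi : ∀ a < m, (s, i, a) ∈ W)
    (hj : ∀ b < n, (s, j, b) ∈ W) {f : MvPolynomial (Fin 3) k}
    (h : ∀ a < m, ∀ b < n, cone (p (s, i, a) ⨯₃ p (s, j, b)) f = 0) :
    f ∈ Ideal.span {lineProd p s m i, lineProd p s n j} := by
  have htp : ∀ x ∈ W, ∀ y ∈ W, ∀ z ∈ W, x ≠ y → x ≠ z → y ≠ z → p x ⬝ᵥ p y ⨯₃ p z ≠ 0 :=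
    fun x hx y hy z hz hxy hxz hyz h0 => by
      simpa [Coll] using (hp.2 x hx y hy z hz hxy hxz hyz).mp h0
  refine mem_span_prod (l := fun a => p (s, i, a))
    (S := fun a => {q | ∃ b < n, q = p (s, i, a) ⨯₃ p (s, j, b)}) ?_ ?_ ?_ ?_
  · rintro a - _ ⟨b, hb, rfl⟩
    rw [lineProd, map_prod, prod_eq_zero (mem_range.mpr hb)]
    rw [cone_lin, dot_cross_self, map_zero, zero_mul]
  · rintro a ha a' ha' hab _ ⟨b, hb, rfl⟩
    exact htp _ (hi a (mem_range.mp ha)) _ (hi a' (mem_range.mp ha')) _ (hj b hb)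
      (by simpa using hab) (by simp [hij]) (by simp [hij])
  · intro a ha f hf
    have ha' := hi a (mem_range.mp ha)
    rw [Set.pair_comm]
    refine mem_span_prod (l := fun b => p (s, j, b))
      (S := fun b => {p (s, i, a) ⨯₃ p (s, j, b)}) ?_ ?_ ?_ ?_
    · rintro b - _ rfl
      rw [cone_lin, dot_self_cross, map_zero, zero_mul]
    · rintro b hb b' hb' hbb _ rfl
      exact htp _ (hj b (mem_range.mp hb)) _ ha' _ (hj b' (mem_range.mp hb'))
        (by simp [hij.symm]) (by simpa using hbb) (by simp [hij])
    · intro b hb f hf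
      rw [Set.pair_comm]
      exact mem_span_of_cone_eq_zero (hp.1 _ ha' _ (hj b (mem_range.mp hb)) (by simp [hij]))
        (hf _ rfl)
    · rintro b hb _ rfl
      exact hf _ ⟨b, mem_range.mp hb, rfl⟩
  · rintro a ha _ ⟨b, hb, rfl⟩
    exact h a (mem_range.mp ha) b hb

section
variable {r : ℕ} {d : Fin r → ℕ}

lemma getD_ofFn (d : Fin r → ℕ) (i : Fin r) : (List.ofFn d).getD i 0 = d i := by
  simp [List.getD_eq_getElem?_getD]

lemma exists_fin_of_lt_getD {i a : ℕ} (h : a < (List.ofFn d).getD i 0) :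
    ∃ j : Fin r, i = j ∧ a < d j := by
  have hi : i < r := by
    by_contra! hi
    simp [List.getD_eq_getElem?_getD, hi] at h
  exact ⟨⟨i, hi⟩, rfl, getD_ofFn d ⟨i, hi⟩ ▸ h⟩

lemma card_pts (d : Fin r → ℕ) : #(Pts (List.ofFn d)) = 2 * Dval d := by
  have h : #((univ : Finset Bool) ×ˢ (univ.filter fun q : Fin r × Fin r => q.1 < q.2).sigma
      fun q => range (d q.1) ×ˢ range (d q.2)) = 2 * Dval d := by
    simp [card_product, card_sigma, Dval]
  rw [← h]
  symm
  refine card_bij (fun x _ => ((x.1, (x.2.1.1 : ℕ), x.2.2.1), (x.1, (x.2.1.2 : ℕ), x.2.2.2)))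
    ?_ ?_ ?_
  · rintro ⟨s, ⟨i, j⟩, a, b⟩ hx
    simp only [mem_product, mem_univ, mem_sigma, mem_filter, mem_range, true_and] at hx
    simpa [mem_pts, getD_ofFn] using hx
  · rintro ⟨s, ⟨i, j⟩, a, b⟩ - ⟨s', ⟨i', j'⟩, a', b'⟩ - h
    simp only [Prod.mk.injEq, Fin.val_inj] at h
    obtain ⟨⟨rfl, rfl, rfl⟩, -, rfl, rfl⟩ := h
    rfl
  · rintro ⟨⟨s, i, a⟩, s', j, b⟩ h
    rw [mem_pts] at h
    obtain ⟨h1, h2, h3, h4⟩ := h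
    obtain ⟨i, rfl, ha⟩ := exists_fin_of_lt_getD h3
    obtain ⟨j, rfl, hb⟩ := exists_fin_of_lt_getD h4
    obtain rfl : s = s' := h1
    exact ⟨(s, ⟨(i, j), (a, b)⟩), by simpa [ha, hb] using h2, rfl⟩

/-- The lines of the colour pattern `d`. -/
def lines (d : Fin r → ℕ) : Finset Ln := univ ×ˢ range r ×ˢ range (∑ i, d i)

lemma mem_lines {i : Fin r} {a : ℕ} (ha : a < d i) (s : Bool) : (s, (i : ℕ), a) ∈ lines d := by
  simpa [lines] using ha.trans_le (single_le_sum (fun _ _ => Nat.zero_le _) (mem_univ i))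

lemma eval_eq_zero_of_mem {p : Ln → Fin 3 → k} {f : MvPolynomial (Fin 3) k} {e : Ln × Ln}
    (he : e ∈ Pts (List.ofFn d))
    (hf : f ∈ idealOfForms fun i : Fin r => lineProd p e.1.1 (d i) i) : eval (pt p e) f = 0 := by
  obtain ⟨⟨s, i, a⟩, s', j, b⟩ := e
  rw [mem_pts] at he
  obtain ⟨h1, h2, h3, h4⟩ := he
  obtain ⟨i, rfl, ha⟩ := exists_fin_of_lt_getD h3
  obtain ⟨j, rfl, hb⟩ := exists_fin_of_lt_getD h4
  obtain rfl : s = s' := h1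
  simp only [idealOfForms, Ideal.mem_iInf] at hf
  obtain ⟨x, y, rfl⟩ := Ideal.mem_span_pair.mp (hf i j h2)
  have hi : eval (pt p ((s, ↑i, a), s, ↑j, b)) (lineProd p s (d i) i) = 0 := by
    rw [lineProd, map_prod]
    exact prod_eq_zero (mem_range.mpr ha) (by rw [eval_lin, pt, dot_self_cross])
  have hj : eval (pt p ((s, ↑i, a), s, ↑j, b)) (lineProd p s (d j) j) = 0 := by
    rw [lineProd, map_prod]
    exact prod_eq_zero (mem_range.mpr hb) (by rw [eval_lin, pt, dot_cross_self])
  simp [hi, hj]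

lemma mem_idealOfForms [Infinite k] {p : Ln → Fin 3 → k} (hp : Exact [] (lines d) p) (s : Bool)
    {f : MvPolynomial (Fin 3) k} {t : ℕ} (hft : f.IsHomogeneous t)
    (hf : ∀ e ∈ Pts (List.ofFn d), eval (pt p e) f = 0) :
    f ∈ idealOfForms fun i : Fin r => lineProd p s (d i) i := by
  simp only [idealOfForms, Ideal.mem_iInf]
  intro i j hij
  refine mem_span_lineProd (by simpa [Fin.val_inj] using hij.ne) hp (fun a ha => mem_lines ha s)
    (fun b hb => mem_lines hb s) fun a ha b hb => cone_eq_zero hft ?_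
  exact hf ((s, i, a), s, j, b) (mem_pts.mpr ⟨rfl, hij, by simpa [getD_ofFn], by simpa [getD_ofFn]⟩)

theorem exists_forms [Infinite k] {E : Finset (Ln × Ln)}
    (hE : E ⊆ Pts (List.ofFn d)) (h : Indep k E (∑ i, d i))
    (h' : E = Pts (List.ofFn d) ∨ #E = ((∑ i, d i) + 2).choose 2) :
    ∃ F G : Fin r → MvPolynomial (Fin 3) k,
      (∀ i, F i ≠ 0 ∧ (F i).IsHomogeneous (d i)) ∧
      (∀ i, G i ≠ 0 ∧ (G i).IsHomogeneous (d i)) ∧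
      gradedDim (idealOfForms F ⊓ idealOfForms G) (∑ i, d i) + #E = ((∑ i, d i) + 2).choose 2 := by
  obtain ⟨p, hp, hs⟩ := h.gen (lines d)
  have h0 : ∀ s, ∀ i : Fin r, ∀ a < d i, p (s, i, a) ≠ 0 := fun s i a ha h0 => by
    simpa [h0] using hp.1 _ (mem_lines ha s) _ (mem_lines ha !s) (by simp)
  refine ⟨fun i => lineProd p false (d i) i, fun i => lineProd p true (d i) i,
    fun i => ⟨lineProd_ne_zero (h0 _ i), lineProd_isHomogeneous _ _ _ _⟩,
    fun i => ⟨lineProd_ne_zero (h0 _ i), lineProd_isHomogeneous _ _ _ _⟩, ?_⟩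
  have hI : ∀ {f}, f ∈ idealOfForms (fun i : Fin r => lineProd p false (d i) i) ⊓
      idealOfForms (fun i : Fin r => lineProd p true (d i) i) →
      ∀ e ∈ E, eval (pt p e) f = 0 := fun {f} hf e he =>
    eval_eq_zero_of_mem (hE he) (by cases e.1.1; exacts [hf.1, hf.2])
  refine hs.finrank_add_card fun f => ⟨fun hf => ⟨hf.2, hI hf.1⟩, fun hf => ⟨?_, hf.1⟩⟩
  rcases h' with rfl | h'
  · exact ⟨mem_idealOfForms hp _ hf.1 hf.2, mem_idealOfForms hp _ hf.1 hf.2⟩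
  · rw [hs.eq_zero h' hf.1 hf.2]
    exact zero_mem _
end

end LineArrangement

/-- Proposition 4.7(i): if `d₁ < s` then for general `[F], [G] ∈ X_{2,λ}` the space
`(I_F ∩ I_G)_d` has the expected dimension `max {0, C(d+2,2) - 2D}`. -/
theorem expected_dimension_below_hyperplane
    {k : Type*} [Field k] [IsAlgClosed k]
    (r : ℕ) [NeZero r] (hr : 2 ≤ r)
    (d : Fin r → ℕ)
    (hanti : ∀ i j : Fin r, i ≤ j → d j ≤ d i)
    (hpos : ∀ i, 1 ≤ d i)
    (hds : d 0 < sval d) :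
    ∃ F G : Fin r → MvPolynomial (Fin 3) k,
      (∀ i, F i ≠ 0 ∧ (F i).IsHomogeneous (d i)) ∧
      (∀ i, G i ≠ 0 ∧ (G i).IsHomogeneous (d i)) ∧
      (gradedDim (idealOfForms F ⊓ idealOfForms G) (∑ i, d i) : ℤ) =
        max 0 ((((∑ i, d i) + 2).choose 2 : ℤ) - 2 * Dval d) := by
  have hsum : ∑ i, d i = d 0 + sval d := by
    rw [sval, ← sum_filter_add_sum_filter_not univ (fun i : Fin r => i.val = 0)]
    congr 1
    rw [show univ.filter (fun i : Fin r => i.val = 0) = {0} by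
      ext i; rw [mem_filter, mem_singleton, Fin.ext_iff]; simp, sum_singleton]
  have hr3 : 3 ≤ r := by
    by_contra! h
    obtain rfl : r = 2 := by omega
    have := hanti 0 1 (Fin.zero_le _)
    rw [Fin.sum_univ_two] at hsum
    omega
  have hlsum : (List.ofFn d).sum = ∑ i, d i := List.sum_ofFn
  have key : LineArrangement.Surj k (List.ofFn d) ∨ LineArrangement.Inj k (List.ofFn d) := by
    refine LineArrangement.surj_or_inj (by simpa) ?_ ?_ <;> simp only [List.forall_mem_ofFn_iff]
    · exact hpos
    · intro i
      have := hanti 0 i (Fin.zero_le _)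
      rw [hlsum]
      omega
  obtain ⟨E, hE, h1, h2⟩ : ∃ E ⊆ LineArrangement.Pts (List.ofFn d),
      LineArrangement.Indep k E (∑ i, d i) ∧
      (E = LineArrangement.Pts (List.ofFn d) ∨ #E = ((∑ i, d i) + 2).choose 2) := by
    rw [← hlsum]
    rcases key with h | ⟨E, hE, hc, h⟩
    · exact ⟨_, Subset.rfl, h, Or.inl rfl⟩
    · exact ⟨E, hE, h, Or.inr hc.symm⟩
  obtain ⟨F, G, hF, hG, hFG⟩ := LineArrangement.exists_forms hE h1 h2
  refine ⟨F, G, hF, hG, ?_⟩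
  have hcard := card_le_card hE
  rw [LineArrangement.card_pts] at hcard
  rcases h2 with rfl | h2
  · rw [LineArrangement.card_pts] at hFG
    omega
  · omega
end
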